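/- arXiv:1508.05524 — 5 statements merged into one kernel-verified Lean document; each statement's English description precedes it below -/
import Mathlib

section
/- Let G = ℤ/Nℤ be a finite cyclic group of order N and let r be an integer with 1 ≤ r ≤ N. Then ρ_G⁻(r) = min over positive divisors d of N of d·(2·⌈r/d⌉ − 1). -/
open Pointwise

/-- `rhoMinus G r` is the minimum cardinality of `A - A` over subsets `A ⊆ G` with `|A| = r`. -/
noncomputable def rhoMinus (G : Type*) [AddCommGroup G] [Fintype G] [DecidableEq G] (r : ℕ) : ℕ :=
  sInf {n : ℕ | ∃ A : Finset G, A.card = r ∧ (A - A).card = n}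

/-- `C` is a union of cosets of `H`. -/
def PerKn {G : Type*} [AddCommGroup G] (H : AddSubgroup G) (C : Finset G) : Prop :=
  ∀ h ∈ H, ∀ x ∈ C, x + h ∈ C

lemma PerKn.dvd {G : Type*} [AddCommGroup G] {H : AddSubgroup G} {C : Finset G}
    (hC : PerKn H C) : Nat.card H ∣ C.card := by
  classical
  have h := Nat.card_congr (QuotientAddGroup.preimageMkEquivAddSubgroupProdSet H
    ((QuotientAddGroup.mk : G → G ⧸ H) '' (C : Set G)))
  have e : ((QuotientAddGroup.mk : G → G ⧸ H) ⁻¹' ((QuotientAddGroup.mk : G → G ⧸ H) '' (C : Set G)))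
      = (C : Set G) := by
    ext x
    constructor
    · rintro ⟨y, hy, hxy⟩
      have := hC _ (QuotientAddGroup.eq.1 hxy) y hy
      simpa using this
    · intro hx
      exact ⟨x, hx, rfl⟩
  rw [e] at h
  have h' : C.card = Nat.card (C : Set G) := by simp
  rw [h', h, Nat.card_prod]
  exact Dvd.intro _ rfl

lemma kn_fib {G : Type*} [AddCommGroup G] [Fintype G] [DecidableEq G] (H K : AddSubgroup G)
    (S T D : Finset G) (z : G) (hS : ∀ x ∈ S, x ∈ H) (hT : ∀ x ∈ T, x ∈ K)
    (hD : ∀ x ∈ S, ∀ y ∈ T, z + x + y ∈ D) :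
    S.card * T.card ≤ Nat.card (H ⊓ K : AddSubgroup G) * D.card := by
  classical
  rw [← Finset.card_product]
  refine Finset.card_le_mul_card_image_of_maps_to (f := fun p => z + p.1 + p.2) ?_ _ ?_
  · intro p hp
    rw [Finset.mem_product] at hp
    exact hD _ hp.1 _ hp.2
  · intro b _
    rcases Finset.eq_empty_or_nonempty {a ∈ S ×ˢ T | z + a.1 + a.2 = b} with h | ⟨p0, h0⟩
    · rw [h]; simp
    · have : Nat.card (H ⊓ K : AddSubgroup G) =
          (Finset.univ.filter (fun x => x ∈ (H ⊓ K : AddSubgroup G))).card := by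
        rw [Nat.card_eq_fintype_card, Fintype.card_subtype]
      rw [this]
      simp only [Finset.mem_filter, Finset.mem_product] at h0
      apply Finset.card_le_card_of_injOn (fun p => p.1 - p0.1)
      · intro p hp
        simp only [Finset.coe_filter, Finset.mem_product, Set.mem_ofPred_eq] at hp
        simp only [Finset.coe_filter, Finset.mem_univ, true_and, Set.mem_ofPred_eq,
          AddSubgroup.mem_inf]
        refine ⟨H.sub_mem (hS _ hp.1.1) (hS _ h0.1.1), ?_⟩
        have : p.1 - p0.1 = p0.2 - p.2 := by
          have := hp.2.trans h0.2.symm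
          rw [sub_eq_sub_iff_add_eq_add]
          rw [add_assoc, add_assoc] at this
          rw [add_left_cancel this, add_comm]
        rw [this]
        exact K.sub_mem (hT _ h0.1.2) (hT _ hp.1.2)
      · intro p hp q hq hpq
        simp only [Finset.coe_filter, Finset.mem_product, Set.mem_ofPred_eq] at hp hq
        have h1 : p.1 = q.1 := sub_left_injective hpq
        have h2 := hp.2.trans hq.2.symm
        rw [h1] at h2
        exact Prod.ext h1 (add_left_cancel h2)

lemma kn_arith (k b x y a U V : ℕ) (hb : 0 < k * b) (hx : 0 < k * x)
    (h1 : (k * b) * (k * x) ≤ k * U) (h2 : (k * y) * (k * a) ≤ k * V)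
    (hU : U + k < k * b + k * y) (hV : V + k < k * x + k * a) :
    k * x + k * a < k * b + k * y := by
  have hk : 0 < k := Nat.pos_of_mul_pos_right hb
  have hb' : 0 < b := Nat.pos_of_mul_pos_left hb
  have hx' : 0 < x := Nat.pos_of_mul_pos_left hx
  have h1' : k * (b * x) ≤ U := by
    refine Nat.le_of_mul_le_mul_left (?_ : k * _ ≤ k * _) hk
    calc _ = _ := by ring
      _ ≤ _ := h1
  have h2' : k * (y * a) ≤ V := by
    refine Nat.le_of_mul_le_mul_left (?_ : k * _ ≤ k * _) hk
    calc _ = _ := by ring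
      _ ≤ _ := h2
  have h3 : b * x + 1 < b + y := by
    refine Nat.lt_of_mul_lt_mul_left (a := k) ?_
    nlinarith
  have h4 : y * a + 1 < x + a := by
    refine Nat.lt_of_mul_lt_mul_left (a := k) ?_
    nlinarith
  rw [← mul_add, ← mul_add]
  refine Nat.mul_lt_mul_of_pos_left ?_ hk
  rcases Nat.eq_zero_or_pos a with rfl | ha
  · nlinarith
  · exfalso
    obtain ⟨b, rfl⟩ := Nat.exists_eq_add_of_lt hb'
    obtain ⟨x, rfl⟩ := Nat.exists_eq_add_of_lt hx'
    obtain ⟨a, rfl⟩ := Nat.exists_eq_add_of_lt ha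
    rcases Nat.eq_zero_or_pos y with rfl | hy
    · nlinarith
    · obtain ⟨y, rfl⟩ := Nat.exists_eq_add_of_lt hy
      have : 0 ≤ b * x := Nat.zero_le _
      have : 0 ≤ y * a := Nat.zero_le _
      nlinarith

lemma kn_half {G : Type*} [AddCommGroup G] [Fintype G] [DecidableEq G] (H K : AddSubgroup G)
    (C D : Finset G) (hC : PerKn H C) (hD : PerKn K D) (z : G) (hz : z ∈ D) (hz' : z ∉ C)
    (h1 : (D \ C).card + Nat.card (H ⊓ K : AddSubgroup G) < Nat.card H)
    (h2 : (C \ D).card + Nat.card (H ⊓ K : AddSubgroup G) < Nat.card K) :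
    Nat.card K < Nat.card H := by
  classical
  have cH : (Finset.univ.filter (fun x => x ∈ H)).card = Nat.card H := by
    rw [Nat.card_eq_fintype_card, Fintype.card_subtype]
  have cK : (Finset.univ.filter (fun x => x ∈ K)).card = Nat.card K := by
    rw [Nat.card_eq_fintype_card, Fintype.card_subtype]
  set FH := Finset.univ.filter (fun x => x ∈ H) with hFH
  set FK := Finset.univ.filter (fun x => x ∈ K) with hFK
  have hC' : ∀ h ∈ H, ∀ x, x + h ∈ C → x ∈ C := fun h hh x hx => by
    simpa using hC (-h) (H.neg_mem hh) _ hx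
  have hD' : ∀ h ∈ K, ∀ x, x + h ∈ D → x ∈ D := fun h hh x hx => by
    simpa using hD (-h) (K.neg_mem hh) _ hx
  set S := FH.filter (fun x => z + x ∈ D) with hS
  set S' := FH.filter (fun x => ¬ (z + x ∈ D)) with hS'
  set T' := FK.filter (fun x => z + x ∈ C) with hT'
  set T := FK.filter (fun x => ¬ (z + x ∈ C)) with hT
  have sS : S.card + S'.card = Nat.card H := by
    rw [← cH]; exact Finset.card_filter_add_card_filter_not _
  have sT : T'.card + T.card = Nat.card K := by
    rw [← cK]; exact Finset.card_filter_add_card_filter_not _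
  have pS : PerKn (H ⊓ K) S := by
    intro h hh x hx
    simp only [hS, hFH, Finset.mem_filter, Finset.mem_univ, true_and] at hx ⊢
    exact ⟨H.add_mem hx.1 hh.1, by rw [← add_assoc]; exact hD _ hh.2 _ hx.2⟩
  have pS' : PerKn (H ⊓ K) S' := by
    intro h hh x hx
    simp only [hS', hFH, Finset.mem_filter, Finset.mem_univ, true_and] at hx ⊢
    exact ⟨H.add_mem hx.1 hh.1, by rw [← add_assoc]; exact fun h' => hx.2 (hD' _ hh.2 _ h')⟩
  have pT' : PerKn (H ⊓ K) T' := by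
    intro h hh x hx
    simp only [hT', hFK, Finset.mem_filter, Finset.mem_univ, true_and] at hx ⊢
    exact ⟨K.add_mem hx.1 hh.2, by rw [← add_assoc]; exact hC _ hh.1 _ hx.2⟩
  have pT : PerKn (H ⊓ K) T := by
    intro h hh x hx
    simp only [hT, hFK, Finset.mem_filter, Finset.mem_univ, true_and] at hx ⊢
    exact ⟨K.add_mem hx.1 hh.2, by rw [← add_assoc]; exact fun h' => hx.2 (hC' _ hh.1 _ h')⟩
  have f1 := kn_fib H K S T (D \ C) z
    (fun x hx => by simp [hS, hFH] at hx; exact hx.1)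
    (fun x hx => by simp [hT, hFK] at hx; exact hx.1)
    (fun x hx y hy => by
      simp only [hS, hT, hFH, hFK, Finset.mem_filter, Finset.mem_univ, true_and] at hx hy
      rw [Finset.mem_sdiff]
      refine ⟨hD _ hy.1 _ hx.2, fun h => hy.2 (hC' _ hx.1 _ ?_)⟩
      rwa [add_right_comm])
  have f2 := kn_fib H K S' T' (C \ D) z
    (fun x hx => by simp [hS', hFH] at hx; exact hx.1)
    (fun x hx => by simp [hT', hFK] at hx; exact hx.1)
    (fun x hx y hy => by
      simp only [hS', hT', hFH, hFK, Finset.mem_filter, Finset.mem_univ, true_and] at hx hy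
      rw [Finset.mem_sdiff]
      refine ⟨?_, fun h => hx.2 (hD' _ hy.1 _ h)⟩
      rw [add_right_comm]
      exact hC _ hx.1 _ hy.2)
  have nS : 0 < S.card := Finset.card_pos.2 ⟨0, by
    simp [hS, hFH, hz]⟩
  have nT : 0 < T.card := Finset.card_pos.2 ⟨0, by
    simp [hT, hFK, hz']⟩
  obtain ⟨b, eb⟩ := pS.dvd
  obtain ⟨y, ey⟩ := pS'.dvd
  obtain ⟨x, ex⟩ := pT.dvd
  obtain ⟨a, ea⟩ := pT'.dvd
  rw [← sS] at h1 ⊢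
  rw [← sT, add_comm T'.card] at h2 ⊢
  rw [eb] at f1 nS h1 ⊢
  rw [ex] at f1 nT h2 ⊢
  rw [ey] at f2 h1 ⊢
  rw [ea] at f2 h2 ⊢
  exact kn_arith _ b x y a _ _ nS nT f1 f2 h1 h2

/-- `C` has a period `H` with `n ≤ |C| + |H|`. -/
def GoodKn {G : Type*} [AddCommGroup G] (n : ℕ) (C : Finset G) : Prop :=
  ∃ H : AddSubgroup G, PerKn H C ∧ n ≤ C.card + Nat.card H

lemma GoodKn.union {G : Type*} [AddCommGroup G] [Fintype G] [DecidableEq G] {n : ℕ}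
    {C D : Finset G} (hC : GoodKn n C) (hD : GoodKn n D) : GoodKn n (C ∪ D) := by
  by_cases hCD : C ⊆ D
  · rwa [Finset.union_eq_right.2 hCD]
  by_cases hDC : D ⊆ C
  · rwa [Finset.union_eq_left.2 hDC]
  obtain ⟨H, pH, nH⟩ := hC
  obtain ⟨K, pK, nK⟩ := hD
  obtain ⟨w, hw, hw'⟩ := Finset.not_subset.1 hCD
  obtain ⟨z, hz, hz'⟩ := Finset.not_subset.1 hDC
  refine ⟨H ⊓ K, ?_, ?_⟩
  · intro h hh x hx
    rcases Finset.mem_union.1 hx with hx | hx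
    · exact Finset.mem_union_left _ (pH _ hh.1 _ hx)
    · exact Finset.mem_union_right _ (pK _ hh.2 _ hx)
  · by_contra hlt
    have e1 : (C ∪ D).card = C.card + (D \ C).card := by
      rw [← Finset.union_sdiff_self_eq_union, Finset.card_union_of_disjoint Finset.disjoint_sdiff]
    have e2 : (C ∪ D).card = D.card + (C \ D).card := by
      rw [Finset.union_comm, ← Finset.union_sdiff_self_eq_union,
        Finset.card_union_of_disjoint Finset.disjoint_sdiff]
    have a1 := kn_half H K C D pH pK z hz hz' (by omega) (by omega)
    have a2 := kn_half K H D C pK pH w hw hw' (by rw [inf_comm]; omega) (by rw [inf_comm]; omega)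
    omega

lemma kn_local {G : Type*} [AddCommGroup G] [Fintype G] [DecidableEq G] :
    ∀ (m : ℕ) (A B : Finset G), A.card = m → 0 ∈ A → 0 ∈ B →
      ∃ C : Finset G, C ⊆ A + B ∧ 0 ∈ C ∧ GoodKn (A.card + B.card) C := by
  intro m
  induction m using Nat.strong_induction_on with
  | _ m ih =>
    intro A B hm hA hB
    by_cases hall : ∀ e ∈ B, ∀ a ∈ A, a + e ∈ B
    · refine ⟨B, fun b hb => ?_, hB, AddSubgroup.closure (A : Set G), ?_, ?_⟩
      · have := Finset.add_mem_add hA hb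
        simpa using this
      · intro h hh
        induction hh using AddSubgroup.closure_induction with
        | mem x hx => intro b hb; rw [add_comm]; exact hall b hb x hx
        | zero => intro b hb; simpa using hb
        | add x y _ _ hx hy => intro b hb; rw [← add_assoc]; exact hy _ (hx _ hb)
        | neg x _ hx =>
          intro b hb
          have himg : B.image (fun t => t + x) = B := by
            apply Finset.eq_of_subset_of_card_le
            · intro t ht
              obtain ⟨s, hs, rfl⟩ := Finset.mem_image.1 ht
              exact hx s hs
            · rw [Finset.card_image_of_injective _ (add_left_injective x)]
          rw [← himg] at hb
          obtain ⟨s, hs, rfl⟩ := Finset.mem_image.1 hb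
          simpa using hs
      · have : A.card ≤ Nat.card (AddSubgroup.closure (A : Set G)) := by
          have := Nat.card_mono (Set.toFinite (AddSubgroup.closure (A : Set G) : Set G))
            (AddSubgroup.subset_closure (k := (A : Set G)))
          simpa using this
        omega
    · push Not at hall
      obtain ⟨e, he, a, ha, hae⟩ := hall
      set A' := A.filter (fun x => x + e ∈ B) with hA'
      set B' := B ∪ A.image (fun x => x + e) with hB'
      have hlt : A'.card < A.card := by
        apply Finset.card_lt_card
        rw [Finset.ssubset_iff_of_subset (Finset.filter_subset _ _)]
        exact ⟨a, ha, by simp [hA', hae]⟩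
      have hsum : A'.card + B'.card = A.card + B.card := by
        have h1 := Finset.card_union_add_card_inter B (A.image (fun x => x + e))
        have h2 : B ∩ A.image (fun x => x + e) = A'.image (fun x => x + e) := by
          ext t
          simp only [hA', Finset.mem_inter, Finset.mem_image, Finset.mem_filter]
          constructor
          · rintro ⟨h, x, hx, rfl⟩
            exact ⟨x, ⟨hx, h⟩, rfl⟩
          · rintro ⟨x, ⟨hx, h⟩, rfl⟩
            exact ⟨h, x, hx, rfl⟩
        rw [h2, Finset.card_image_of_injective _ (add_left_injective e),
          Finset.card_image_of_injective _ (add_left_injective e)] at h1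
        rw [← hB'] at h1
        omega
      obtain ⟨C, hC, h0, hg⟩ := ih A'.card (hm ▸ hlt) A' B' rfl
        (by simp [hA', hA, he]) (by simp [hB', hB])
      refine ⟨C, hC.trans ?_, h0, hsum ▸ hg⟩
      intro t ht
      obtain ⟨x, hx, y, hy, rfl⟩ := Finset.mem_add.1 ht
      rw [hA', Finset.mem_filter] at hx
      rcases Finset.mem_union.1 hy with hy | hy
      · exact Finset.add_mem_add hx.1 hy
      · obtain ⟨s, hs, rfl⟩ := Finset.mem_image.1 hy
        have := Finset.add_mem_add hs hx.2
        rwa [add_left_comm] at this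

lemma kn_local' {G : Type*} [AddCommGroup G] [Fintype G] [DecidableEq G]
    (A B : Finset G) (c : G) (hc : c ∈ A + B) :
      ∃ C : Finset G, C ⊆ A + B ∧ c ∈ C ∧ GoodKn (A.card + B.card) C := by
  obtain ⟨a, ha, b, hb, rfl⟩ := Finset.mem_add.1 hc
  obtain ⟨C, hC, h0, H, pH, nH⟩ := kn_local _ (A.image (fun x => x - a)) (B.image (fun x => x - b))
    rfl (Finset.mem_image.2 ⟨a, ha, by simp⟩) (Finset.mem_image.2 ⟨b, hb, by simp⟩)
  rw [Finset.card_image_of_injective _ sub_left_injective,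
    Finset.card_image_of_injective _ sub_left_injective] at nH
  refine ⟨C.image (fun x => x + (a + b)), ?_, Finset.mem_image.2 ⟨0, h0, by simp⟩, H, ?_, ?_⟩
  · intro t ht
    obtain ⟨s, hs, rfl⟩ := Finset.mem_image.1 ht
    obtain ⟨x, hx, y, hy, rfl⟩ := Finset.mem_add.1 (hC hs)
    obtain ⟨x, hx1, rfl⟩ := Finset.mem_image.1 hx
    obtain ⟨y, hy1, rfl⟩ := Finset.mem_image.1 hy
    have := Finset.add_mem_add hx1 hy1
    convert this using 1
    abel
  · intro h hh x hx
    obtain ⟨s, hs, rfl⟩ := Finset.mem_image.1 hx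
    exact Finset.mem_image.2 ⟨s + h, pH h hh s hs, by abel⟩
  · rwa [Finset.card_image_of_injective _ (add_left_injective _)]

lemma kn_weak {G : Type*} [AddCommGroup G] [Fintype G] [DecidableEq G]
    (A B : Finset G) (hne : (A + B).Nonempty) : GoodKn (A.card + B.card) (A + B) := by
  classical
  obtain ⟨c, hc⟩ := hne
  obtain ⟨C, hC, hcC, hg⟩ := kn_local' A B c hc
  obtain ⟨M, hM, hmax⟩ := Finset.exists_max_image
    ((A + B).powerset.filter (fun C => GoodKn (A.card + B.card) C)) Finset.card
    ⟨C, by simp only [Finset.mem_filter, Finset.mem_powerset]; exact ⟨hC, hg⟩⟩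
  simp only [Finset.mem_filter, Finset.mem_powerset] at hM hmax
  have : M = A + B := by
    refine Finset.Subset.antisymm hM.1 fun x hx => ?_
    obtain ⟨D, hD, hxD, hgD⟩ := kn_local' A B x hx
    have h1 := hmax (M ∪ D) ⟨Finset.union_subset hM.1 hD, hM.2.union hgD⟩
    have h2 := Finset.eq_of_subset_of_card_le (Finset.subset_union_left (s₁ := M) (s₂ := D)) h1
    rw [h2]
    exact Finset.mem_union_right _ hxD
  exact this ▸ hM.2

lemma kn_strong {G : Type*} [AddCommGroup G] [Fintype G] [DecidableEq G]
    (A : Finset G) (hA : A.Nonempty) :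
    ∃ (H : AddSubgroup G) (A' : Finset G), A ⊆ A' ∧ PerKn H A' ∧
      2 * A'.card ≤ (A - A).card + Nat.card H := by
  classical
  obtain ⟨H, hH, hmax⟩ := Set.exists_max_image {H : AddSubgroup G | PerKn H (A - A)}
    (fun H => Nat.card H) (Set.toFinite _) ⟨⊥, fun h hh x hx => by
      rw [AddSubgroup.mem_bot.1 hh]; simpa using hx⟩
  set FH : Finset G := Finset.univ.filter (fun x => x ∈ H) with hFH
  have hsub : A ⊆ A + FH := fun a ha => by
    have := Finset.add_mem_add ha (show (0 : G) ∈ FH by simp [hFH])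
    simpa using this
  have hsum : (A + FH) + (-(A + FH)) = A - A := by
    apply Finset.Subset.antisymm
    · intro t ht
      obtain ⟨x, hx, y, hy, rfl⟩ := Finset.mem_add.1 ht
      rw [Finset.mem_neg'] at hy
      obtain ⟨a, ha, h, hh, rfl⟩ := Finset.mem_add.1 hx
      obtain ⟨a', ha', h', hh', e⟩ := Finset.mem_add.1 hy
      simp only [hFH, Finset.mem_filter, Finset.mem_univ, true_and] at hh hh'
      have := hH (h - h') (H.sub_mem hh hh') (a - a') (Finset.sub_mem_sub ha ha')
      convert this using 1
      rw [← neg_neg y, ← e]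
      abel
    · intro t ht
      obtain ⟨x, hx, y, hy, rfl⟩ := Finset.mem_sub.1 ht
      rw [sub_eq_add_neg]
      exact Finset.add_mem_add (hsub hx) (Finset.neg_mem_neg (hsub hy))
  obtain ⟨K, hK, hn⟩ := kn_weak (A + FH) (-(A + FH)) (by rw [hsum]; exact hA.sub hA)
  rw [hsum] at hK hn
  have := hmax K hK
  rw [Finset.card_neg] at hn
  refine ⟨H, A + FH, hsub, ?_, by omega⟩
  intro h hh x hx
  obtain ⟨a, ha, h', hh', rfl⟩ := Finset.mem_add.1 hx
  rw [add_assoc]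
  refine Finset.add_mem_add ha ?_
  simp only [hFH, Finset.mem_filter, Finset.mem_univ, true_and] at hh' ⊢
  exact H.add_mem hh' hh

lemma kn_lower {G : Type*} [AddCommGroup G] [Fintype G] [DecidableEq G]
    (A : Finset G) (hA : A.Nonempty) :
    ∃ d, 0 < d ∧ d ∣ Nat.card G ∧ d * (2 * (A.card ⌈/⌉ d) - 1) ≤ (A - A).card := by
  obtain ⟨H, A', hs, hp, hle⟩ := kn_strong A hA
  have hd : 0 < Nat.card H := Nat.card_pos
  refine ⟨Nat.card H, hd, AddSubgroup.card_addSubgroup_dvd_card H, ?_⟩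
  obtain ⟨q, hq⟩ := hp.dvd
  have h1 := Finset.card_le_card hs
  have h2 : A.card ⌈/⌉ Nat.card H ≤ q := by
    rw [ceilDiv_le_iff_le_mul hd]
    omega
  have h3 : Nat.card H * (2 * (A.card ⌈/⌉ Nat.card H) - 1) ≤ Nat.card H * (2 * q - 1) :=
    Nat.mul_le_mul_left _ (by omega)
  refine h3.trans ?_
  rw [Nat.mul_sub, mul_one]
  have : Nat.card H * (2 * q) = 2 * A'.card := by rw [hq]; ring
  omega

lemma kn_upper (N : ℕ) [NeZero N] (r : ℕ) (hr1 : 1 ≤ r) (hrN : r ≤ N) (d : ℕ) (hd : 0 < d)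
    (hdN : d ∣ N) :
    ∃ A : Finset (ZMod N), A.card = r ∧ (A - A).card ≤ d * (2 * (r ⌈/⌉ d) - 1) := by
  classical
  obtain ⟨m, rfl⟩ := hdN
  set k := r ⌈/⌉ d with hk
  have hkm : k ≤ m := by rw [hk, ceilDiv_le_iff_le_mul hd]; exact hrN
  have hrk : r ≤ d * k := (ceilDiv_le_iff_le_mul hd).1 le_rfl
  have hk1 : 1 ≤ k := by
    rcases Nat.eq_zero_or_pos k with h | h
    · rw [h] at hrk; omega
    · exact h
  set P : Finset (ZMod (d * m)) :=
    (Finset.range d ×ˢ Finset.range k).image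
      (fun p => ((p.2 + m * p.1 : ℕ) : ZMod (d * m))) with hP
  have hPc : P.card = d * k := by
    rw [hP, Finset.card_image_of_injOn]
    · simp
    · rintro ⟨i, j⟩ hp ⟨i', j'⟩ hq h
      simp only [Finset.coe_product, Finset.coe_range, Set.mem_prod, Set.mem_Iio] at hp hq
      have bd : ∀ i j, i < d → j < k → j + m * i < d * m := by
        intro i j hi hj
        calc j + m * i < m + m * i := by omega
          _ = (i + 1) * m := by ring
          _ ≤ d * m := Nat.mul_le_mul_right _ hi
      simp only at h
      rw [ZMod.natCast_eq_natCast_iff'] at h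
      rw [Nat.mod_eq_of_lt (bd _ _ hp.1 hp.2), Nat.mod_eq_of_lt (bd _ _ hq.1 hq.2)] at h
      have h1 : j = j' := by
        have := congrArg (· % m) h
        simpa [Nat.add_mul_mod_self_left, Nat.mod_eq_of_lt (hp.2.trans_le hkm),
          Nat.mod_eq_of_lt (hq.2.trans_le hkm)] using this
      subst h1
      have h2 : m * i = m * i' := by omega
      rw [Nat.eq_of_mul_eq_mul_left (by omega) h2]
  obtain ⟨A, hAP, hAc⟩ := Finset.exists_subset_card_eq (hPc ▸ hrk : r ≤ P.card)
  refine ⟨A, hAc, ?_⟩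
  have hsub : A - A ⊆ (Finset.range d ×ˢ Finset.range (2 * k - 1)).image
      (fun p => ((p.2 + m * p.1 : ℕ) : ZMod (d * m)) - ((k - 1 : ℕ) : ZMod (d * m))) := by
    intro t ht
    obtain ⟨x, hx, y, hy, rfl⟩ := Finset.mem_sub.1 ht
    obtain ⟨⟨i, j⟩, hp, rfl⟩ := Finset.mem_image.1 (hAP hx)
    obtain ⟨⟨i', j'⟩, hq, rfl⟩ := Finset.mem_image.1 (hAP hy)
    simp only [Finset.mem_product, Finset.mem_range] at hp hq
    have hz : (d : ZMod (d * m)) * (m : ZMod (d * m)) = 0 := by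
      rw [← Nat.cast_mul]; exact ZMod.natCast_self _
    refine Finset.mem_image.2 ⟨⟨(i + (d - i')) % d, j + (k - 1) - j'⟩, ?_, ?_⟩
    · simp only [Finset.mem_product, Finset.mem_range]
      exact ⟨Nat.mod_lt _ hd, by omega⟩
    · have e1 := congrArg (Nat.cast : ℕ → ZMod (d * m)) (Nat.mod_add_div (i + (d - i')) d)
      have e2 : ((j + (k - 1) - j' : ℕ) : ZMod (d * m)) = j + ((k - 1 : ℕ) : ZMod (d * m)) - j' := by
        rw [Nat.cast_sub (by omega), Nat.cast_add]
      push_cast [Nat.cast_sub hq.1.le] at e1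
      simp only [Nat.cast_add, Nat.cast_mul]
      rw [e2]
      linear_combination (m : ZMod (d * m)) * e1 +
        (1 - (((i + (d - i')) / d : ℕ) : ZMod (d * m))) * hz
  calc (A - A).card ≤ _ := Finset.card_le_card hsub
    _ ≤ _ := Finset.card_image_le
    _ = _ := by simp

/-- Theorem: for the cyclic group `G = ℤ/Nℤ` and `1 ≤ r ≤ N`,
`ρ⁻_G(r) = min over positive divisors d of N of d (2⌈r/d⌉ - 1)`. -/
theorem rhoMinus_cyclic (N : ℕ) [NeZero N] (r : ℕ) (hr1 : 1 ≤ r) (hrN : r ≤ N) :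
    rhoMinus (ZMod N) r =
      sInf ((fun d => d * (2 * (r ⌈/⌉ d) - 1)) '' {d : ℕ | 0 < d ∧ d ∣ N}) := by
  unfold rhoMinus
  apply le_antisymm
  · apply le_csInf
    · exact ⟨_, 1, ⟨one_pos, one_dvd _⟩, rfl⟩
    · rintro _ ⟨d, ⟨hd, hdN⟩, rfl⟩
      obtain ⟨A, hA, hle⟩ := kn_upper N r hr1 hrN d hd hdN
      refine le_trans (Nat.sInf_le ?_) hle
      exact ⟨A, hA, rfl⟩
  · apply le_csInf
    · obtain ⟨A, hA, _⟩ := kn_upper N r hr1 hrN 1 one_pos (one_dvd _)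
      exact ⟨_, A, hA, rfl⟩
    · rintro _ ⟨A, hA, rfl⟩
      obtain ⟨d, hd, hdN, hle⟩ := kn_lower A (Finset.card_pos.1 (by omega))
      rw [Nat.card_zmod] at hdN
      rw [hA] at hle
      refine le_trans (Nat.sInf_le ?_) hle
      exact ⟨d, ⟨hd, hdN⟩, rfl⟩
end

section
/- Let G = (ℤ/pℤ)^d where p is prime and d ≥ 0. Let t and r be integers with 0 ≤ t ≤ d, p^t < r ≤ p^{t+1}, and r ≤ p^d. Then ρ_G⁻(r) = p^t · min{2·⌈r/p^t⌉ − 1, p}. -/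
open Pointwise

lemma arithJ (p q k M J : ℕ) (a d : ℕ → ℕ) (hp : p = 2*q+1) (hkM : k + 2 ≤ M)
    (hMq : M ≤ q) (ha : Antitone a) (haM : 1 ≤ a M) (hap : ∀ i, a i ≤ p)
    (hS : ∑ i ∈ Finset.range M, a (i+1) = k*p+1) (hd : Antitone d)
    (hcd : ∀ i j, 1 ≤ i → 1 ≤ j → i ≤ M → j ≤ M → min p (a i + a j - 1) ≤ d (i+j-1))
    (hJ1 : 1 ≤ J) (hJk : J ≤ k) (hJ : q + 1 ≤ a J) (hJ' : a (J+1) ≤ q) :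
    (2*k+1)*p ≤ ∑ j ∈ Finset.range (2*M-1), d (j+1) := by
  obtain ⟨m, rfl⟩ : ∃ m, M = J + m := ⟨M - J, by omega⟩
  have hm : 2 ≤ m := by omega
  rw [Finset.sum_range_add] at hS
  have e1 : 2*(J+m)-1 = (2*J-1) + m + m := by omega
  rw [e1, Finset.sum_range_add, Finset.sum_range_add]
  have h1 : (2*J-1)*p ≤ ∑ j ∈ Finset.range (2*J-1), d (j+1) := by
    have : ∀ j ∈ Finset.range (2*J-1), p ≤ d (j+1) := by
      intro j hj
      rw [Finset.mem_range] at hj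
      have h := hcd J J hJ1 hJ1 (by omega) (by omega)
      have h2 : d (J+J-1) ≤ d (j+1) := hd (by omega)
      omega
    simpa using Finset.card_nsmul_le_sum _ _ _ this
  have hb : ∀ i, a (J + (i+1)) ≤ q := fun i => le_trans (ha (by omega)) hJ'
  have h2 : ∀ i ∈ Finset.range m, min p (a J + a (J+(i+1)) - 1) ≤ d (2*J-1+i+1) := by
    intro i hi
    rw [Finset.mem_range] at hi
    have h := hcd J (J+(i+1)) hJ1 (by omega) (by omega) (by omega)
    rwa [show J + (J+(i+1)) - 1 = 2*J-1+i+1 by omega] at h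
  have h3 : ∀ i ∈ Finset.range m, a (J+(i+1)) ≤ d (2*J-1+m+i+1) := by
    intro i hi
    rw [Finset.mem_range] at hi
    have h := hcd (J+m) (J+(i+1)) (by omega) (by omega) (by omega) (by omega)
    rw [show J + m + (J+(i+1)) - 1 = 2*J-1+m+i+1 by omega] at h
    have := hb i
    have h4 : a (J+m) ≤ q := by have := hb (m-1); rwa [show J + (m-1+1) = J+m by omega] at this
    omega
  have h23 := add_le_add (Finset.sum_le_sum h2) (Finset.sum_le_sum h3)
  have hT : (∑ i ∈ Finset.range J, a (i+1)) + (p - a J) ≤ J * p := by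
    obtain ⟨j, rfl⟩ : ∃ j, J = j + 1 := ⟨J-1, by omega⟩
    rw [Finset.sum_range_succ]
    have : ∑ i ∈ Finset.range j, a (i+1) ≤ j * p := by
      simpa using Finset.sum_le_card_nsmul (Finset.range j) (fun i => a (i+1)) p (fun i _ => hap _)
    have := hap (j+1)
    rw [add_mul]; omega
  set SJ := ∑ i ∈ Finset.range J, a (i+1) with hSJ
  have hS' : SJ + ∑ i ∈ Finset.range m, a (J+(i+1)) = k*p+1 := by
    rw [← hS]; simp only [add_assoc]
  obtain ⟨κ, rfl⟩ : ∃ κ, k = J + κ := ⟨k - J, by omega⟩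
  have hX : (2*J-1)*p + p = 2*(J*p) := by
    obtain ⟨j, rfl⟩ : ∃ j, J = j + 1 := ⟨J-1, by omega⟩
    rw [show 2*(j+1)-1 = 2*j+1 by omega]; ring
  have hY : (2*(J+κ)+1)*p = 2*(J*p) + 2*(κ*p) + p := by ring
  have hZ : (J+κ)*p = J*p+κ*p := by ring
  rw [hY]
  rw [hZ] at hS'
  have haJ := hap J
  by_cases hm4 : 4 ≤ m
  · have h5 : ∑ i ∈ Finset.range m, (2 * a (J+(i+1)) + q) ≤
        ∑ i ∈ Finset.range m, min p (a J + a (J+(i+1)) - 1) + ∑ i ∈ Finset.range m, a (J+(i+1)) := by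
      rw [← Finset.sum_add_distrib]
      apply Finset.sum_le_sum
      intro i _
      have := hb i
      omega
    rw [Finset.sum_add_distrib, ← Finset.mul_sum] at h5
    simp only [Finset.sum_const, Finset.card_range, smul_eq_mul] at h5
    have : 4 * q ≤ m * q := Nat.mul_le_mul_right _ hm4
    omega
  · have b0 := hb 0
    have b1 := hb 1
    have b2 := hb 2
    have hm23 : m = 2 ∨ m = 3 := by omega
    have hκ : κ ≤ 1 := by
      by_contra hcon
      have : 2 * p ≤ κ * p := Nat.mul_le_mul_right _ (by omega)
      rcases hm23 with rfl | rfl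
      · simp [Finset.sum_range_succ] at hS' b0 b1
        omega
      · simp [Finset.sum_range_succ] at hS' b0 b1 b2
        omega
    have hk01 : κ = 0 ∨ κ = 1 := by omega
    rcases hm23 with rfl | rfl <;> rcases hk01 with rfl | rfl <;>
      simp only [Finset.sum_range_succ, Finset.sum_range_zero, zero_add, one_mul, zero_mul, mul_zero, add_zero] at hS' h23 b0 b1 b2 ⊢ h1 <;>
      omega

lemma arith0 (p q k M : ℕ) (a d : ℕ → ℕ) (hp : p = 2*q+1) (hk : 1 ≤ k) (hkM : k + 2 ≤ M)
    (hMq : M ≤ q) (ha : Antitone a) (haM : 1 ≤ a M)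
    (hS : ∑ i ∈ Finset.range M, a (i+1) = k*p+1)
    (hcd : ∀ i j, 1 ≤ i → 1 ≤ j → i ≤ M → j ≤ M → min p (a i + a j - 1) ≤ d (i+j-1))
    (hJ' : a 1 ≤ q) :
    (2*k+1)*p ≤ ∑ j ∈ Finset.range (2*M-1), d (j+1) := by
  obtain ⟨n, rfl⟩ : ∃ n, M = n + 1 := ⟨M-1, by omega⟩
  have hb : ∀ i, a (i+1) ≤ q := fun i => le_trans (ha (by omega)) hJ'
  have hpos : ∀ i, i ≤ n → 1 ≤ a (i+1) := fun i hi => le_trans haM (ha (by omega))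
  have hcd' : ∀ i j, i ≤ n → j ≤ n → a (i+1) + a (j+1) ≤ d (i+j+1) + 1 := by
    intro i j hi hj
    have h := hcd (i+1) (j+1) (by omega) (by omega) (by omega) (by omega)
    rw [show i+1+(j+1)-1 = i+j+1 by omega] at h
    have := hb i; have := hb j
    omega
  have key : ∀ n', n' ≤ n → 4 * ∑ i ∈ Finset.range (n'+1), a (i+1) ≤
      (∑ j ∈ Finset.range (2*n'+1), d (j+1)) + a 1 + a (n'+1) + (2*n'+1) := by
    intro n'
    induction n' with
    | zero => intro _; have := hcd' 0 0 (by omega) (by omega); simp at this ⊢; omega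
    | succ n' ih =>
      intro h
      have ih := ih (by omega)
      rw [Finset.sum_range_succ _ (n'+1), show 2*(n'+1)+1 = 2*n'+1+1+1 by ring,
        Finset.sum_range_succ _ (2*n'+1+1), Finset.sum_range_succ _ (2*n'+1)]
      have h1 := hcd' n' (n'+1) (by omega) (by omega)
      have h2 := hcd' (n'+1) (n'+1) (by omega) (by omega)
      rw [show n' + (n'+1) + 1 = 2*n'+1+1 by ring] at h1
      rw [show (n'+1) + (n'+1) + 1 = 2*n'+1+1+1 by ring] at h2
      omega
  have hdiag := key n le_rfl
  rw [show 2*(n+1)-1 = 2*n+1 by omega]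
  rw [hS] at hdiag
  have hbn := hb n
  by_cases hk2 : 2 ≤ k
  · have : 2 * p ≤ k * p := Nat.mul_le_mul_right _ hk2
    have e : (2*k+1)*p = 2*(k*p)+p := by ring
    omega
  · have hk1 : k = 1 := by omega
    subst hk1
    by_cases hc : a 1 + a (n+1) + 2 * n ≤ p + 3
    · omega
    · have h0 := hcd' 0 0 (by omega) (by omega)
      have hL : ∑ i ∈ Finset.range n, (a 1 + a (i+1+1)) ≤ ∑ i ∈ Finset.range n, (d (1+i+1) + 1) := by
        apply Finset.sum_le_sum
        intro i hi
        rw [Finset.mem_range] at hi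
        have := hcd' 0 (i+1) (by omega) (by omega)
        rw [show 0 + (i+1)+1 = 1+i+1 by ring] at this
        exact this
      have hR : ∑ i ∈ Finset.range n, (a (n+1) + a (i+1+1)) ≤ ∑ i ∈ Finset.range n, (d (1+n+i+1) + 1) := by
        apply Finset.sum_le_sum
        intro i hi
        rw [Finset.mem_range] at hi
        have := hcd' n (i+1) (by omega) (by omega)
        rw [show n + (i+1)+1 = 1+n+i+1 by ring] at this
        exact this
      rw [Finset.sum_range_succ'] at hS
      rw [show 2*n+1 = 1 + n + n by ring, Finset.sum_range_add, Finset.sum_range_add]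
      simp only [Finset.sum_add_distrib, Finset.sum_const, Finset.card_range, smul_eq_mul, mul_one] at hL hR
      simp at hS h0 ⊢
      have hp1 := hpos n le_rfl
      have hp0 := hpos 0 (by omega)
      have ha1 := hb 0
      simp at hp0 ha1
      obtain ⟨w, hw⟩ : ∃ w, a 1 + a (n+1) = w + 2 := ⟨a 1 + a (n+1) - 2, by omega⟩
      have hnw : 2 * q ≤ n * w := by
        have h1 : 2*q+3 ≤ w + 2*n := by omega
        have h2 : 3 ≤ n := by omega
        have h3 : n + 1 ≤ q := by omega
        nlinarith [mul_le_mul_of_nonneg_left h1 (Nat.zero_le n), mul_nonneg (by omega : (0:ℤ) ≤ (n:ℤ) - 3) (by omega : (0:ℤ) ≤ (q:ℤ) - 1 - n)]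
      have hexp : n * a 1 + n * a (n+1) = n * w + n * 2 := by rw [← mul_add, hw, mul_add]
      omega

lemma arith (p q k M : ℕ) (a d : ℕ → ℕ) (hp : p = 2*q+1) (hk : 1 ≤ k) (hkM : k + 2 ≤ M)
    (hMq : M ≤ q) (ha : Antitone a) (haM : 1 ≤ a M) (hap : ∀ i, a i ≤ p)
    (hS : ∑ i ∈ Finset.range M, a (i+1) = k*p+1) (hd : Antitone d)
    (hcd : ∀ i j, 1 ≤ i → 1 ≤ j → i ≤ M → j ≤ M → min p (a i + a j - 1) ≤ d (i+j-1))
    (hk1 : a (k+1) ≤ q) :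
    (2*k+1)*p ≤ ∑ j ∈ Finset.range (2*M-1), d (j+1) := by
  by_cases h1 : a 1 ≤ q
  · exact arith0 p q k M a d hp hk hkM hMq ha haM hS hcd h1
  · have hex : ∃ n, a (n+1) ≤ q := ⟨k, hk1⟩
    classical
    have hJ' := Nat.find_spec hex
    have hJmin := fun m => Nat.find_min (m := m) hex
    have hJk := Nat.find_min' hex hk1
    set J := Nat.find hex
    have hJ1 : 1 ≤ J := by
      by_contra h
      have : J = 0 := by omega
      rw [this] at hJ'; exact h1 hJ'
    have hJ : q + 1 ≤ a J := by
      have := hJmin (J-1) (by omega)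
      rw [show J - 1 + 1 = J by omega] at this
      omega
    exact arithJ p q k M J a d hp hkM hMq ha haM hap hS hd hcd hJ1 hJk hJ hJ'

lemma cdF {p : ℕ} [Fact p.Prime] (X Y : Finset (ZMod p)) (hX : X.Nonempty) (hY : Y.Nonempty) :
    min p (X.card + Y.card - 1) ≤ (X - Y).card := by
  have h := ZMod.cauchy_davenport (Fact.out : p.Prime) hX hY.neg
  rwa [Finset.card_neg, ← sub_eq_add_neg] at h

lemma cdFF {p : ℕ} [Fact p.Prime] (X Y : Finset (ZMod p × ZMod p)) (hX : X.Nonempty)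
    (hY : Y.Nonempty) :
    min p (X.card + Y.card - 1) ≤ (X - Y).card := by
  have h := cauchy_davenport_minOrder_add hX hY.neg
  rw [Finset.card_neg, ← sub_eq_add_neg] at h
  have h2 : (p : ℕ∞) ≤ AddMonoid.minOrder (ZMod p × ZMod p) := by
    rw [AddMonoid.le_minOrder]
    intro a ha _
    have : addOrderOf a = p := by
      apply addOrderOf_eq_prime _ ha
      ext <;> simp
    rw [this]
  have h3 : ((min p (X.card + Y.card - 1) : ℕ) : ℕ∞) ≤ ((X - Y).card : ℕ∞) := by
    refine le_trans ?_ h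
    exact le_min ((Nat.cast_le.2 (min_le_left _ _)).trans h2) (Nat.cast_le.2 (min_le_right _ _))
  exact_mod_cast h3

lemma levels {N : Type*} [Fintype N] (f : N → ℕ) (B : ℕ) :
    ∑ j ∈ Finset.range B, (Finset.univ.filter fun z => j + 1 ≤ f z).card = ∑ z, min B (f z) := by
  simp only [Finset.card_filter]
  rw [Finset.sum_comm]
  apply Finset.sum_congr rfl
  intro z _
  rw [← Finset.card_filter]
  have : (Finset.range B).filter (fun j => j + 1 ≤ f z) = Finset.range (min B (f z)) := by
    ext j; simp only [Finset.mem_filter, Finset.mem_range]; omega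
  rw [this, Finset.card_range]

lemma func {p : ℕ} [Fact p.Prime] (A : Finset (ZMod p × ZMod p)) (φ : ZMod p × ZMod p →+ ZMod p)
    (k q : ℕ) (hp : p = 2*q+1) (hk : 1 ≤ k) (hkp : 2*k+1 < p) (hA : A.card = k*p+1) :
    (2*k+1)*p ≤ (A - A).card ∨ (∃ x, q + 1 ≤ (A.filter fun a => φ a = x).card) ∨
    ((∀ x, (A.filter fun a => φ a = x).card ≤ k+1) ∧
      (Finset.univ.filter fun x => k+1 ≤ (A.filter fun a => φ a = x).card).card ≤ q) := by
  set f : ZMod p → ℕ := fun x => (A.filter fun a => φ a = x).card with hf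
  set h : ZMod p → ℕ := fun x => ((A-A).filter fun a => φ a = x).card with hh
  set a : ℕ → ℕ := fun i => (Finset.univ.filter fun x => i ≤ f x).card with ha
  set d : ℕ → ℕ := fun i => (Finset.univ.filter fun x => i ≤ h x).card with hd
  have haa : Antitone a := by
    intro i j hij
    apply Finset.card_le_card
    intro x; simp; omega
  have hdd : Antitone d := by
    intro i j hij
    apply Finset.card_le_card
    intro x; simp; omega
  have hap : ∀ i, a i ≤ p := by
    intro i
    have := Finset.card_le_univ (Finset.univ.filter fun x => i ≤ f x)
    rwa [ZMod.card] at this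
  have hfs : ∑ x, f x = A.card := by
    rw [Finset.card_eq_sum_card_fiberwise (f := φ) (t := Finset.univ) (by simp)]
  have hhs : ∑ x, h x = (A-A).card := by
    rw [Finset.card_eq_sum_card_fiberwise (s := A - A) (f := φ) (t := Finset.univ) (by simp)]
  have hfh : ∀ x y, 1 ≤ f x → 1 ≤ f y → min p (f x + f y - 1) ≤ h (x - y) := by
    intro x y hx hy
    refine le_trans (cdFF (A.filter fun a => φ a = x) (A.filter fun a => φ a = y)
      (Finset.card_pos.mp hx) (Finset.card_pos.mp hy)) ?_
    apply Finset.card_le_card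
    intro z hz
    obtain ⟨u, hu, v, hv, rfl⟩ := Finset.mem_sub.mp hz
    rw [Finset.mem_filter] at hu hv ⊢
    exact ⟨Finset.sub_mem_sub hu.1 hv.1, by rw [map_sub, hu.2, hv.2]⟩
  have hcd : ∀ i j, 1 ≤ i → 1 ≤ j → 1 ≤ a i → 1 ≤ a j → i + j - 1 ≤ p →
      min p (a i + a j - 1) ≤ d (i+j-1) := by
    intro i j hi hj hai haj hij
    refine le_trans (cdF (Finset.univ.filter fun x => i ≤ f x)
      (Finset.univ.filter fun x => j ≤ f x) (Finset.card_pos.mp hai) (Finset.card_pos.mp haj)) ?_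
    apply Finset.card_le_card
    intro z hz
    obtain ⟨u, hu, v, hv, rfl⟩ := Finset.mem_sub.mp hz
    simp only [Finset.mem_filter, Finset.mem_univ, true_and] at hu hv ⊢
    have := hfh u v (by omega) (by omega)
    omega
  have hdsum : ∀ B, ∑ j ∈ Finset.range B, d (j+1) ≤ (A-A).card := by
    intro B
    rw [← hhs]
    refine le_trans (le_of_eq (levels h B)) (Finset.sum_le_sum fun _ _ => min_le_right _ _)
  by_cases hbig : ∃ x, q + 1 ≤ f x
  · exact Or.inr (Or.inl hbig)
  push Not at hbig
  by_cases hak : q + 1 ≤ a (k+1)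
  · left
    have h1 := hcd (k+1) (k+1) (by omega) (by omega) (by omega) (by omega) (by omega)
    refine le_trans ?_ (hdsum (2*k+1))
    have : ∀ j ∈ Finset.range (2*k+1), p ≤ d (j+1) := by
      intro j hj
      rw [Finset.mem_range] at hj
      have h2 : d (k+1+(k+1)-1) ≤ d (j+1) := hdd (by omega)
      omega
    simpa using Finset.card_nsmul_le_sum _ _ _ this
  obtain ⟨x0, -, hx0⟩ := Finset.exists_max_image Finset.univ f ⟨0, Finset.mem_univ _⟩
  by_cases hM : k + 2 ≤ f x0
  · left
    have haM : 1 ≤ a (f x0) := Finset.card_pos.mpr ⟨x0, by simp⟩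
    have hpos : ∀ i, i ≤ f x0 → 1 ≤ a i := fun i hi => le_trans haM (haa hi)
    have hMq : f x0 ≤ q := by have := hbig x0; omega
    refine le_trans (arith p q k (f x0) a d hp hk hM hMq haa haM hap ?_ hdd ?_ (by omega))
      (hdsum _)
    · rw [← hA, ← hfs]
      refine (levels f (f x0)).trans (Finset.sum_congr rfl fun z _ => ?_)
      exact min_eq_right (hx0 z (Finset.mem_univ _))
    · intro i j hi hj hi' hj'
      exact hcd i j hi hj (hpos i hi') (hpos j hj') (by omega)
  · right; right
    refine ⟨fun x => ?_, Nat.lt_succ_iff.mp (not_le.mp hak)⟩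
    have := hx0 x (Finset.mem_univ _)
    show f x ≤ k + 1
    omega

lemma lineSum {p : ℕ} [Fact p.Prime] {V : Type*} [AddCommGroup V] [Module (ZMod p) V] [Fintype V]
    [DecidableEq V] (D : Finset V) :
    ∑ v : V, ((Finset.univ.erase (0 : ZMod p)).filter fun s => s • v ∈ D).card
      = (p - 1) * D.card := by
  simp only [Finset.card_filter]
  rw [Finset.sum_comm]
  have : ∀ s ∈ Finset.univ.erase (0 : ZMod p), (∑ v : V, if s • v ∈ D then 1 else 0) = D.card := by
    intro s hs
    have hs0 : s ≠ 0 := Finset.ne_of_mem_erase hs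
    rw [← Finset.card_filter]
    apply Finset.card_bij (fun v _ => s • v)
    · intro v hv; simpa using hv
    · intro v _ w _ h; exact smul_right_injective V hs0 h
    · intro b hb
      exact ⟨s⁻¹ • b, by simpa [smul_smul, hs0] using hb, by simp [smul_smul, hs0]⟩
  rw [Finset.sum_congr rfl this]
  simp [Finset.card_erase_of_mem, ZMod.card]

lemma averaging {T V : Type*} [Fintype T] [AddCommGroup V] [Fintype V] [DecidableEq V]
    (A : Finset V) (g : T → V) (K : ℕ) (h : K * Fintype.card V < Fintype.card T * A.card) :
    ∃ x, K < (Finset.univ.filter fun s => x + g s ∈ A).card := by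
  by_contra hcon
  push Not at hcon
  have h1 : ∑ x : V, (Finset.univ.filter fun s => x + g s ∈ A).card = Fintype.card T * A.card := by
    simp only [Finset.card_filter]
    rw [Finset.sum_comm]
    have : ∀ s ∈ (Finset.univ : Finset T), (∑ x : V, if x + g s ∈ A then 1 else 0) = A.card := by
      intro s _
      rw [← Finset.card_filter]
      apply Finset.card_bij (fun v _ => v + g s)
      · intro v hv; simpa using hv
      · intro v _ w _ h; exact add_right_cancel h
      · intro b hb
        exact ⟨b - g s, by simpa using hb, by simp⟩
    rw [Finset.sum_congr rfl this]
    simp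
  have h2 := Finset.sum_le_card_nsmul Finset.univ (fun x : V => (Finset.univ.filter fun s => x + g s ∈ A).card) K (fun x _ => hcon x)
  rw [h1] at h2
  simp only [Finset.card_univ, smul_eq_mul] at h2
  rw [mul_comm] at h
  omega

lemma lineLemma {p : ℕ} [Fact p.Prime] {V : Type*} [AddCommGroup V] [Module (ZMod p) V] [Fintype V]
    [DecidableEq V] (A : Finset V) (k : ℕ) (h : k * Fintype.card V < p * A.card) (v : V) :
    min p (2*k+1) ≤ (Finset.univ.filter fun s : ZMod p => s • v ∈ A - A).card := by
  obtain ⟨x, hx⟩ := averaging A (fun s : ZMod p => s • v) k (by rwa [ZMod.card])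
  have hne : (Finset.univ.filter fun s : ZMod p => x + s • v ∈ A).Nonempty :=
    Finset.card_pos.mp (by omega)
  have h1 := cdF _ _ hne hne
  refine le_trans (by omega) (h1.trans (Finset.card_le_card ?_))
  intro z hz
  obtain ⟨a, ha, b, hb, rfl⟩ := Finset.mem_sub.mp hz
  simp only [Finset.mem_filter, Finset.mem_univ, true_and] at ha hb ⊢
  have := Finset.sub_mem_sub ha hb
  rwa [add_sub_add_left_eq_sub, ← sub_smul] at this

lemma lineLemma' {p : ℕ} [Fact p.Prime] {V : Type*} [AddCommGroup V] [Module (ZMod p) V] [Fintype V]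
    [DecidableEq V] (A : Finset V) (k : ℕ) (h : k * Fintype.card V < p * A.card) (hk : 2*k+1 ≤ p)
    (v : V) :
    2*k ≤ ((Finset.univ.erase (0 : ZMod p)).filter fun s => s • v ∈ A - A).card := by
  have h1 := lineLemma A k h v
  have h2 : (Finset.univ.filter fun s : ZMod p => s • v ∈ A - A) ⊆
      insert 0 ((Finset.univ.erase (0 : ZMod p)).filter fun s => s • v ∈ A - A) := by
    intro s; simp; tauto
  have h3 := (Finset.card_le_card h2).trans (Finset.card_insert_le _ _)
  omega

lemma perp {p : ℕ} [Fact p.Prime] (w : ZMod p × ZMod p) (hw : w ≠ 0) :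
    (Finset.univ.filter fun v : ZMod p × ZMod p => w.1 * v.1 + w.2 * v.2 = 0).card = p := by
  obtain ⟨a, b⟩ := w
  have hab : a ≠ 0 ∨ b ≠ 0 := by
    by_contra h; push Not at h; exact hw (by simp [h.1, h.2])
  have : (Finset.univ.filter fun v : ZMod p × ZMod p => a * v.1 + b * v.2 = 0) =
      Finset.univ.image (fun s : ZMod p => (s * (-b), s * a)) := by
    ext ⟨x, y⟩
    simp only [Finset.mem_filter, Finset.mem_univ, true_and, Finset.mem_image, Prod.mk.injEq]
    constructor
    · intro h
      rcases hab with ha | hb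
      · refine ⟨y / a, ?_, by field_simp⟩
        field_simp
        linear_combination (-1) * h
      · refine ⟨-x / b, by field_simp, ?_⟩
        field_simp
        linear_combination (-1) * h
    · rintro ⟨s, rfl, rfl⟩
      ring
  simp only
  rw [this, Finset.card_image_of_injective, Finset.card_univ, ZMod.card]
  intro s s' h
  simp only [Prod.mk.injEq] at h
  rcases hab with ha | hb
  · exact mul_right_cancel₀ ha h.2
  · exact mul_right_cancel₀ (neg_ne_zero.mpr hb) h.1

def phi {p : ℕ} (w : ZMod p × ZMod p) : ZMod p × ZMod p →+ ZMod p where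
  toFun v := w.1 * v.1 + w.2 * v.2
  map_zero' := by simp
  map_add' x y := by simp; ring

lemma final2 (p q k n : ℕ) (hp : p = 2*q+1) (hk : 1 ≤ k) (hkp : 2*k+1 < p) (hn : n = k*p+1)
    (h : (p-1) * (n * (p + n)) ≤ (p^2-1) * (k*n + (k+1)*q)) : False := by
  have h1 : (p-1) * (n * (p+n)) ≤ (p-1) * ((p+1) * (k*n+(k+1)*q)) := by
    refine h.trans (le_of_eq ?_)
    rw [← mul_assoc]
    congr 1
    have := Nat.sq_sub_sq p 1
    rw [one_pow] at this
    rw [this, mul_comm]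
  have h2 := Nat.le_of_mul_le_mul_left h1 (by omega)
  obtain ⟨j, rfl⟩ : ∃ j, k = j + 1 := ⟨k-1, by omega⟩
  obtain ⟨i, rfl⟩ : ∃ i, q = j + 2 + i := ⟨q - (j+2), by omega⟩
  subst hn
  subst hp
  ring_nf at h2
  nlinarith [Nat.zero_le (j*i), Nat.zero_le (j*i*i), Nat.zero_le (j*j*i)]

lemma twoDim0 {p : ℕ} [Fact p.Prime] (A : Finset (ZMod p × ZMod p))
    (k q : ℕ) (hp : p = 2*q+1) (hk : 1 ≤ k) (hkp : 2*k+1 < p) (hA : A.card = k*p+1) :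
    (2*k+1)*p ≤ (A - A).card := by
  have hpp : 0 < p := by omega
  have hcardV : Fintype.card (ZMod p × ZMod p) = p * p := by simp [ZMod.card]
  by_contra hcon
  have hsmall : ∀ w : ZMod p × ZMod p, w ≠ 0 → ∀ x, (A.filter fun a => phi w a = x).card ≤ q := by
    intro w hw x
    by_contra hx
    apply hcon
    set X := A.filter fun a => phi w a = x with hX
    have hXne : X.Nonempty := Finset.card_pos.mp (by omega)
    have h1 := cdFF X X hXne hXne
    set K := Finset.univ.filter fun v : ZMod p × ZMod p => w.1 * v.1 + w.2 * v.2 = 0 with hK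
    have hKc : K.card = p := perp w hw
    have hXK : X - X ⊆ K := by
      intro z hz
      obtain ⟨u, hu, v, hv, rfl⟩ := Finset.mem_sub.mp hz
      rw [hX, Finset.mem_filter] at hu hv
      rw [hK, Finset.mem_filter]
      refine ⟨Finset.mem_univ _, ?_⟩
      show phi w (u - v) = 0
      rw [map_sub, hu.2, hv.2, sub_self]
    have hXKe : X - X = K := Finset.eq_of_subset_of_card_le hXK (by omega)
    have hKD : K ⊆ A - A := by
      rw [← hXKe]
      exact Finset.sub_subset_sub (Finset.filter_subset _ _) (Finset.filter_subset _ _)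
    have hls := lineSum (p := p) (A - A)
    have hlow : ∀ v : ZMod p × ZMod p, (if v ∈ K then p - 1 else 2*k) ≤
        ((Finset.univ.erase (0 : ZMod p)).filter fun s => s • v ∈ A - A).card := by
      intro v
      split_ifs with hv
      · rw [Finset.filter_true_of_mem]
        · simp [Finset.card_erase_of_mem, ZMod.card]
        · intro s _
          apply hKD
          rw [hK, Finset.mem_filter] at hv ⊢
          refine ⟨Finset.mem_univ _, ?_⟩
          simp only [Prod.smul_fst, Prod.smul_snd, smul_eq_mul]
          linear_combination s * hv.2
      · apply lineLemma' A k _ (by omega)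
        rw [hcardV, hA]
        nlinarith
    have hsum := Finset.sum_le_sum (fun v (_ : v ∈ Finset.univ) => hlow v)
    rw [hls, Finset.sum_ite, Finset.sum_const, Finset.sum_const, Finset.filter_not,
      Finset.card_sdiff_of_subset (Finset.filter_subset _ _)] at hsum
    simp only [Finset.filter_mem_eq_inter, Finset.univ_inter, hKc, Finset.card_univ, hcardV,
      smul_eq_mul] at hsum
    have e : p * (p-1) + (p*p - p) * (2*k) = (p-1) * ((2*k+1)*p) := by
      have : p * p - p = p * (p-1) := by rw [Nat.mul_sub, mul_one]
      rw [this]; ring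
    rw [e] at hsum
    exact Nat.le_of_mul_le_mul_left hsum (by omega)
  have hP : ∀ w : ZMod p × ZMod p, w ≠ 0 →
      ((A ×ˢ A).filter fun ab => phi w ab.1 = phi w ab.2).card ≤ k * A.card + (k+1)*q := by
    intro w hw
    rcases func A (phi w) k q hp hk hkp hA with h | ⟨x, hx⟩ | ⟨h1, h2⟩
    · exact absurd h hcon
    · have := hsmall w hw x; omega
    · have e : ((A ×ˢ A).filter fun ab => phi w ab.1 = phi w ab.2).card =
          ∑ x, (A.filter fun a => phi w a = x).card ^ 2 := by
        rw [Finset.card_eq_sum_card_fiberwise (f := fun ab => phi w ab.1) (t := Finset.univ)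
          (by simp)]
        apply Finset.sum_congr rfl
        intro x _
        rw [sq, ← Finset.card_product]
        congr 1
        ext ⟨u, v⟩
        simp only [Finset.mem_filter, Finset.mem_product]
        constructor
        · rintro ⟨⟨⟨hu, hv⟩, h⟩, h'⟩
          exact ⟨⟨hu, h'⟩, hv, by rw [← h, h']⟩
        · rintro ⟨⟨hu, h'⟩, hv, h⟩
          exact ⟨⟨⟨hu, hv⟩, by rw [h, h']⟩, h'⟩
      have hpt : ∀ x ∈ (Finset.univ : Finset (ZMod p)), (A.filter fun a => phi w a = x).card ^ 2 +
          (k+1) * (if k+1 ≤ (A.filter fun a => phi w a = x).card then 0 else 1) ≤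
          k * (A.filter fun a => phi w a = x).card + (k+1) := by
        intro x _
        have := h1 x
        set f := (A.filter fun a => phi w a = x).card
        split_ifs with hf
        · have : f = k+1 := by omega
          rw [this]; apply le_of_eq; ring
        · have : f ≤ k := by omega
          nlinarith
      have hs := Finset.sum_le_sum hpt
      rw [Finset.sum_add_distrib, Finset.sum_add_distrib, ← e, ← Finset.mul_sum,
        ← Finset.mul_sum, ← Finset.card_eq_sum_card_fiberwise (f := phi w) (t := Finset.univ) (by simp)] at hs
      have hc : (∑ x : ZMod p, if k+1 ≤ (A.filter fun a => phi w a = x).card then 0 else 1) +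
          (Finset.univ.filter fun x => k+1 ≤ (A.filter fun a => phi w a = x).card).card = p := by
        rw [Finset.card_filter, ← Finset.sum_add_distrib]
        have : ∀ x ∈ (Finset.univ : Finset (ZMod p)), ((if k+1 ≤ (A.filter fun a => phi w a = x).card then 0 else 1) +
          (if k+1 ≤ (A.filter fun a => phi w a = x).card then 1 else 0)) = 1 := by
          intro x _; split_ifs <;> rfl
        rw [Finset.sum_congr rfl this]
        simp [ZMod.card]
      simp only [Finset.sum_const, Finset.card_univ, ZMod.card, smul_eq_mul] at hs
      set S := (∑ x : ZMod p, if k+1 ≤ (A.filter fun a => phi w a = x).card then 0 else 1)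
      have hS : q + 1 ≤ S := by omega
      nlinarith
  have htot : ∑ w : ZMod p × ZMod p, ((A ×ˢ A).filter fun ab => phi w ab.1 = phi w ab.2).card =
      A.card * (p*p) + (A.card * A.card - A.card) * p := by
    simp only [Finset.card_filter]
    rw [Finset.sum_comm]
    simp only [← Finset.card_filter]
    have : ∀ ab ∈ A ×ˢ A, (Finset.univ.filter fun w : ZMod p × ZMod p => phi w ab.1 = phi w ab.2).card
        = if ab.1 = ab.2 then p * p else p := by
      rintro ⟨a, b⟩ _
      split_ifs with hab
      · simp only at hab
        subst hab
        simp [ZMod.card]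
      · refine Eq.trans ?_ (perp (a - b) (sub_ne_zero.mpr hab))
        congr 1
        ext w
        simp only [Finset.mem_filter, Finset.mem_univ, true_and]
        rw [← sub_eq_zero, ← map_sub]
        show w.1 * (a-b).1 + w.2 * (a-b).2 = 0 ↔ _
        rw [mul_comm, mul_comm w.2]
    have e1 : (A ×ˢ A).filter (fun ab => ab.1 = ab.2) = A.diag := by
      ext ⟨a, b⟩
      simp only [Finset.mem_filter, Finset.mem_product, Finset.mem_diag]
      constructor
      · rintro ⟨⟨h1, h2⟩, h3⟩; exact ⟨h1, h3⟩
      · rintro ⟨h1, h3⟩; exact ⟨⟨h1, h3 ▸ h1⟩, h3⟩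
    have e2 : (A ×ˢ A).filter (fun ab => ¬ ab.1 = ab.2) = A.offDiag := by
      ext ⟨a, b⟩
      simp only [Finset.mem_filter, Finset.mem_product, Finset.mem_offDiag]
      tauto
    rw [Finset.sum_congr rfl this, Finset.sum_ite, Finset.sum_const, Finset.sum_const,
      e1, e2, Finset.diag_card, Finset.offDiag_card]
    simp
  rw [← Finset.add_sum_erase _ _ (Finset.mem_univ 0)] at htot
  have h0 : ((A ×ˢ A).filter fun ab => phi 0 ab.1 = phi 0 ab.2).card = A.card * A.card := by
    rw [Finset.filter_true_of_mem, Finset.card_product]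
    intro ab _
    simp [phi]
  have hub := Finset.sum_le_card_nsmul (Finset.univ.erase (0 : ZMod p × ZMod p))
    (fun w => ((A ×ˢ A).filter fun ab => phi w ab.1 = phi w ab.2).card) (k * A.card + (k+1)*q)
    (fun w hw => hP w (Finset.ne_of_mem_erase hw))
  rw [Finset.card_erase_of_mem (Finset.mem_univ _), Finset.card_univ, hcardV] at hub
  apply final2 p q k A.card hp hk hkp hA
  rw [h0] at htot
  refine le_trans (le_of_eq ?_) (by simpa [sq] using hub)
  have e1 : A.card ≤ A.card * A.card := Nat.le_mul_self _
  zify [e1, show 1 ≤ p by omega] at htot ⊢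
  linear_combination (-1) * htot

lemma twoDim {p : ℕ} [Fact p.Prime] (A : Finset (ZMod p × ZMod p))
    (k : ℕ) (hk : 1 ≤ k) (hkp : 2*k+1 < p) (hA : k*p+1 ≤ A.card) :
    (2*k+1)*p ≤ (A - A).card := by
  obtain ⟨B, hBA, hB⟩ := Finset.exists_subset_card_eq hA
  have hodd : Odd p := (Fact.out : p.Prime).odd_of_ne_two (by omega)
  obtain ⟨q, hq⟩ := hodd
  exact (twoDim0 B k q hq hk hkp hB).trans (Finset.card_le_card (Finset.sub_subset_sub hBA hBA))

lemma planeLemma {p : ℕ} [Fact p.Prime] {V : Type*} [AddCommGroup V] [Module (ZMod p) V] [Fintype V]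
    [DecidableEq V] (A : Finset V) (k : ℕ) (h : k * Fintype.card V < p * A.card)
    (hk : 1 ≤ k) (hkp : 2*k+1 < p) (u v : V) :
    (2*k+1)*p ≤ (Finset.univ.filter fun s : ZMod p × ZMod p => s.1 • u + s.2 • v ∈ A - A).card := by
  have hp : 0 < p := by omega
  obtain ⟨x, hx⟩ := averaging A (fun s : ZMod p × ZMod p => s.1 • u + s.2 • v) (k*p) (by
    rw [Fintype.card_prod, ZMod.card]
    calc k * p * Fintype.card V = p * (k * Fintype.card V) := by ring
      _ < p * (p * A.card) := Nat.mul_lt_mul_of_pos_left h hp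
      _ = _ := by ring)
  refine (twoDim _ k hk hkp hx).trans (Finset.card_le_card ?_)
  intro z hz
  obtain ⟨a, ha, b, hb, rfl⟩ := Finset.mem_sub.mp hz
  simp only [Finset.mem_filter, Finset.mem_univ, true_and] at ha hb ⊢
  have := Finset.sub_mem_sub ha hb
  rw [add_sub_add_left_eq_sub] at this
  convert this using 1
  simp only [Prod.fst_sub, Prod.snd_sub, sub_smul]
  abel

lemma erase_card {p : ℕ} [Fact p.Prime] {V : Type*} [AddCommGroup V] [Module (ZMod p) V]
    [DecidableEq V] (D : Finset V) (h0 : (0 : V) ∈ D) (v : V) :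
    (Finset.univ.filter fun s : ZMod p => s • v ∈ D).card =
      ((Finset.univ.erase (0 : ZMod p)).filter fun s => s • v ∈ D).card + 1 := by
  rw [← Finset.card_insert_of_notMem (a := (0 : ZMod p)) (by simp)]
  congr 1
  ext s
  simp only [Finset.mem_filter, Finset.mem_univ, true_and, Finset.mem_insert, Finset.mem_erase, and_true]
  by_cases hs : s = 0
  · simp [hs, h0]
  · simp [hs]

lemma lineBound {p : ℕ} [Fact p.Prime] {V : Type*} [AddCommGroup V] [Module (ZMod p) V] [Fintype V]
    [DecidableEq V] (D : Finset V) (h0 : (0 : V) ∈ D) (m : ℕ)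
    (h : ∀ v : V, v ≠ 0 → m ≤ ((Finset.univ.erase (0 : ZMod p)).filter fun s => s • v ∈ D).card) :
    (p - 1) + (Fintype.card V - 1) * m ≤ (p - 1) * D.card := by
  rw [← lineSum (p := p) D, ← Finset.add_sum_erase _ _ (Finset.mem_univ 0)]
  apply add_le_add
  · simp [h0, Finset.card_erase_of_mem, ZMod.card]
  · have := Finset.card_nsmul_le_sum (Finset.univ.erase (0 : V)) (fun v =>
      ((Finset.univ.erase (0 : ZMod p)).filter fun s => s • v ∈ D).card) m
      (fun v hv => h v (Finset.ne_of_mem_erase hv))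
    rwa [Finset.card_erase_of_mem (Finset.mem_univ _), Finset.card_univ, smul_eq_mul] at this

lemma lower1 {p : ℕ} [Fact p.Prime] {V : Type*} [AddCommGroup V] [Module (ZMod p) V] [Fintype V]
    [DecidableEq V] (A : Finset V) (k t : ℕ) (hV : Fintype.card V = p^(t+1))
    (hA : k * p^t < A.card) (hk : 1 ≤ k) :
    p^t * min (2*k+1) p ≤ (A - A).card := by
  have hp1 : 1 < p := (Fact.out : p.Prime).one_lt
  have hpt : 0 < p^t := Nat.pow_pos (by omega)
  have h : k * Fintype.card V < p * A.card := by
    rw [hV, pow_succ]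
    calc k * (p^t*p) = p * (k * p^t) := by ring
      _ < _ := Nat.mul_lt_mul_of_pos_left hA (by omega)
  obtain ⟨a, ha⟩ : A.Nonempty := Finset.card_pos.mp (by omega)
  have h0 : (0 : V) ∈ A - A := by
    have := Finset.sub_mem_sub ha ha
    rwa [sub_self] at this
  by_cases hkp : p ≤ 2*k+1
  · rw [min_eq_right hkp]
    have : A - A = Finset.univ := by
      ext v
      simp only [Finset.mem_univ, iff_true]
      have h1 := lineLemma A k h v
      rw [min_eq_left hkp] at h1
      have h2 : (Finset.univ.filter fun s : ZMod p => s • v ∈ A - A) = Finset.univ :=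
        Finset.eq_univ_of_card _ (le_antisymm (Finset.card_le_univ _) (by rwa [ZMod.card]))
      have h3 : (1 : ZMod p) ∈ (Finset.univ.filter fun s : ZMod p => s • v ∈ A - A) := by
        rw [h2]; exact Finset.mem_univ _
      simpa using h3
    rw [this, Finset.card_univ, hV, pow_succ]
  · push Not at hkp
    rw [min_eq_left hkp.le]
    by_cases hall : ∀ v : V, v ≠ 0 →
        2*k+1 ≤ ((Finset.univ.erase (0 : ZMod p)).filter fun s => s • v ∈ A - A).card
    · have h1 := lineBound (A - A) h0 (2*k+1) hall
      rw [hV] at h1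
      apply Nat.le_of_mul_le_mul_left _ (by omega : 0 < p - 1)
      refine le_trans ?_ h1
      have hpt1 : 1 ≤ p^(t+1) := Nat.pow_pos (by omega)
      have hpp : p^(t+1) = p^t * p := pow_succ _ _
      zify [hp1.le, hpt1] at hpp ⊢
      rw [hpp]
      have a1 : (1:ℤ) ≤ (p:ℤ)^t := by exact_mod_cast hpt
      have a2 : (2*(k:ℤ)+1) + 1 ≤ p := by exact_mod_cast hkp
      nlinarith [mul_le_mul_of_nonneg_right a1 (by positivity : (0:ℤ) ≤ 2*k+1)]
    · push Not at hall
      obtain ⟨u, hu, hcu⟩ := hall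
      have hcu' : (Finset.univ.filter fun s : ZMod p => s • u ∈ A - A).card ≤ 2*k+1 := by
        rw [erase_card _ h0]; omega
      have hv : ∀ v : V, (2*k+1)*(p-1) ≤ (((Finset.univ : Finset (ZMod p)) ×ˢ
          (Finset.univ.erase (0 : ZMod p))).filter fun s => s.1 • u + s.2 • v ∈ A - A).card := by
        intro v
        have h1 := planeLemma A k h hk hkp u v
        have h2 : (Finset.univ.filter fun s : ZMod p × ZMod p => s.1 • u + s.2 • v ∈ A - A) ⊆
          (((Finset.univ : Finset (ZMod p)) ×ˢ
          (Finset.univ.erase (0 : ZMod p))).filter fun s => s.1 • u + s.2 • v ∈ A - A) ∪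
          (Finset.univ.filter fun s : ZMod p => s • u ∈ A - A).image (fun s => (s, (0 : ZMod p))) := by
          rintro ⟨s, r⟩ hs
          simp only [Finset.mem_filter, Finset.mem_univ, true_and] at hs
          simp only [Finset.mem_union, Finset.mem_filter, Finset.mem_product, Finset.mem_univ,
            Finset.mem_erase, true_and, Finset.mem_image, Prod.mk.injEq, and_true]
          by_cases hr : r = 0
          · right
            refine ⟨s, ?_, rfl, hr.symm⟩
            rw [hr] at hs; simpa using hs
          · left; exact ⟨hr, hs⟩
        have h3 := ((Finset.card_le_card h2).trans (Finset.card_union_le _ _)).trans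
          (add_le_add_right Finset.card_image_le _)
        rw [Nat.mul_sub, mul_one]
        omega
      have hs := Finset.card_nsmul_le_sum Finset.univ _ _ (fun v (_ : v ∈ Finset.univ) => hv v)
      have he : ∑ v : V, (((Finset.univ : Finset (ZMod p)) ×ˢ
          (Finset.univ.erase (0 : ZMod p))).filter fun s => s.1 • u + s.2 • v ∈ A - A).card =
          p * (p-1) * (A - A).card := by
        simp only [Finset.card_filter]
        rw [Finset.sum_comm]
        have : ∀ s ∈ ((Finset.univ : Finset (ZMod p)) ×ˢ (Finset.univ.erase (0 : ZMod p))),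
            (∑ v : V, if s.1 • u + s.2 • v ∈ A - A then 1 else 0) = (A - A).card := by
          intro s hs
          have hs0 : s.2 ≠ 0 := by simpa using hs
          rw [← Finset.card_filter]
          apply Finset.card_bij (fun v _ => s.1 • u + s.2 • v)
          · intro v hv; simpa using hv
          · intro v _ w _ h; exact smul_right_injective V hs0 (add_left_cancel h)
          · intro b hb
            refine ⟨s.2⁻¹ • (b - s.1 • u), ?_, ?_⟩
            · simp only [Finset.mem_filter, Finset.mem_univ, true_and]
              rw [smul_smul, mul_inv_cancel₀ hs0, one_smul, add_sub_cancel]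
              exact hb
            · rw [smul_smul, mul_inv_cancel₀ hs0, one_smul, add_sub_cancel]
        rw [Finset.sum_congr rfl this]
        simp [Finset.card_erase_of_mem, ZMod.card]
      rw [he, Finset.card_univ, hV, smul_eq_mul] at hs
      apply Nat.le_of_mul_le_mul_left _ (Nat.mul_pos (by omega : 0 < p) (by omega : 0 < p - 1))
      refine le_trans (le_of_eq ?_) hs
      rw [pow_succ]; ring

lemma lower {p : ℕ} [Fact p.Prime] (k t : ℕ) (hk : 1 ≤ k) (n : ℕ) :
    ∀ (V : Type) [AddCommGroup V] [Module (ZMod p) V] [Fintype V]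
    [DecidableEq V] (A : Finset V), Fintype.card V = p^(t+1+n) → k * p^t < A.card →
    p^t * min (2*k+1) p ≤ (A - A).card := by
  have hp1 : 1 < p := (Fact.out : p.Prime).one_lt
  induction n with
  | zero => intro V _ _ _ _ A hV hA; exact lower1 A k t hV hA hk
  | succ n ih =>
    intro V _ _ _ _ A hV hA
    obtain ⟨a, ha⟩ : A.Nonempty := Finset.card_pos.mp (by omega)
    have h0 : (0 : V) ∈ A - A := by
      have := Finset.sub_mem_sub ha ha
      rwa [sub_self] at this
    by_cases hall : ∀ v : V, v ≠ 0 →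
        1 ≤ ((Finset.univ.erase (0 : ZMod p)).filter fun s => s • v ∈ A - A).card
    · have h1 := lineBound (A - A) h0 1 hall
      have h2 : p^t * min (2*k+1) p ≤ p^(t+1) := by
        rw [pow_succ]; exact Nat.mul_le_mul_left _ (min_le_right _ _)
      refine h2.trans ?_
      apply Nat.le_of_mul_le_mul_left _ (by omega : 0 < p - 1)
      refine le_trans ?_ h1
      rw [hV]
      have h3 : p^(t+1+1) ≤ p^(t+1+(n+1)) := Nat.pow_le_pow_right (by omega) (by omega)
      have h4 : (p-1)*p^(t+1) ≤ p^(t+1+1) := by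
        rw [pow_succ _ (t+1), mul_comm]
        exact Nat.mul_le_mul_left _ (by omega)
      omega
    · push Not at hall
      obtain ⟨v, hv, hcv⟩ := hall
      have hv' : ∀ s : ZMod p, s ≠ 0 → s • v ∉ A - A := by
        intro s hs hmem
        have : 0 < ((Finset.univ.erase (0 : ZMod p)).filter fun s => s • v ∈ A - A).card :=
          Finset.card_pos.mpr ⟨s, by simp [hs, hmem]⟩
        omega
      classical
      let W := Submodule.span (ZMod p) {v}
      let _ : Fintype (V ⧸ W) := Fintype.ofFinite _
      let π : V →ₗ[ZMod p] V ⧸ W := W.mkQ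
      have hinj : Set.InjOn π A := by
        intro x hx y hy hxy
        have hm : x - y ∈ W := (Submodule.Quotient.eq W).mp hxy
        obtain ⟨s, hs⟩ := Submodule.mem_span_singleton.mp hm
        by_cases hs0 : s = 0
        · rw [hs0, zero_smul] at hs
          exact sub_eq_zero.mp hs.symm
        · exact absurd (hs ▸ Finset.sub_mem_sub hx hy) (hv' s hs0)
      have hcardW : Nat.card W = p := by
        have e := LinearEquiv.toSpanNonzeroSingleton (ZMod p) V v hv
        rw [← Nat.card_congr e.toEquiv, Nat.card_zmod]
      have hcard : Fintype.card (V ⧸ W) = p^(t+1+n) := by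
        have h1 := Submodule.card_eq_card_quotient_mul_card W
        rw [hcardW, Nat.card_eq_fintype_card, hV, Nat.card_eq_fintype_card, ← add_assoc,
          pow_succ] at h1
        exact Nat.eq_of_mul_eq_mul_left (show 0 < p by omega) (by rw [← h1, mul_comm])
      have h1 := ih (V ⧸ W) (A.image π) hcard (by rwa [Finset.card_image_of_injOn hinj])
      refine h1.trans ?_
      have hi : A.image π - A.image π ⊆ (A - A).image π := by
        intro z hz
        obtain ⟨x, hx, y, hy, rfl⟩ := Finset.mem_sub.mp hz
        obtain ⟨i, hi, rfl⟩ := Finset.mem_image.mp hx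
        obtain ⟨j, hj, rfl⟩ := Finset.mem_image.mp hy
        exact Finset.mem_image.mpr ⟨i - j, Finset.sub_mem_sub hi hj, map_sub _ _ _⟩
      exact (Finset.card_le_card hi).trans Finset.card_image_le

lemma upper (p : ℕ) [Fact p.Prime] (d t r l : ℕ) (htd : t < d) (hl1 : 1 ≤ l) (hl2 : l ≤ p)
    (hr : r ≤ p^t * l) :
    ∃ A : Finset (Fin d → ZMod p), A.card = r ∧ (A - A).card ≤ p^t * min (2*l-1) p := by
  let I : Finset (ZMod p) := (Finset.range l).image (fun n : ℕ => (n : ZMod p))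
  have hI : I.card = l := by
    rw [Finset.card_image_of_injOn, Finset.card_range]
    intro x hx y hy hxy
    simp only [Finset.coe_range, Set.mem_Iio] at hx hy
    have := (ZMod.natCast_eq_natCast_iff' x y p).mp hxy
    rwa [Nat.mod_eq_of_lt (by omega), Nat.mod_eq_of_lt (by omega)] at this
  have hII : (I - I).card ≤ min (2*l-1) p := by
    apply le_min
    · have hsub : I - I ⊆ (Finset.range (2*l-1)).image (fun n : ℕ => (n : ZMod p) - ((l-1 : ℕ) : ZMod p)) := by
        intro z hz
        obtain ⟨x, hx, y, hy, rfl⟩ := Finset.mem_sub.mp hz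
        obtain ⟨i, hi, rfl⟩ := Finset.mem_image.mp hx
        obtain ⟨j, hj, rfl⟩ := Finset.mem_image.mp hy
        rw [Finset.mem_range] at hi hj
        refine Finset.mem_image.mpr ⟨i + (l-1-j), Finset.mem_range.mpr (by omega), ?_⟩
        have : ((l-1 : ℕ) : ZMod p) = ((l-1-j : ℕ) : ZMod p) + j := by
          rw [← Nat.cast_add]; congr 1; omega
        rw [this]; push_cast; ring
      exact (Finset.card_le_card hsub).trans (Finset.card_image_le.trans (by simp))
    · have := Finset.card_le_univ (I - I)
      rwa [ZMod.card] at this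
  let T : Finset (ZMod p) → Finset (Fin d → ZMod p) := fun J => Fintype.piFinset fun i : Fin d =>
    if i.1 < t then Finset.univ else if i.1 = t then J else {0}
  have hT : ∀ J, (T J).card = p^t * J.card := by
    intro J
    obtain ⟨e, rfl⟩ : ∃ e, d = t + (1 + e) := ⟨d - t - 1, by omega⟩
    simp only [T, Fintype.card_piFinset]
    rw [Fin.prod_univ_add, Fin.prod_univ_add]
    simp [ZMod.card]
  obtain ⟨A, hAT, hA⟩ := Finset.exists_subset_card_eq (s := T I) (n := r) (by rw [hT, hI]; exact hr)
  refine ⟨A, hA, ?_⟩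
  have h1 : A - A ⊆ T (I - I) := by
    intro z hz
    obtain ⟨x, hx, y, hy, rfl⟩ := Finset.mem_sub.mp hz
    have hx' := Fintype.mem_piFinset.mp (hAT hx)
    have hy' := Fintype.mem_piFinset.mp (hAT hy)
    refine Fintype.mem_piFinset.mpr fun i => ?_
    have hxi := hx' i
    have hyi := hy' i
    simp only [Pi.sub_apply]
    split_ifs at hxi hyi ⊢ with c1 c2
    · exact Finset.mem_univ _
    · exact Finset.sub_mem_sub hxi hyi
    · rw [Finset.mem_singleton] at hxi hyi ⊢
      rw [hxi, hyi, sub_self]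
  refine (Finset.card_le_card h1).trans ?_
  rw [hT]
  exact Nat.mul_le_mul_left _ hII

theorem rhoMinus_vector_space (p : ℕ) [Fact p.Prime] (d t r : ℕ) (htd : t ≤ d)
    (hr1 : p ^ t < r) (hr2 : r ≤ p ^ (t + 1)) (hr3 : r ≤ p ^ d) :
    rhoMinus (Fin d → ZMod p) r = p ^ t * min (2 * (r ⌈/⌉ p ^ t) - 1) p := by
  have hp1 : 1 < p := (Fact.out : p.Prime).one_lt
  have hpt : 0 < p^t := Nat.pow_pos (by omega)
  have htd' : t < d := by
    rcases htd.lt_or_eq with h | h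
    · exact h
    · subst h; omega
  set l := r ⌈/⌉ p ^ t with hl
  have hiff : ∀ c, l ≤ c ↔ r ≤ p^t * c := fun c => ceilDiv_le_iff_le_mul hpt
  have hlp : l ≤ p := (hiff p).mpr (by rwa [← pow_succ])
  have hrl : r ≤ p^t * l := (hiff l).mp le_rfl
  have hl2 : 2 ≤ l := by
    by_contra h
    have := (hiff 1).mp (by omega)
    omega
  have hlow : (l-1) * p^t < r := by
    by_contra h
    have := (hiff (l-1)).mpr (by rw [mul_comm]; omega)
    omega
  have hb : ∀ A : Finset (Fin d → ZMod p), A.card = r → p ^ t * min (2 * l - 1) p ≤ (A - A).card := by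
    intro A hA
    have h := lower (p := p) (l-1) t (by omega) (d - t - 1) (Fin d → ZMod p) A
      (by simp only [Fintype.card_pi, ZMod.card, Finset.prod_const, Finset.card_univ, Fintype.card_fin]
          congr 1; omega) (by rwa [hA])
    rwa [show 2 * (l-1) + 1 = 2*l-1 by omega] at h
  obtain ⟨A, hA, hAA⟩ := upper p d t r l htd' (by omega) hlp hrl
  have hmem : (A - A).card ∈ {n : ℕ | ∃ A : Finset (Fin d → ZMod p), A.card = r ∧ (A - A).card = n} :=
    ⟨A, hA, rfl⟩
  unfold rhoMinus
  apply le_antisymm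
  · exact (Nat.sInf_le hmem).trans hAA
  · refine le_csInf ⟨_, hmem⟩ ?_
    rintro n ⟨B, hB, rfl⟩
    exact hb B hB
end

section
/- Let p > 2 be a prime number, and let c and v be integers with 1 ≤ c ≤ (p−3)/2 and 1 ≤ v ≤ p. Let m = cp + v. Then ρ_±((ℤ/pℤ)², m, 2) = (2c+1)p. -/
open Pointwise

/-- The 2-fold signed sumset `2±A = (A + A) ∪ (-(A + A)) ∪ {a - b | a, b ∈ A, a ≠ b}`. -/
def signedSumset2 {G : Type*} [AddCommGroup G] [DecidableEq G] (A : Finset G) : Finset G :=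
  ((A + A) ∪ -(A + A)) ∪ A.offDiag.image fun q => q.1 - q.2

/-- `rhoPM G m` is the minimum cardinality of `2±A` over subsets `A ⊆ G` with `|A| = m`. -/
noncomputable def rhoPM (G : Type*) [AddCommGroup G] [Fintype G] [DecidableEq G] (m : ℕ) : ℕ :=
  sInf {n : ℕ | ∃ A : Finset G, A.card = m ∧ (signedSumset2 A).card = n}

open Finset

lemma seq_aux (p : ℕ) (hodd : p % 2 = 1) (c : ℕ) (hc : 1 ≤ c) (K : ℕ) (x f : ℕ → ℕ)
    (hK : c + 1 ≤ K) (hKp : 2 * (K + 1) + 1 ≤ p) (hx : Antitone x)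
    (hx1 : ∀ t, t < K + 1 → 1 ≤ x t) (hxp : ∀ t, x t ≤ p)
    (hN : c * p + 1 ≤ ∑ t ∈ range (K + 1), x t)
    (hf : ∀ t u, t < K + 1 → u < K + 1 → min p (x t + x u - 1) ≤ f (t + u))
    (hB : x 0 + x 1 ≤ p) :
    (2 * c + 1) * p ≤ ∑ s ∈ range (2 * K + 1), f s := by
  have hxK : 1 ≤ x K := hx1 K (by omega)
  have hx0 : ∀ t, x t ≤ x 0 := fun t => hx (by omega)
  have hx0' : ∀ t, 1 ≤ t → x t ≤ x 1 := fun t h => hx h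
  have hf' : ∀ t u, t < K + 1 → u < K + 1 → 1 ≤ u → x t + x u ≤ f (t + u) + 1 := by
    intro t u ht hu h1
    have := hf t u ht hu
    have a := hx0 t
    have b := hx0' u h1
    omega
  have hf0 : min p (2 * x 0 - 1) ≤ f 0 := by
    have := hf 0 0 (by omega) (by omega)
    rwa [← two_mul] at this
  have hN' : ∑ t ∈ range (K + 1), x t = ∑ t ∈ range K, x (t + 1) + x 0 := sum_range_succ' _ _
  -- path 1
  have p1 : 2 * (∑ t ∈ range K, x (t + 1)) + K * x 0 + K * x K + f 0 ≤
      (∑ s ∈ range (2 * K + 1), f s) + 2 * K := by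
    have e : ∑ s ∈ range (2 * K + 1), f s =
        (∑ s ∈ range K, f (0 + (s + 1))) + (∑ s ∈ range K, f (K + (s + 1))) + f 0 := by
      rw [sum_range_succ', two_mul, sum_range_add]
      simp [add_assoc]
    have a1 : ∑ s ∈ range K, (x 0 + x (s + 1)) ≤ ∑ s ∈ range K, (f (0 + (s + 1)) + 1) :=
      sum_le_sum fun s hs => by
        have := mem_range.1 hs
        exact hf' _ _ (by omega) (by omega) (by omega)
    have a2 : ∑ s ∈ range K, (x K + x (s + 1)) ≤ ∑ s ∈ range K, (f (K + (s + 1)) + 1) :=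
      sum_le_sum fun s hs => by
        have := mem_range.1 hs
        exact hf' _ _ (by omega) (by omega) (by omega)
    simp only [sum_add_distrib, sum_const, card_range, smul_eq_mul] at a1 a2
    rw [e]
    linarith
  have hKx : K * 1 ≤ K * x K := Nat.mul_le_mul_left _ hxK
  have hx01 : 1 ≤ x 0 := hx1 0 (by omega)
  have e2 : (2 * c + 1) * p = 2 * (c * p) + p := by ring
  have hcp : 1 * p ≤ c * p := Nat.mul_le_mul_right _ hc
  obtain ⟨b, hb⟩ : ∃ b, x 0 = b + 1 := ⟨x 0 - 1, by omega⟩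
  have e3 : K * x 0 = K * b + K := by rw [hb]; ring
  by_cases h1 : p ≤ 2 * x 0 - 1
  · have : 2 * b ≤ K * b := Nat.mul_le_mul_right _ (by omega)
    omega
  by_cases h2 : p ≤ K * b + 1
  · omega
  -- staircase
  have p2 : 4 * (∑ t ∈ range (K + 1), x t) ≤
      (∑ s ∈ range (2 * K + 1), f s) + x 0 + x K + (2 * K + 1) := by
    have e : ∀ n, ∑ s ∈ range (2 * n + 1), f s =
        (∑ s ∈ range n, f (s + (s + 1))) + (∑ s ∈ range (n + 1), f (s + s)) := by
      intro n
      induction n with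
      | zero => simp
      | succ n ih =>
        have q1 := sum_range_succ (fun s => f (s + (s + 1))) n
        have q2 := sum_range_succ (fun s => f (s + s)) (n + 1)
        rw [show 2 * (n + 1) + 1 = (2 * n + 1) + 1 + 1 by ring, sum_range_succ,
          sum_range_succ _ (2 * n + 1), ih, q1, q2,
          show n + (n + 1) = 2 * n + 1 by ring, show n + 1 + (n + 1) = 2 * n + 1 + 1 by ring]
        ring
    have a1 : ∑ s ∈ range K, (x s + x (s + 1)) ≤ ∑ s ∈ range K, (f (s + (s + 1)) + 1) :=
      sum_le_sum fun s hs => by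
        have := mem_range.1 hs
        exact hf' _ _ (by omega) (by omega) (by omega)
    have a2 : ∑ s ∈ range (K + 1), (x s + x s) ≤ ∑ s ∈ range (K + 1), (f (s + s) + 1) :=
      sum_le_sum fun s hs => by
        have := mem_range.1 hs
        have h3 := hf s s (by omega) (by omega)
        have h4 := hx0 s
        omega
    simp only [sum_add_distrib, sum_const, card_range, smul_eq_mul] at a1 a2
    have h5 : ∑ t ∈ range (K + 1), x t = ∑ t ∈ range K, x t + x K := sum_range_succ _ _
    rw [e]
    linarith
  have hNM : ∑ t ∈ range (K + 1), x t ≤ (K + 1) * x 0 := by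
    have := sum_le_card_nsmul (range (K + 1)) x (x 0) (fun t _ => hx0 t)
    simpa using this
  have hb2 : 2 ≤ b := by
    by_contra hcon
    have : (K + 1) * x 0 ≤ (K + 1) * 2 := Nat.mul_le_mul_left _ (by omega)
    omega
  have hK2 : 2 ≤ K := by omega
  have hprod : 2 * K + 2 * b ≤ K * b + 4 := by
    obtain ⟨k, rfl⟩ := Nat.exists_eq_add_of_le hK2
    obtain ⟨l, rfl⟩ := Nat.exists_eq_add_of_le hb2
    nlinarith [Nat.zero_le (k * l)]
  have := hx0 K
  omega


section Seq

lemma seq_lemma (p : ℕ) (hodd : p % 2 = 1) : ∀ (c : ℕ), 1 ≤ c → ∀ (K : ℕ) (x f : ℕ → ℕ),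
    c + 1 ≤ K → 2 * (K + 1) + 1 ≤ p → Antitone x → (∀ t, t < K + 1 → 1 ≤ x t) →
    (∀ t, x t ≤ p) →
    c * p + 1 ≤ ∑ t ∈ range (K + 1), x t →
    (∀ t u, t < K + 1 → u < K + 1 → min p (x t + x u - 1) ≤ f (t + u)) →
    (2 * c + 1) * p ≤ ∑ s ∈ range (2 * K + 1), f s := by
  intro c hc
  induction c, hc using Nat.le_induction with
  | base => ?_
  | succ c hc ih => ?_
  all_goals
    intro K x f hK hKp hx hx1 hxp hN hf
    by_cases hA : p + 1 ≤ x 0 + x 1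
  · -- base, case A
    obtain ⟨L, rfl⟩ : ∃ L, K = L + 2 := ⟨K - 2, by omega⟩
    have h0 := hf 0 0 (by omega) (by omega)
    have h1 := hf 0 1 (by omega) (by omega)
    have h2 := hf 0 2 (by omega) (by omega)
    have h3 := hf 1 2 (by omega) (by omega)
    have h4 := hx1 2 (by omega)
    have h5 := hx (show 0 ≤ 1 by omega)
    have h6 := hxp 0
    have h7 := hxp 1
    have : ∑ s ∈ range 4, f s ≤ ∑ s ∈ range (2 * (L + 2) + 1), f s :=
      sum_le_sum_of_subset (range_subset_range.2 (by omega))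
    have e4 : ∑ s ∈ range 4, f s = f 0 + f 1 + f 2 + f 3 := by simp [sum_range_succ]
    rw [e4] at this
    norm_num at h0 h1 h2 h3
    omega
  · exact seq_aux p hodd 1 le_rfl K x f hK hKp hx hx1 hxp hN hf (by omega)
  · obtain ⟨L, rfl⟩ : ∃ L, K = L + 1 := ⟨K - 1, by omega⟩
    have h0 := hf 0 0 (by omega) (by omega)
    have h1 := hf 0 1 (by omega) (by omega)
    have h5 := hx (show 0 ≤ 1 by omega)
    have h6 := hxp 0
    have := ih L (fun t => x (t + 1)) (fun s => f (s + 2)) (by omega) (by omega)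
      (fun a b h => hx (by omega)) (fun t ht => hx1 _ (by omega)) (fun t => hxp _)
      (by
        rw [sum_range_succ'] at hN
        have : (c + 1) * p = c * p + p := by ring
        omega)
      (fun t u ht hu => by
        have := hf (t + 1) (u + 1) (by omega) (by omega)
        convert this using 2
        ring)
    rw [show 2 * (L + 1) + 1 = (2 * L + 1) + 1 + 1 by ring, sum_range_succ', sum_range_succ']
    norm_num at h0 h1
    have e : (2 * (c + 1) + 1) * p = (2 * c + 1) * p + p + p := by ring
    simp only [add_assoc, zero_add] at this ⊢
    norm_num at this ⊢
    simp only [add_assoc] at e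
    omega
  · exact seq_aux p hodd (c + 1) (by omega) K x f hK hKp hx hx1 hxp hN hf (by omega)

end Seq

section Geo

variable {p : ℕ} [Fact p.Prime]

def rowF (B : Finset (ZMod p × ZMod p)) (i : ZMod p) : Finset (ZMod p) :=
  univ.filter fun y => (i, y) ∈ B

def lev (B : Finset (ZMod p × ZMod p)) (t : ℕ) : Finset (ZMod p) :=
  univ.filter fun i => t < (rowF B i).card

lemma rowF_card (B : Finset (ZMod p × ZMod p)) (i : ZMod p) :
    (rowF B i).card = (B.filter fun w => w.1 = i).card := by
  apply card_bij (fun y _ => (i, y))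
  · intro y hy
    simpa [rowF] using hy
  · intro a _ b _ h
    simpa using h
  · rintro ⟨a, b⟩ h
    simp only [mem_filter] at h
    obtain ⟨h1, h2⟩ := h
    subst h2
    exact ⟨b, by simpa [rowF] using h1, rfl⟩

lemma rowF_le (B : Finset (ZMod p × ZMod p)) (i : ZMod p) : (rowF B i).card ≤ p := by
  have := card_le_univ (rowF B i)
  rwa [ZMod.card] at this

lemma lev_le (B : Finset (ZMod p × ZMod p)) (t : ℕ) : (lev B t).card ≤ p := by
  have := card_le_univ (lev B t)
  rwa [ZMod.card] at this

lemma lev_antitone (B : Finset (ZMod p × ZMod p)) : Antitone fun t => (lev B t).card := by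
  intro a b h
  apply card_le_card
  intro i hi
  simp only [lev, mem_filter, mem_univ, true_and] at hi ⊢
  omega

lemma sum_rowF (B : Finset (ZMod p × ZMod p)) : ∑ i, (rowF B i).card = B.card := by
  simp_rw [rowF_card]
  exact (card_eq_sum_card_fiberwise (fun w _ => mem_coe.2 (mem_univ w.1))).symm

lemma sum_lev_of_le (B : Finset (ZMod p × ZMod p)) (M : ℕ) (hM : ∀ i, (rowF B i).card ≤ M) :
    ∑ t ∈ range M, (lev B t).card = B.card := by
  rw [← sum_rowF]
  simp only [lev, card_filter]
  rw [sum_comm]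
  apply sum_congr rfl
  intro i _
  rw [← card_filter]
  have : (range M).filter (fun t => t < (rowF B i).card) = range (rowF B i).card := by
    ext t
    have := hM i
    simp only [mem_filter, mem_range]
    omega
  rw [this, card_range]

lemma rowF_add (B : Finset (ZMod p × ZMod p)) (i j : ZMod p) :
    rowF B i + rowF B j ⊆ rowF (B + B) (i + j) := by
  intro y hy
  obtain ⟨a, ha, b, hb, rfl⟩ := mem_add.1 hy
  simp only [rowF, mem_filter, mem_univ, true_and] at ha hb ⊢
  exact mem_add.2 ⟨_, ha, _, hb, rfl⟩

lemma lev_add (B : Finset (ZMod p × ZMod p)) (t u : ℕ) (htu : t + u < p)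
    (ht : 1 ≤ (lev B t).card) (hu : 1 ≤ (lev B u).card) :
    min p ((lev B t).card + (lev B u).card - 1) ≤ (lev (B + B) (t + u)).card := by
  refine (ZMod.cauchy_davenport Fact.out (card_pos.1 ht) (card_pos.1 hu)).trans ?_
  apply card_le_card
  intro k hk
  obtain ⟨i, hi, j, hj, rfl⟩ := mem_add.1 hk
  simp only [lev, mem_filter, mem_univ, true_and] at hi hj ⊢
  have h1 := ZMod.cauchy_davenport (p := p) Fact.out (card_pos.1 (by omega : 0 < (rowF B i).card))
    (card_pos.1 (by omega : 0 < (rowF B j).card))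
  have h2 := card_le_card (rowF_add B i j)
  omega

lemma sum_lev_le (B : Finset (ZMod p × ZMod p)) (n : ℕ) (hn : n ≤ p) :
    ∑ t ∈ range n, (lev B t).card ≤ B.card := by
  rw [← sum_lev_of_le B p (rowF_le B)]
  exact sum_le_sum_of_subset (range_subset_range.2 hn)

/-- a direction with a moderately rich line -/
lemma case_two (B : Finset (ZMod p × ZMod p)) (c : ℕ) (hc : 1 ≤ c) (hp : p % 2 = 1)
    (hN : c * p + 1 ≤ B.card) (hsmall : ∀ i, 2 * (rowF B i).card + 1 ≤ p)
    (i : ZMod p) (hi : c + 2 ≤ (rowF B i).card) : (2 * c + 1) * p ≤ (B + B).card := by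
  obtain ⟨j, -, hj⟩ := exists_max_image univ (fun i => (rowF B i).card) ⟨i, mem_univ i⟩
  obtain ⟨K, hK⟩ : ∃ K, (rowF B j).card = K + 1 := ⟨(rowF B j).card - 1, by
    have := hj i (mem_univ _)
    omega⟩
  have hsj := hsmall j
  have hji := hj i (mem_univ _)
  have hx1 : ∀ t, t < K + 1 → 1 ≤ (lev B t).card := by
    intro t ht
    apply card_pos.2
    exact ⟨j, by simp [lev]; omega⟩
  refine (seq_lemma p hp c hc K (fun t => (lev B t).card) (fun t => (lev (B + B) t).card)
    (by omega) (by omega) (lev_antitone B) hx1 (lev_le B) ?_ ?_).trans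
    (sum_lev_le (B + B) _ (by omega))
  · rw [sum_lev_of_le]
    · exact hN
    · intro k
      have := hj k (mem_univ _)
      omega
  · intro t u ht hu
    exact lev_add B t u (by omega) (hx1 t ht) (hx1 u hu)

lemma case_three (B : Finset (ZMod p × ZMod p)) (c : ℕ) (hcp : 2 * c + 1 ≤ p)
    (ha : p + 1 ≤ 2 * (lev B c).card) : (2 * c + 1) * p ≤ (B + B).card := by
  refine le_trans ?_ (sum_lev_le (B + B) (2 * c + 1) hcp)
  have : ∀ s ∈ range (2 * c + 1), p ≤ (lev (B + B) s).card := by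
    intro s hs
    have hs := mem_range.1 hs
    obtain ⟨t, u, ht, hu, rfl⟩ : ∃ t u, t ≤ c ∧ u ≤ c ∧ s = t + u :=
      ⟨min s c, s - min s c, by omega, by omega, by omega⟩
    have h1 : (lev B c).card ≤ (lev B t).card := lev_antitone B ht
    have h2 : (lev B c).card ≤ (lev B u).card := lev_antitone B hu
    have := lev_add B t u (by omega) (by omega) (by omega)
    omega
  have := card_nsmul_le_sum (range (2 * c + 1)) (fun s => (lev (B + B) s).card) p this
  simpa using this

/-! ### directions -/

def psi : Option (ZMod p) → (ZMod p × ZMod p) →+ (ZMod p × ZMod p)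
  | none => AddMonoidHom.id _
  | some a =>
    { toFun := fun w => (w.2 - a * w.1, w.1)
      map_zero' := by simp
      map_add' := by
        intro x y
        ext
        · simp; ring
        · simp }

lemma psi_inj (θ : Option (ZMod p)) : Function.Injective (psi θ) := by
  cases θ with
  | none => exact fun a b h => h
  | some a =>
    rintro ⟨x, y⟩ ⟨x', y'⟩ h
    simp only [psi, AddMonoidHom.coe_mk, ZeroHom.coe_mk, Prod.mk.injEq] at h
    obtain ⟨h1, rfl⟩ := h
    simpa using h1

lemma psi_fst_some (a : ZMod p) (w : ZMod p × ZMod p) : (psi (some a) w).1 = w.2 - a * w.1 := rfl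

lemma psi_fst_none (w : ZMod p × ZMod p) : (psi none w).1 = w.1 := rfl

lemma psi_count (w : ZMod p × ZMod p) (hw : w ≠ 0) :
    (univ.filter fun θ : Option (ZMod p) => (psi θ w).1 = 0).card = 1 := by
  rw [card_eq_one]
  by_cases h : w.1 = 0
  · refine ⟨none, ?_⟩
    ext θ
    cases θ with
    | none => simp [psi_fst_none, h]
    | some a =>
      simp only [mem_filter, mem_univ, true_and, mem_singleton, psi_fst_some, h, mul_zero, sub_zero,
        reduceCtorEq, iff_false]
      intro h2
      exact hw (Prod.ext h h2)
  · refine ⟨some (w.2 / w.1), ?_⟩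
    ext θ
    cases θ with
    | none => simp [psi_fst_none, h]
    | some a =>
      simp only [mem_filter, mem_univ, true_and, mem_singleton, psi_fst_some, Option.some.injEq]
      rw [eq_div_iff h, sub_eq_zero, eq_comm]

lemma dir_sum (S : Finset (ZMod p × ZMod p)) (h0 : (0 : ZMod p × ZMod p) ∉ S) :
    ∑ θ : Option (ZMod p), (S.filter fun w => (psi θ w).1 = 0).card = S.card := by
  simp only [card_filter]
  rw [sum_comm, card_eq_sum_ones]
  apply sum_congr rfl
  intro w hw
  rw [← card_filter]
  exact psi_count w (fun h => h0 (h ▸ hw))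

/-- image of `B` under `psi θ` -/
def tB (θ : Option (ZMod p)) (B : Finset (ZMod p × ZMod p)) : Finset (ZMod p × ZMod p) :=
  B.image (psi θ)

lemma tB_card (θ : Option (ZMod p)) (B : Finset (ZMod p × ZMod p)) : (tB θ B).card = B.card :=
  card_image_of_injective _ (psi_inj θ)

lemma tB_add (θ : Option (ZMod p)) (B : Finset (ZMod p × ZMod p)) :
    tB θ B + tB θ B = tB θ (B + B) := (image_add (psi θ)).symm

lemma tB_row (θ : Option (ZMod p)) (B : Finset (ZMod p × ZMod p)) (i : ZMod p) :
    (rowF (tB θ B) i).card = (B.filter fun w => (psi θ w).1 = i).card := by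
  rw [rowF_card, tB, filter_image, card_image_of_injective _ (psi_inj θ)]

/-- lower bound for the part of `B + B` on a line through the origin -/
lemma line_bound (B : Finset (ZMod p × ZMod p)) (hB : ∀ w ∈ B, -w ∈ B) (θ : Option (ZMod p))
    (i : ZMod p) (h : 1 ≤ (rowF (tB θ B) i).card) :
    min p (2 * (rowF (tB θ B) i).card - 1) ≤
      (((B + B).erase 0).filter fun w => (psi θ w).1 = 0).card + 1 := by
  have hneg : rowF (tB θ B) (-i) = -rowF (tB θ B) i := by
    have key : ∀ w, w ∈ tB θ B → -w ∈ tB θ B := by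
      intro w hw
      obtain ⟨b, hb, rfl⟩ := mem_image.1 hw
      exact mem_image.2 ⟨-b, hB b hb, by simp⟩
    ext y
    simp only [rowF, mem_filter, mem_univ, true_and, mem_neg']
    constructor
    · intro h
      simpa using key _ h
    · intro h
      simpa using key _ h
  have h1 := ZMod.cauchy_davenport (p := p) (s := rowF (tB θ B) i) (t := rowF (tB θ B) (-i))
    Fact.out (card_pos.1 h) (by rw [hneg]; exact (card_pos.1 h).neg)
  have h2 := card_le_card (rowF_add (tB θ B) i (-i))
  rw [tB_add, add_neg_cancel, tB_row] at h2
  rw [hneg, card_neg, ← hneg] at h1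
  have h3 : ((B + B).filter fun w => (psi θ w).1 = 0).card ≤
      (((B + B).erase 0).filter fun w => (psi θ w).1 = 0).card + 1 := by
    rw [filter_erase]
    have := pred_card_le_card_erase (s := (B + B).filter fun w => (psi θ w).1 = 0) (a := 0)
    omega
  omega

end Geo

section Main

variable {p : ℕ} [Fact p.Prime]

lemma exists_row (B : Finset (ZMod p × ZMod p)) (c : ℕ) (hN : c * p + 1 ≤ B.card)
    (θ : Option (ZMod p)) : ∃ i, c + 1 ≤ (rowF (tB θ B) i).card := by
  by_contra h
  push Not at h
  have h1 := sum_le_card_nsmul univ (fun i => (rowF (tB θ B) i).card) c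
    (fun i _ => by have := h i; omega)
  rw [sum_rowF, tB_card, card_univ, ZMod.card, smul_eq_mul] at h1
  have : p * c = c * p := mul_comm _ _
  omega

lemma card_dir : (univ : Finset (Option (ZMod p))).card = p + 1 := by
  rw [card_univ, Fintype.card_option, ZMod.card]

/-- bound when no zero -/
lemma dir_bound (B : Finset (ZMod p × ZMod p)) (hB : ∀ w ∈ B, -w ∈ B) (q : ℕ)
    (hN : q * p + 1 ≤ B.card) :
    (p + 1) * min (p - 1) (2 * q) ≤ ((B + B).erase 0).card := by
  rw [← dir_sum _ (notMem_erase 0 (B + B)), ← card_dir, ← smul_eq_mul]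
  apply card_nsmul_le_sum
  intro θ _
  obtain ⟨i, hi⟩ := exists_row B q hN θ
  have := line_bound B hB θ i (by omega)
  omega

lemma case_one (B : Finset (ZMod p × ZMod p)) (hB : ∀ w ∈ B, -w ∈ B) (c : ℕ)
    (hcp : 2 * c + 3 ≤ p) (hN : c * p + 1 ≤ B.card) (θ : Option (ZMod p)) (i : ZMod p)
    (hi : p + 1 ≤ 2 * (rowF (tB θ B) i).card) :
    (2 * c + 1) * p ≤ ((B + B).erase 0).card + 1 := by
  rw [← dir_sum _ (notMem_erase 0 (B + B)), ← add_sum_erase _ _ (mem_univ θ)]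
  have h1 := line_bound B hB θ i (by omega)
  have h2 := card_nsmul_le_sum (univ.erase θ)
    (fun θ => (((B + B).erase 0).filter fun w => (psi θ w).1 = 0).card) (2 * c) (by
      intro η _
      obtain ⟨i, hi⟩ := exists_row B c hN η
      have := line_bound B hB η i (by omega)
      omega)
  rw [card_erase_of_mem (mem_univ _), card_dir, smul_eq_mul] at h2
  have : (2 * c + 1) * p = (p + 1 - 1) * (2 * c) + p := by
    rw [Nat.add_sub_cancel]; ring
  omega

lemma lev_pigeon (B : Finset (ZMod p × ZMod p)) (c : ℕ) (hc : 1 ≤ c) (hcp : 2 * c + 3 ≤ p)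
    (hN : c * p + 1 ≤ B.card)
    (hall : ∀ θ i, (rowF (tB θ B) i).card ≤ c + 1) :
    ∃ θ, p + 1 ≤ 2 * (lev (tB θ B) c).card := by
  by_contra hcon
  push Not at hcon
  -- incidences
  have h1 : ∀ b ∈ B, p + 1 ≤ c + (univ.filter fun θ : Option (ZMod p) =>
      c < (rowF (tB θ B) (psi θ b).1).card).card := by
    intro b hb
    have e1 : (B.image fun w => w - b).card = B.card :=
      card_image_of_injective _ (sub_left_injective)
    have e2 : ((B.image fun w => w - b).erase 0).card = B.card - 1 := by
      rw [card_erase_of_mem, e1]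
      exact mem_image.2 ⟨b, hb, sub_self b⟩
    rw [← dir_sum _ (notMem_erase 0 _)] at e2
    have e3 : ∀ θ ∈ (univ : Finset (Option (ZMod p))),
        (((B.image fun w => w - b).erase 0).filter fun w => (psi θ w).1 = 0).card ≤
        (c - 1) + if c < (rowF (tB θ B) (psi θ b).1).card then 1 else 0 := by
      intro θ _
      have e4 : (((B.image fun w => w - b)).filter fun w => (psi θ w).1 = 0).card =
          (rowF (tB θ B) (psi θ b).1).card := by
        rw [tB_row, filter_image, card_image_of_injective _ (sub_left_injective)]
        congr 1
        ext w
        simp [sub_eq_zero]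
      rw [filter_erase, card_erase_of_mem, e4]
      · have := hall θ (psi θ b).1
        split_ifs <;> omega
      · rw [mem_filter]
        exact ⟨mem_image.2 ⟨b, hb, sub_self b⟩, by simp⟩
    have e5 := sum_le_sum e3
    rw [e2, sum_add_distrib, ← card_filter, sum_const, card_dir, smul_eq_mul] at e5
    obtain ⟨d, rfl⟩ : ∃ d, c = d + 1 := ⟨c - 1, by omega⟩
    rw [Nat.add_sub_cancel] at e5
    have : (d + 1) * p = d * p + p := by ring
    have : (p + 1) * d = d * p + d := by ring
    omega
  have h2 : ∑ b ∈ B, (univ.filter fun θ : Option (ZMod p) =>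
      c < (rowF (tB θ B) (psi θ b).1).card).card =
      ∑ θ : Option (ZMod p), (B.filter fun b => c < (rowF (tB θ B) (psi θ b).1).card).card := by
    simp only [card_filter]
    rw [sum_comm]
  have h3 : ∀ θ ∈ (univ : Finset (Option (ZMod p))),
      2 * (B.filter fun b => c < (rowF (tB θ B) (psi θ b).1).card).card ≤ (c + 1) * (p - 1) := by
    intro θ _
    have e1 := card_le_mul_card_image_of_maps_to (s := B.filter fun b =>
      c < (rowF (tB θ B) (psi θ b).1).card) (t := lev (tB θ B) c) (f := fun b => (psi θ b).1)
      (by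
        intro b hb
        have := (mem_filter.1 hb).2
        simpa [lev] using this) (c + 1) (by
        intro i _
        refine le_trans (card_le_card ?_) ((tB_row θ B i).symm.le.trans (hall θ i))
        intro w hw
        simp only [mem_filter] at hw ⊢
        exact ⟨hw.1.1, hw.2⟩)
    have e2 := hcon θ
    calc _ ≤ 2 * ((c + 1) * (lev (tB θ B) c).card) := Nat.mul_le_mul_left _ e1
      _ = (c + 1) * (2 * (lev (tB θ B) c).card) := by ring
      _ ≤ _ := ?_
    rcases (Fact.out : p.Prime).eq_two_or_odd with h | h
    · omega
    · exact Nat.mul_le_mul_left _ (by omega)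
  have h4 := sum_le_card_nsmul _ _ _ h3
  rw [← mul_sum, ← h2, card_dir, smul_eq_mul] at h4
  have h5 := card_nsmul_le_sum B (fun b => (univ.filter fun θ : Option (ZMod p) =>
      c < (rowF (tB θ B) (psi θ b).1).card).card) (p + 1 - c) (fun b hb => by
        have := h1 b hb
        omega)
  rw [smul_eq_mul] at h5
  have h6 : (c * p + 1) * (p + 1 - c) ≤ B.card * (p + 1 - c) := Nat.mul_le_mul_right _ hN
  have h7 : 2 * ((c * p + 1) * (p + 1 - c)) ≤ (p + 1) * ((c + 1) * (p - 1)) := by omega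
  obtain ⟨k, rfl⟩ := Nat.exists_eq_add_of_le hcp
  obtain ⟨d, rfl⟩ := Nat.exists_eq_add_of_le hc
  have q1 : 2 * (1 + d) + 3 + k + 1 - (1 + d) = d + 5 + k := by omega
  have q2 : 2 * (1 + d) + 3 + k - 1 = 2 * d + 4 + k := by omega
  rw [q1, q2] at h7
  ring_nf at h7
  nlinarith [Nat.zero_le (d * k), Nat.zero_le (d * k * k), Nat.zero_le (d * d * k),
    Nat.zero_le (d * d * d)]

lemma main_sym (B : Finset (ZMod p × ZMod p)) (hB : ∀ w ∈ B, -w ∈ B) (c : ℕ) (hc : 1 ≤ c)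
    (hcp : 2 * c + 3 ≤ p) (hN : c * p + 1 ≤ B.card) :
    (2 * c + 1) * p ≤ (B + B).card := by
  have hodd : p % 2 = 1 := by
    rcases (Fact.out : p.Prime).eq_two_or_odd with h | h <;> omega
  by_cases h1 : ∃ θ i, p + 1 ≤ 2 * (rowF (tB θ B) i).card
  · obtain ⟨θ, i, hi⟩ := h1
    have h := case_one B hB c hcp hN θ i hi
    have h0 : (0 : ZMod p × ZMod p) ∈ B + B := by
      obtain ⟨w, hw⟩ : B.Nonempty := card_pos.1 (by omega)
      exact mem_add.2 ⟨w, hw, -w, hB w hw, by simp⟩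
    rwa [card_erase_add_one h0] at h
  push Not at h1
  by_cases h2 : ∃ θ i, c + 2 ≤ (rowF (tB θ B) i).card
  · obtain ⟨θ, i, hi⟩ := h2
    have := case_two (tB θ B) c hc hodd (by rwa [tB_card]) (fun j => by
      have := h1 θ j
      omega) i hi
    rwa [tB_add, tB_card] at this
  push Not at h2
  obtain ⟨θ, hθ⟩ := lev_pigeon B c hc hcp hN (fun θ i => by
    have := h2 θ i
    omega)
  have := case_three (tB θ B) c (by omega) hθ
  rwa [tB_add, tB_card] at this

lemma signed_lower (A : Finset (ZMod p × ZMod p)) (c : ℕ) (hc : 1 ≤ c)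
    (hcp : 2 * c + 3 ≤ p) (hN : c * p + 1 ≤ A.card) :
    (2 * c + 1) * p ≤ (signedSumset2 A).card := by
  have hsym : ∀ w ∈ A ∪ -A, -w ∈ A ∪ -A := by
    intro w hw
    simp only [mem_union, mem_neg', neg_neg] at hw ⊢
    exact hw.symm
  have hsub : ((A ∪ -A) + (A ∪ -A)).erase 0 ⊆ signedSumset2 A := by
    intro w hw
    obtain ⟨hw0, hw⟩ := mem_erase.1 hw
    obtain ⟨a, ha, b, hb, rfl⟩ := mem_add.1 hw
    simp only [mem_union, mem_neg'] at ha hb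
    simp only [signedSumset2, mem_union, mem_neg', mem_image, mem_offDiag]
    rcases ha with ha | ha <;> rcases hb with hb | hb
    · exact Or.inl (Or.inl (add_mem_add ha hb))
    · refine Or.inr ⟨(a, -b), ⟨ha, hb, ?_⟩, by simp⟩
      intro h
      have h : a = -b := h
      simp [h] at hw0
    · refine Or.inr ⟨(b, -a), ⟨hb, ha, ?_⟩, by simp [add_comm]⟩
      intro h
      have h : b = -a := h
      simp [h] at hw0
    · refine Or.inl (Or.inr ?_)
      rw [neg_add]
      exact add_mem_add ha hb
  by_cases hd : Disjoint A (-A)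
  · have hcard : (A ∪ -A).card = 2 * A.card := by
      rw [card_union_of_disjoint hd, card_neg, two_mul]
    have h1 := dir_bound (A ∪ -A) hsym (2 * c) (by
      rw [hcard]
      have : 2 * c * p = 2 * (c * p) := by ring
      omega)
    refine le_trans ?_ (h1.trans (card_le_card hsub))
    obtain ⟨k, rfl⟩ := Nat.exists_eq_add_of_le hcp
    rcases min_choice (2 * c + 3 + k - 1) (2 * (2 * c)) with h | h <;> rw [h]
    · rw [show 2 * c + 3 + k - 1 = 2 * c + 2 + k by omega]
      nlinarith
    · nlinarith
  · refine (main_sym (A ∪ -A) hsym c hc hcp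
      (hN.trans (card_le_card subset_union_left))).trans (card_le_card ?_)
    intro w hw
    by_cases h0 : w = 0
    · subst h0
      rw [not_disjoint_iff] at hd
      obtain ⟨a, ha, ha'⟩ := hd
      rw [mem_neg'] at ha'
      simp only [signedSumset2, mem_union]
      exact Or.inl (Or.inl (mem_add.2 ⟨a, ha, -a, ha', by simp⟩))
    · exact hsub (mem_erase.2 ⟨h0, hw⟩)

lemma signed_upper (c m : ℕ) (hcp : 2 * c + 3 ≤ p) (hm : m ≤ (c + 1) * p) :
    ∃ A : Finset (ZMod p × ZMod p), A.card = m ∧ (signedSumset2 A).card ≤ (2 * c + 1) * p := by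
  have hS : ((range (c + 1)).image fun i : ℕ => (2 * (i : ZMod p) - c)).card = c + 1 := by
    rw [card_image_of_injOn, card_range]
    intro i hi j hj h
    have hi := mem_range.1 (mem_coe.1 hi)
    have hj := mem_range.1 (mem_coe.1 hj)
    have h : 2 * (i : ZMod p) - c = 2 * (j : ZMod p) - c := h
    have h1 : ((2 * i : ℕ) : ZMod p) = ((2 * j : ℕ) : ZMod p) := by
      push_cast
      exact sub_left_injective h
    rw [ZMod.natCast_eq_natCast_iff'] at h1
    rw [Nat.mod_eq_of_lt (by omega), Nat.mod_eq_of_lt (by omega)] at h1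
    omega
  obtain ⟨A, hA, hAc⟩ := exists_subset_card_eq (s := ((range (c + 1)).image
    fun i : ℕ => (2 * (i : ZMod p) - c)) ×ˢ (univ : Finset (ZMod p))) (n := m) (by
      rw [card_product, hS, card_univ, ZMod.card]
      exact hm)
  refine ⟨A, hAc, ?_⟩
  have hA' : ∀ a ∈ A, ∃ i : ℕ, i ≤ c ∧ a.1 = 2 * (i : ZMod p) - c := by
    intro a ha
    have := (mem_product.1 (hA ha)).1
    obtain ⟨i, hi, h⟩ := mem_image.1 this
    exact ⟨i, by have := mem_range.1 hi; omega, h.symm⟩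
  have hT : signedSumset2 A ⊆ ((range (2 * c + 1)).image
      fun i : ℕ => (2 * (i : ZMod p) - 2 * c)) ×ˢ (univ : Finset (ZMod p)) := by
    intro w hw
    rw [mem_product]
    refine ⟨?_, mem_univ _⟩
    rw [mem_image]
    simp only [signedSumset2, mem_union, mem_neg', mem_image, mem_offDiag] at hw
    rcases hw with (hw | hw) | ⟨⟨a, b⟩, ⟨ha, hb, -⟩, rfl⟩
    · obtain ⟨a, ha, b, hb, rfl⟩ := mem_add.1 hw
      obtain ⟨i, hi, h1⟩ := hA' a ha
      obtain ⟨j, hj, h2⟩ := hA' b hb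
      refine ⟨i + j, mem_range.2 (by omega), ?_⟩
      rw [Prod.fst_add, h1, h2]
      push_cast
      ring
    · obtain ⟨a, ha, b, hb, hab⟩ := mem_add.1 hw
      obtain ⟨i, hi, h1⟩ := hA' a ha
      obtain ⟨j, hj, h2⟩ := hA' b hb
      refine ⟨(c - i) + (c - j), mem_range.2 (by omega), ?_⟩
      rw [← neg_neg w, ← hab, Prod.fst_neg, Prod.fst_add, h1, h2]
      push_cast [hi, hj]
      ring
    · obtain ⟨i, hi, h1⟩ := hA' a ha
      obtain ⟨j, hj, h2⟩ := hA' b hb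
      refine ⟨i + (c - j), mem_range.2 (by omega), ?_⟩
      rw [Prod.fst_sub, h1, h2]
      push_cast [hj]
      ring
  refine (card_le_card hT).trans ?_
  rw [card_product, card_univ, ZMod.card]
  refine Nat.mul_le_mul_right _ (card_image_le.trans (card_range _).le)

end Main

/-- Theorem: for a prime `p > 2`, integers `1 ≤ c ≤ (p-3)/2` and `1 ≤ v ≤ p`, and `m = cp + v`,
we have `ρ±((ℤ/pℤ)², m, 2) = (2c + 1)p`. -/
theorem rhoPM_eq_of_le (p : ℕ) [Fact p.Prime] (hp2 : 2 < p) (c v m : ℕ)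
    (hc1 : 1 ≤ c) (hc2 : c ≤ (p - 3) / 2) (hv1 : 1 ≤ v) (hv2 : v ≤ p)
    (hm : m = c * p + v) :
    rhoPM (ZMod p × ZMod p) m = (2 * c + 1) * p := by
  have hcp : 2 * c + 3 ≤ p := by omega
  obtain ⟨A, hA, hA2⟩ := signed_upper (p := p) c m hcp (by
    have : (c + 1) * p = c * p + p := by ring
    omega)
  unfold rhoPM
  apply le_antisymm
  · exact le_trans (Nat.sInf_le ⟨A, hA, rfl⟩) hA2
  · refine le_csInf ⟨_, A, hA, rfl⟩ ?_
    rintro n ⟨A', hA', rfl⟩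
    exact signed_lower A' c hc1 hcp (by omega)
end

section
/- Let p be a prime, let d ≥ 0 be an integer, and let G = (ℤ/pℤ)^d. Let t and r be integers with t ≥ 0, p^t < r ≤ p^{t+1}, r ≤ p^d, and r ≤ p². Then ρ_G⁻(r) = p^t · min{2·⌈r/p^t⌉ − 1, p}. -/
open Pointwise

lemma seq_sum_split_even (F : ℕ → ℕ) (g : ℕ) :
    ∑ v ∈ Finset.range (2 * g + 1), F v =
      ∑ s ∈ Finset.range (g + 1), F (2 * s) + ∑ s ∈ Finset.range g, F (2 * s + 1) := by
  induction g with
  | zero => simp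
  | succ n ih =>
    rw [show 2 * (n + 1) + 1 = 2 * n + 1 + 1 + 1 by ring, Finset.sum_range_succ,
      Finset.sum_range_succ, ih, Finset.sum_range_succ _ (n + 1), Finset.sum_range_succ _ n,
      Finset.sum_range_succ _ n]
    rw [show 2 * (n + 1) = 2 * n + 1 + 1 by ring]
    ring

lemma seq_caseC (p k g : ℕ) (a F : ℕ → ℕ) (hk : 1 ≤ k) (hg : k + 1 ≤ g) (hp : 2 * g + 3 ≤ p)
    (hsum : ∑ s ∈ Finset.range (g + 1), a s = p * k + 1)
    (H : ∀ s ≤ g, ∀ s' ≤ g, a s + a s' ≤ F (s + s') + 1) :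
    p * (2 * k + 1) ≤ ∑ v ∈ Finset.range (2 * g + 1), F v := by
  by_contra hcon
  push Not at hcon
  have hs0 : ∑ s ∈ Finset.range g, a s + a g = p * k + 1 := by
    rw [← hsum, Finset.sum_range_succ]
  have hs1 : ∑ s ∈ Finset.range g, a (s + 1) + a 0 = p * k + 1 := by
    rw [← hsum, Finset.sum_range_succ']
  -- bound alpha
  have hα : 4 * (p * k + 1) ≤ ∑ v ∈ Finset.range (2 * g + 1), F v + (2 * g + 1) + (a 0 + a g) := by
    rw [seq_sum_split_even]
    have h1 : ∑ s ∈ Finset.range (g + 1), (a s + a s) ≤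
        ∑ s ∈ Finset.range (g + 1), (F (2 * s) + 1) := by
      apply Finset.sum_le_sum
      intro s hs
      have hs' : s ≤ g := by simpa [Nat.lt_succ_iff] using hs
      have := H s hs' s hs'
      rwa [← two_mul s] at this
    have h2 : ∑ s ∈ Finset.range g, (a s + a (s + 1)) ≤
        ∑ s ∈ Finset.range g, (F (2 * s + 1) + 1) := by
      apply Finset.sum_le_sum
      intro s hs
      have hs' : s < g := by simpa using hs
      have := H s hs'.le (s + 1) hs'
      rwa [show s + (s + 1) = 2 * s + 1 by ring] at this
    simp only [Finset.sum_add_distrib, Finset.sum_const, Finset.card_range, smul_eq_mul,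
      mul_one] at h1 h2
    omega
  have hβ : 2 * (p * k + 1) + g * (a 0 + a g) ≤
      ∑ v ∈ Finset.range (2 * g + 1), F v + (2 * g + 1) := by
    rw [show 2 * g + 1 = (g + 1) + g by ring, Finset.sum_range_add]
    have h1 : ∑ s ∈ Finset.range (g + 1), (a 0 + a s) ≤
        ∑ s ∈ Finset.range (g + 1), (F s + 1) := by
      apply Finset.sum_le_sum
      intro s hs
      have hs' : s ≤ g := by simpa [Nat.lt_succ_iff] using hs
      have := H 0 (by omega) s hs'
      rwa [zero_add] at this
    have h2 : ∑ s ∈ Finset.range g, (a g + a (s + 1)) ≤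
        ∑ s ∈ Finset.range g, (F (g + 1 + s) + 1) := by
      apply Finset.sum_le_sum
      intro s hs
      have hs' : s < g := by simpa using hs
      have := H g le_rfl (s + 1) hs'
      rwa [show g + (s + 1) = g + 1 + s by ring] at this
    simp only [Finset.sum_add_distrib, Finset.sum_const, Finset.card_range, smul_eq_mul,
      mul_one] at h1 h2
    nlinarith
  generalize ∑ v ∈ Finset.range (2 * g + 1), F v = S at *
  generalize a 0 + a g = w at *
  have hw : p + 4 ≤ w + 2 * g := by nlinarith
  have h3 : 2 * g + g * (p + 2) + 2 ≤ p + 2 * g * g + 2 * g + g * 0 + g * 0 := by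
    nlinarith
  have hg2 : 2 ≤ g := by omega
  obtain ⟨x, rfl⟩ := Nat.exists_eq_add_of_le hg2
  obtain ⟨y, rfl⟩ := Nat.exists_eq_add_of_le hp
  nlinarith [Nat.zero_le (x*y)]

lemma seq_main (p k g : ℕ) (a F : ℕ → ℕ) (hk : 1 ≤ k) (hg : k + 1 ≤ g) (hp : 2 * g + 3 ≤ p)
    (ha : Antitone a) (hF : Antitone F) (hap : a 0 ≤ p) (ha1 : 1 ≤ a g)
    (hsum : ∑ s ∈ Finset.range (g + 1), a s = p * k + 1)
    (H : ∀ s ≤ g, ∀ s' ≤ g, p ≤ F (s + s') ∨ a s + a s' ≤ F (s + s') + 1) :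
    p * (2 * k + 1) ≤ ∑ v ∈ Finset.range (2 * g + 1), F v := by
  by_cases hB : p + 1 ≤ 2 * a k
  · have h1 : p ≤ F (2 * k) := by
      have := H k (by omega) k (by omega)
      rw [← two_mul] at this
      omega
    calc p * (2 * k + 1) = ∑ v ∈ Finset.range (2 * k + 1), p := by simp [mul_comm]
      _ ≤ ∑ v ∈ Finset.range (2 * k + 1), F v := by
        apply Finset.sum_le_sum
        intro v hv
        exact h1.trans (hF (by simp at hv; omega))
      _ ≤ _ := Finset.sum_le_sum_of_subset (by
        intro v; simp only [Finset.mem_range]; omega)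
  by_cases hC : 2 * a 0 ≤ p
  · apply seq_caseC p k g a F hk hg hp hsum
    intro s hs s' hs'
    have h1 := ha (Nat.zero_le s)
    have h2 := ha (Nat.zero_le s')
    rcases H s hs s' hs' with h | h <;> omega
  -- find κ
  obtain ⟨κ, hκk, hκ1, hκ2⟩ : ∃ κ < k, p + 1 ≤ 2 * a κ ∧ 2 * a (κ + 1) ≤ p := by
    have hex : ∃ n, 2 * a n ≤ p := ⟨k, by omega⟩
    classical
    have hspec := Nat.find_spec hex
    have hmin := fun m => @Nat.find_min _ _ hex m
    have hle := Nat.find_min' hex (show 2 * a k ≤ p by omega)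
    generalize Nat.find hex = n at *
    rcases n with _ | n
    · omega
    · exact ⟨n, by omega, by have := hmin n (by omega); omega, hspec⟩
  obtain ⟨q, rfl⟩ : ∃ q, k = κ + 1 + q := ⟨k - (κ + 1), by omega⟩
  obtain ⟨e, rfl⟩ : ∃ e, g = κ + 1 + (e + 1) := ⟨g - (κ + 2), by omega⟩
  have heq : q ≤ e := by omega
  have hF0 : p ≤ F (2 * κ) := by
    have := H κ (by omega) κ (by omega)
    rw [← two_mul] at this
    omega
  have hsplit : ∑ v ∈ Finset.range (2 * (κ + 1 + (e + 1)) + 1), F v =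
      ∑ v ∈ Finset.range (2 * κ + 1), F v + ∑ j ∈ Finset.range (e + 2), F (2 * κ + 1 + j) +
        ∑ j ∈ Finset.range (e + 2), F (2 * κ + 1 + (e + 2) + j) := by
    rw [show 2 * (κ + 1 + (e + 1)) + 1 = (2 * κ + 1 + (e + 2)) + (e + 2) by ring,
      Finset.sum_range_add, Finset.sum_range_add]
  have hblock1 : p * (2 * κ + 1) ≤ ∑ v ∈ Finset.range (2 * κ + 1), F v := by
    calc p * (2 * κ + 1) = ∑ v ∈ Finset.range (2 * κ + 1), p := by simp [mul_comm]
      _ ≤ _ := by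
        apply Finset.sum_le_sum
        intro v hv
        exact hF0.trans (hF (by simp at hv; omega))
  have hap' : ∀ s, a s ≤ p := fun s => (ha (Nat.zero_le s)).trans hap
  set T := ∑ j ∈ Finset.range (e + 2), a (κ + 1 + j) with hT
  have hTlow : p * (q + 1) + 1 ≤ T + a κ := by
    have h1 : ∑ s ∈ Finset.range (κ + 1 + (e + 2)), a s =
        ∑ s ∈ Finset.range κ, a s + a κ + T := by
      rw [Finset.sum_range_add, Finset.sum_range_succ]
    have h2 : ∑ s ∈ Finset.range κ, a s ≤ κ * p := by
      calc _ ≤ ∑ s ∈ Finset.range κ, p := Finset.sum_le_sum (fun s _ => hap' s)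
        _ = _ := by simp
    rw [show κ + 1 + (e + 1) + 1 = κ + 1 + (e + 2) by ring, h1] at hsum
    nlinarith
  have hblock3 : T ≤ ∑ j ∈ Finset.range (e + 2), F (2 * κ + 1 + (e + 2) + j) := by
    apply Finset.sum_le_sum
    intro j hj
    have hj' : j < e + 2 := by simpa using hj
    have h1 := H (κ + 1 + (e + 1)) le_rfl (κ + 1 + j) (by omega)
    rw [show κ + 1 + (e + 1) + (κ + 1 + j) = 2 * κ + 1 + (e + 2) + j by ring] at h1
    have := hap' (κ + 1 + j)
    omega
  have HH : ∀ j < e + 2, p ≤ F (2 * κ + 1 + j) ∨ a κ + a (κ + 1 + j) ≤ F (2 * κ + 1 + j) + 1 := by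
    intro j hj
    have h1 := H κ (by omega) (κ + 1 + j) (by omega)
    rwa [show κ + (κ + 1 + j) = 2 * κ + 1 + j by ring] at h1
  have hpos : ∀ j < e + 2, 1 ≤ a (κ + 1 + j) := fun j hj => ha1.trans (ha (by omega))
  rw [hsplit]
  suffices hs : p * (2 * q + 2) ≤ ∑ j ∈ Finset.range (e + 2), F (2 * κ + 1 + j) + T by
    nlinarith
  have hT2 : T = ∑ j ∈ Finset.range e, a (κ + 1 + j) + a (κ + 1 + e) + a (κ + 1 + (e + 1)) := by
    rw [hT, Finset.sum_range_succ, Finset.sum_range_succ]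
  rw [Finset.sum_range_succ, Finset.sum_range_succ]
  have hanti : a (κ + 1 + (e + 1)) ≤ a (κ + 1 + e) := ha (by omega)
  have hA1 := HH (e + 1) (by omega)
  have hA0 := HH e (by omega)
  have hp1 := hpos (e + 1) (by omega)
  have hp0 := hpos e (by omega)
  have hκp := hap' κ
  by_cases hi : a κ + a (κ + 1 + e) ≤ p + 1
  · have h1 : ∑ j ∈ Finset.range e, a (κ + 1 + j) ≤ ∑ j ∈ Finset.range e, F (2 * κ + 1 + j) := by
      apply Finset.sum_le_sum
      intro j hj
      have hj' : j < e := by simpa using hj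
      have := HH j (by omega)
      have := hap' (κ + 1 + j)
      omega
    have e0 : a κ + a (κ + 1 + e) ≤ F (2 * κ + 1 + e) + 1 := by omega
    have e1 : a κ + a (κ + 1 + (e + 1)) ≤ F (2 * κ + 1 + (e + 1)) + 1 := by omega
    nlinarith
  · have h1 : e * p ≤ ∑ j ∈ Finset.range e, F (2 * κ + 1 + j) := by
      calc e * p = ∑ j ∈ Finset.range e, p := by simp
        _ ≤ _ := by
          apply Finset.sum_le_sum
          intro j hj
          have hj' : j < e := by simpa using hj
          have := HH j (by omega)
          have : a (κ + 1 + e) ≤ a (κ + 1 + j) := ha (by omega)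
          omega
    have e0 : p ≤ F (2 * κ + 1 + e) := by omega
    have e1 : a κ ≤ F (2 * κ + 1 + (e + 1)) := by omega
    have : q * p ≤ e * p := Nat.mul_le_mul_right _ heq
    nlinarith

open Finset in
lemma level_sum_le {ι : Type*} [Fintype ι] (f : ι → ℕ) (N : ℕ) :
    ∑ v ∈ range N, (univ.filter (fun c => v < f c)).card ≤ ∑ c, f c := by
  simp_rw [card_filter]
  rw [sum_comm]
  apply sum_le_sum
  intro c _
  rw [← card_filter]
  calc _ ≤ (range (f c)).card := card_le_card (by intro v; simp)
    _ = _ := by simp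

open Finset in
lemma level_sum_eq {ι : Type*} [Fintype ι] (f : ι → ℕ) (N : ℕ) (hN : ∀ i, f i ≤ N) :
    ∑ v ∈ range N, (univ.filter (fun c => v < f c)).card = ∑ c, f c := by
  simp_rw [card_filter]
  rw [sum_comm]
  apply sum_congr rfl
  intro c _
  rw [← card_filter]
  rw [show (range N).filter (fun v => v < f c) = range (f c) by
    ext v; have := hN c; simp only [mem_filter, mem_range]; omega]
  simp

open Finset in
lemma level_cd (p : ℕ) [Fact p.Prime] (n f : ZMod p → ℕ)
    (hnf : ∀ i j, 0 < n i → 0 < n j → n i + n j ≤ f (i - j) + 1) (s s' : ℕ)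
    (h1 : 0 < (univ.filter (fun i => s < n i)).card)
    (h2 : 0 < (univ.filter (fun i => s' < n i)).card) :
    p ≤ (univ.filter (fun c => s + s' < f c)).card ∨
    (univ.filter (fun i => s < n i)).card + (univ.filter (fun i => s' < n i)).card ≤
      (univ.filter (fun c => s + s' < f c)).card + 1 := by
  have hcd := ZMod.cauchy_davenport (Fact.out : p.Prime) (card_pos.1 h1)
    (Finset.Nonempty.neg (card_pos.1 h2))
  rw [card_neg] at hcd
  have hle : (univ.filter (fun i => s < n i) + -(univ.filter (fun i => s' < n i))).card ≤
      (univ.filter (fun c => s + s' < f c)).card := by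
    apply card_le_card
    intro c hc
    rw [mem_add] at hc
    obtain ⟨i, hi, j, hj, rfl⟩ := hc
    rw [mem_neg] at hj
    obtain ⟨j, hj, rfl⟩ := hj
    simp only [mem_filter, mem_univ, true_and] at hi hj ⊢
    have := hnf i j (by omega) (by omega)
    rw [← sub_eq_add_neg]
    omega
  omega

open Finset in
lemma level_main (p : ℕ) [Fact p.Prime] (n f : ZMod p → ℕ) (k g : ℕ)
    (hnf : ∀ i j, 0 < n i → 0 < n j → n i + n j ≤ f (i - j) + 1)
    (hsum : ∑ i, n i = p * k + 1) (hmax : ∀ i, n i ≤ g + 1) (hex : ∃ i, n i = g + 1)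
    (hk : 1 ≤ k) (hg : k + 1 ≤ g) (hp : 2 * g + 3 ≤ p) :
    p * (2 * k + 1) ≤ ∑ c, f c := by
  have hpos : ∀ s ≤ g, 0 < (univ.filter (fun i => s < n i)).card := by
    intro s hs
    obtain ⟨i, hi⟩ := hex
    exact card_pos.2 ⟨i, by simp; omega⟩
  refine le_trans (seq_main p k g (fun s => (univ.filter (fun i => s < n i)).card)
    (fun v => (univ.filter (fun c => v < f c)).card) hk hg hp ?_ ?_ ?_ ?_ ?_ ?_)
    (level_sum_le f (2 * g + 1))
  · intro s s' hs
    exact card_le_card (by intro i; simp only [mem_filter, mem_univ, true_and]; omega)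
  · intro s s' hs
    exact card_le_card (by intro i; simp only [mem_filter, mem_univ, true_and]; omega)
  · exact (card_le_univ _).trans_eq (ZMod.card p)
  · exact hpos g le_rfl
  · rw [← hsum]; exact level_sum_eq n (g + 1) hmax
  · intro s hs s' hs'
    exact level_cd p n f hnf s s' (hpos s hs) (hpos s' hs')

open Finset in
lemma level_full (p : ℕ) [Fact p.Prime] (n f : ZMod p → ℕ) (k : ℕ)
    (hnf : ∀ i j, 0 < n i → 0 < n j → n i + n j ≤ f (i - j) + 1)
    (hl : p + 1 ≤ 2 * (univ.filter (fun i => k < n i)).card) :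
    p * (2 * k + 1) ≤ ∑ c, f c := by
  have h := level_cd p n f hnf k k (by omega) (by omega)
  have h1 : p ≤ (univ.filter (fun c => k + k < f c)).card := by omega
  have h2 : univ.filter (fun c => k + k < f c) = univ := by
    apply eq_univ_of_card
    rw [ZMod.card]
    exact le_antisymm ((card_le_univ _).trans_eq (ZMod.card p)) h1
  calc p * (2 * k + 1) = ∑ c : ZMod p, (2 * k + 1) := by simp [ZMod.card]
    _ ≤ _ := by
      apply sum_le_sum
      intro c _
      have : c ∈ univ.filter (fun c => k + k < f c) := by rw [h2]; simp
      simp at this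
      omega

open Finset in
lemma row_cd {V : Type*} [AddCommGroup V] [DecidableEq V] (p : ℕ) [Fact p.Prime]
    (φ ψ : V →+ ZMod p) (hinj : ∀ x, φ x = 0 → ψ x = 0 → x = 0) (A : Finset V) (i j : ZMod p)
    (hi : 0 < (A.filter (fun x => φ x = i)).card) (hj : 0 < (A.filter (fun x => φ x = j)).card) :
    min p ((A.filter (fun x => φ x = i)).card + (A.filter (fun x => φ x = j)).card - 1) ≤
      ((A - A).filter (fun x => φ x = i - j)).card := by
  have key : ∀ i, ((A.filter (fun x => φ x = i)).image ψ).card =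
      (A.filter (fun x => φ x = i)).card := by
    intro i
    apply card_image_of_injOn
    intro x hx y hy hxy
    simp only [coe_filter, Set.mem_ofPred_eq] at hx hy
    have := hinj (x - y) (by rw [map_sub, hx.2, hy.2, sub_self])
      (by rw [map_sub]; exact sub_eq_zero.2 hxy)
    exact sub_eq_zero.1 this
  have hcd := ZMod.cauchy_davenport (Fact.out : p.Prime) (Finset.Nonempty.image (card_pos.1 hi) ψ)
    (Finset.Nonempty.neg (Finset.Nonempty.image (card_pos.1 hj) ψ))
  rw [card_neg, key, key] at hcd
  refine hcd.trans ?_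
  refine le_trans (card_le_card ?_) (card_image_le (f := ψ))
  intro c hc
  rw [mem_add] at hc
  obtain ⟨y, hy, z, hz, rfl⟩ := hc
  rw [mem_neg] at hz
  obtain ⟨z, hz, rfl⟩ := hz
  rw [mem_image] at hy hz
  obtain ⟨a, ha, rfl⟩ := hy
  obtain ⟨b, hb, rfl⟩ := hz
  rw [mem_filter] at ha hb
  rw [mem_image]
  refine ⟨a - b, ?_, by rw [map_sub, sub_eq_add_neg]⟩
  rw [mem_filter]
  exact ⟨sub_mem_sub ha.1 hb.1, by rw [map_sub, ha.2, hb.2]⟩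

/-- The `p + 1` directions in the plane. -/
def dirFun (p : ℕ) (o : Option (ZMod p)) : ZMod p × ZMod p →+ ZMod p :=
  match o with
  | none => AddMonoidHom.fst _ _
  | some s => AddMonoidHom.snd _ _ - (AddMonoidHom.mulLeft s).comp (AddMonoidHom.fst _ _)

/-- A complementary coordinate for each direction. -/
def dirCompl (p : ℕ) (o : Option (ZMod p)) : ZMod p × ZMod p →+ ZMod p :=
  match o with
  | none => AddMonoidHom.snd _ _
  | some _ => AddMonoidHom.fst _ _

lemma dir_inj (p : ℕ) (o : Option (ZMod p)) (x : ZMod p × ZMod p) (h1 : dirFun p o x = 0)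
    (h2 : dirCompl p o x = 0) : x = 0 := by
  rcases x with ⟨x, y⟩
  cases o with
  | none => simp [dirFun, dirCompl] at h1 h2; simp [h1, h2]
  | some s => simp [dirFun, dirCompl] at h1 h2; subst h2; simp at h1; simp [h1]

open Finset in
lemma dir_count (p : ℕ) [Fact p.Prime] (x : ZMod p × ZMod p) :
    (univ.filter (fun o => dirFun p o x = 0)).card = if x = 0 then p + 1 else 1 := by
  split_ifs with h
  · subst h
    simp [ZMod.card]
  · rcases x with ⟨x, y⟩
    by_cases hx : x = 0
    · subst hx
      have hy : y ≠ 0 := by rintro rfl; exact h rfl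
      rw [card_eq_one]
      refine ⟨none, ?_⟩
      ext o
      rw [mem_filter, mem_singleton]
      cases o with
      | none => simp [dirFun]
      | some s => simp [dirFun, hy]
    · rw [card_eq_one]
      refine ⟨some (y / x), ?_⟩
      ext o
      rw [mem_filter, mem_singleton]
      cases o with
      | none => simp [dirFun, hx]
      | some s =>
        simp [dirFun]
        rw [sub_eq_zero, eq_div_iff hx, eq_comm]

open Finset in
lemma dir_sum_s7 (p : ℕ) [Fact p.Prime] (D : Finset (ZMod p × ZMod p)) (h0 : (0 : ZMod p × ZMod p) ∈ D) :
    ∑ o, (D.filter (fun x => dirFun p o x = 0)).card = D.card + p := by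
  simp_rw [card_filter]
  rw [sum_comm]
  simp_rw [← card_filter, dir_count]
  rw [← add_sum_erase D _ h0, if_pos rfl, sum_congr rfl (g := fun _ => 1)]
  · rw [sum_const, card_erase_of_mem h0]
    have := card_pos.2 ⟨_, h0⟩
    simp
    omega
  · intro x hx
    rw [if_neg (ne_of_mem_erase hx)]

open Finset in
lemma dir_sum_sq (p : ℕ) [Fact p.Prime] (A : Finset (ZMod p × ZMod p)) :
    ∑ o, ∑ i, (A.filter (fun x => dirFun p o x = i)).card ^ 2 = A.card ^ 2 + A.card * p := by
  have h1 : ∀ o, ∑ i, (A.filter (fun x => dirFun p o x = i)).card ^ 2 =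
      ∑ a ∈ A, ∑ b ∈ A, if dirFun p o (a - b) = 0 then 1 else 0 := by
    intro o
    simp_rw [sq, card_filter, sum_mul_sum]
    rw [sum_comm]
    apply sum_congr rfl
    intro a _
    rw [sum_comm]
    apply sum_congr rfl
    intro b _
    simp_rw [map_sub, sub_eq_zero]
    simp [eq_comm]
  simp_rw [h1]
  rw [sum_comm]
  have h2 : ∀ a ∈ A, ∑ o, ∑ b ∈ A, (if dirFun p o (a - b) = 0 then 1 else 0) = A.card + p := by
    intro a ha
    rw [sum_comm]
    simp_rw [← card_filter, dir_count, sub_eq_zero]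
    rw [← add_sum_erase A _ ha, if_pos rfl, sum_congr rfl (g := fun _ => 1)]
    · rw [sum_const, card_erase_of_mem ha]
      have := card_pos.2 ⟨_, ha⟩
      simp
      omega
    · intro x hx
      rw [if_neg (ne_of_mem_erase hx).symm]
  rw [sum_congr rfl h2]
  simp
  ring

open Finset in
lemma plane_bound (p : ℕ) [Fact p.Prime] (A : Finset (ZMod p × ZMod p)) (k : ℕ) (hk : 1 ≤ k)
    (hA : A.card = p * k + 1) : p * min (2 * k + 1) p ≤ (A - A).card := by
  have hpp : p.Prime := Fact.out
  set n : Option (ZMod p) → ZMod p → ℕ :=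
    fun o i => (A.filter (fun x => dirFun p o x = i)).card with hn
  set f : Option (ZMod p) → ZMod p → ℕ :=
    fun o i => ((A - A).filter (fun x => dirFun p o x = i)).card with hf
  have hcd : ∀ o i j, 0 < n o i → 0 < n o j → min p (n o i + n o j - 1) ≤ f o (i - j) :=
    fun o i j hi hj => row_cd p (dirFun p o) (dirCompl p o) (dir_inj p o) A i j hi hj
  have hns : ∀ o, ∑ i, n o i = p * k + 1 := by
    intro o
    rw [← hA]
    exact (card_eq_sum_card_fiberwise (fun x _ => mem_univ _)).symm
  have hfs : ∀ o, ∑ i, f o i = (A - A).card := by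
    intro o
    exact (card_eq_sum_card_fiberwise (fun x _ => mem_univ _)).symm
  have hA0 : A.Nonempty := card_pos.1 (by omega)
  have h0 : (0 : ZMod p × ZMod p) ∈ A - A := by
    obtain ⟨a, ha⟩ := hA0
    have := sub_mem_sub ha ha
    rwa [sub_self] at this
  have hds : ∑ o, f o 0 = (A - A).card + p := dir_sum_s7 p (A - A) h0
  have hcd0 : ∀ o i, 0 < n o i → min p (2 * n o i - 1) ≤ f o 0 := by
    intro o i hi
    have := hcd o i i hi hi
    rwa [sub_self, ← two_mul] at this
  have hpig : ∀ o, ∃ i, k + 1 ≤ n o i := by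
    intro o
    by_contra hcon
    push Not at hcon
    have : ∑ i, n o i ≤ ∑ i : ZMod p, k := sum_le_sum (fun i _ => by have := hcon i; omega)
    rw [hns] at this
    simp [ZMod.card] at this
  have hf0 : ∀ o, min (2 * k + 1) p ≤ f o 0 := by
    intro o
    obtain ⟨i, hi⟩ := hpig o
    have := hcd0 o i (by omega)
    omega
  have hone : (∃ o, p ≤ f o 0) → p * min (2 * k + 1) p ≤ (A - A).card := by
    rintro ⟨o, ho⟩
    have h1 := add_sum_erase univ (fun o => f o 0) (mem_univ o)
    have h2 : (univ.erase o).card • min (2 * k + 1) p ≤ ∑ o ∈ univ.erase o, f o 0 :=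
      card_nsmul_le_sum _ _ _ (fun o _ => hf0 o)
    rw [card_erase_of_mem (mem_univ o), card_univ, Fintype.card_option, ZMod.card, smul_eq_mul,
      Nat.add_sub_cancel] at h2
    omega
  by_cases hbig : ∃ o i, p + 1 ≤ 2 * n o i
  · obtain ⟨o, i, hi⟩ := hbig
    apply hone
    have := hcd0 o i (by omega)
    exact ⟨o, by omega⟩
  push Not at hbig
  obtain ⟨i0, hi0⟩ := hpig none
  have hkp : 2 * k + 2 ≤ p := by have := hbig none i0; omega
  rw [min_eq_left (by omega)]
  have hodd : p % 2 = 1 := by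
    rcases hpp.eq_two_or_odd with h | h
    · omega
    · exact h
  have hnf : ∀ o i j, 0 < n o i → 0 < n o j → n o i + n o j ≤ f o (i - j) + 1 := by
    intro o i j hi hj
    have := hcd o i j hi hj
    have := hbig o i
    have := hbig o j
    omega
  by_cases hbad : ∃ o i, k + 2 ≤ n o i
  · obtain ⟨o, i, hi⟩ := hbad
    obtain ⟨m, -, hm⟩ := exists_max_image univ (n o) univ_nonempty
    have hmi := hm i (mem_univ _)
    have := hbig o m
    rw [← hfs o]
    apply level_main p (n o) (f o) k (n o m - 1) (hnf o) (hns o)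
    · intro j; have := hm j (mem_univ _); omega
    · exact ⟨m, by omega⟩
    · exact hk
    · omega
    · omega
  push Not at hbad
  by_cases hl : ∃ o, p + 1 ≤ 2 * (univ.filter (fun i => k < n o i)).card
  · obtain ⟨o, ho⟩ := hl
    rw [← hfs o]
    exact level_full p (n o) (f o) k (hnf o) ho
  push Not at hl
  exfalso
  have hsq : ∑ o, ∑ i, n o i ^ 2 = A.card ^ 2 + A.card * p := dir_sum_sq p A
  have hub : ∀ o, 2 * ∑ i, n o i ^ 2 ≤ 2 * (k * (p * k + 1)) + (k + 1) * (p - 1) := by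
    intro o
    have h1 : ∑ i, n o i ^ 2 ≤ ∑ i, (k * n o i + (k + 1) * (if k < n o i then 1 else 0)) := by
      apply sum_le_sum
      intro i _
      have := hbad o i
      split_ifs with h
      · have : n o i = k + 1 := by omega
        rw [this]; nlinarith
      · have : n o i ≤ k := by omega
        nlinarith
    rw [sum_add_distrib, ← mul_sum, ← mul_sum, ← card_filter, hns] at h1
    have h2 := hl o
    have h3 : 2 * (univ.filter (fun i => k < n o i)).card ≤ p - 1 := by omega
    have := Nat.mul_le_mul_left (k + 1) h3
    nlinarith
  have htot : 2 * (A.card ^ 2 + A.card * p) ≤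
      (p + 1) * (2 * (k * (p * k + 1)) + (k + 1) * (p - 1)) := by
    rw [← hsq, mul_sum]
    calc _ ≤ ∑ o : Option (ZMod p), (2 * (k * (p * k + 1)) + (k + 1) * (p - 1)) :=
          sum_le_sum (fun o _ => hub o)
      _ = _ := by simp [ZMod.card]
  rw [hA] at htot
  have hkp' : 2 * k + 3 ≤ p := by omega
  clear_value n f
  clear hub hsq hl hbad hnf hodd hi0 hbig hone hf0 hpig hcd0 hds hfs hns hcd hn hf
  obtain ⟨x, rfl⟩ := Nat.exists_eq_add_of_le hk
  obtain ⟨y, rfl⟩ := Nat.exists_eq_add_of_le hkp'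
  rw [show 2 * (1 + x) + 3 + y - 1 = 2 * (1 + x) + 2 + y by omega] at htot
  zify at htot
  have : (0 : ℤ) ≤ x := by positivity
  have : (0 : ℤ) ≤ y := by positivity
  generalize (x : ℤ) = x at *
  generalize (y : ℤ) = y at *
  ring_nf at htot
  nlinarith [mul_nonneg ‹0 ≤ x› ‹0 ≤ y›, mul_nonneg ‹0 ≤ x› ‹0 ≤ x›, mul_nonneg ‹0 ≤ y› ‹0 ≤ y›,
    mul_nonneg (mul_nonneg ‹0 ≤ x› ‹0 ≤ y›) ‹0 ≤ y›, mul_nonneg (mul_nonneg ‹0 ≤ x› ‹0 ≤ x›) ‹0 ≤ y›,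
    mul_nonneg (mul_nonneg ‹0 ≤ x› ‹0 ≤ x›) ‹0 ≤ x›, mul_nonneg (mul_nonneg ‹0 ≤ y› ‹0 ≤ y›) ‹0 ≤ y›,
    mul_nonneg (mul_nonneg ‹0 ≤ x› ‹0 ≤ y›) (mul_nonneg ‹0 ≤ x› ‹0 ≤ y›)]

open Finset in
lemma image_sub_self_card {V W : Type*} [AddCommGroup V] [AddCommGroup W] [DecidableEq V]
    [DecidableEq W] (L : V →+ W) (A : Finset V) :
    (A.image L - A.image L).card ≤ (A - A).card := by
  refine le_trans (card_le_card ?_) (card_image_le (f := L))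
  intro x hx
  rw [mem_sub] at hx
  obtain ⟨a, ha, b, hb, rfl⟩ := hx
  rw [mem_image] at ha hb
  obtain ⟨a, ha, rfl⟩ := ha
  obtain ⟨b, hb, rfl⟩ := hb
  exact mem_image.2 ⟨a - b, sub_mem_sub ha hb, map_sub L a b⟩

open Finset in
lemma space_bound (p : ℕ) [Fact p.Prime] (k : ℕ) (hk : 1 ≤ k) (N : ℕ) :
    ∀ (V : Type) [AddCommGroup V] [Module (ZMod p) V] [Fintype V] [DecidableEq V]
      (_ : Module.finrank (ZMod p) V = N + 2) (A : Finset V) (_ : A.card = p * k + 1),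
      p * min (2 * k + 1) p ≤ (A - A).card := by
  induction N with
  | zero =>
    intro V _ _ _ _ hV A hA
    have hfr : Module.finrank (ZMod p) V = Module.finrank (ZMod p) (ZMod p × ZMod p) := by
      rw [hV]; simp
    let L : V ≃ₗ[ZMod p] (ZMod p × ZMod p) := LinearEquiv.ofFinrankEq _ _ hfr
    have h1 := plane_bound p (A.image L) k hk
      (by rw [card_image_of_injective _ L.injective, hA])
    exact h1.trans (image_sub_self_card (L : V →+ (ZMod p × ZMod p)) A)
  | succ N ih =>
    intro V _ _ _ _ hV A hA
    by_cases hD : p * p ≤ (A - A).card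
    · exact (Nat.mul_le_mul_left p (min_le_right _ _)).trans hD
    have hpp : p.Prime := Fact.out
    push Not at hD
    have hcardV : p ^ (N + 3) = Fintype.card V := by
      have := Module.card_eq_pow_finrank (K := ZMod p) (V := V)
      rw [ZMod.card, hV] at this
      exact this.symm
    set S : Finset V := (univ ×ˢ (A - A)).image (fun cx : ZMod p × V => cx.1 • cx.2) with hS
    have hSc : S.card < Fintype.card V := by
      calc S.card ≤ (univ ×ˢ (A - A) : Finset (ZMod p × V)).card := card_image_le
        _ = p * (A - A).card := by rw [card_product, card_univ, ZMod.card]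
        _ < p * (p * p) := Nat.mul_lt_mul_of_pos_left hD hpp.pos
        _ = p ^ 3 := by ring
        _ ≤ p ^ (N + 3) := Nat.pow_le_pow_right hpp.pos (by omega)
        _ = _ := hcardV
    obtain ⟨v, hv⟩ : ∃ v, v ∉ S := by
      by_contra hcon
      push Not at hcon
      have : S = univ := by ext x; simp [hcon x]
      rw [this, card_univ] at hSc
      omega
    have hmem : ∀ (c : ZMod p) (x : V), x ∈ A - A → c • x ≠ v := by
      intro c x hx h
      exact hv (mem_image.2 ⟨(c, x), by simp [hx], h⟩)
    have hA0 : A.Nonempty := card_pos.1 (by omega)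
    have hv0 : v ≠ 0 := by
      obtain ⟨a, ha⟩ := hA0
      have := hmem 0 (a - a) (sub_mem_sub ha ha)
      rw [zero_smul] at this
      exact this.symm
    let W := V ⧸ Submodule.span (ZMod p) {v}
    let L : V →ₗ[ZMod p] W := Submodule.mkQ _
    have : Fintype W := Fintype.ofFinite W
    have : DecidableEq W := Classical.decEq W
    have hW : Module.finrank (ZMod p) W = N + 2 := by
      have h1 := Submodule.finrank_quotient_add_finrank (Submodule.span (ZMod p) {v})
      rw [finrank_span_singleton hv0, hV] at h1
      change Module.finrank (ZMod p) W + 1 = _ at h1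
      omega
    have hinj : Set.InjOn L A := by
      intro a ha b hb hab
      have h1 : L (a - b) = 0 := by rw [map_sub, hab, sub_self]
      rw [Submodule.mkQ_apply, Submodule.Quotient.mk_eq_zero, Submodule.mem_span_singleton] at h1
      obtain ⟨c, hc⟩ := h1
      by_cases hc0 : c = 0
      · rw [hc0, zero_smul] at hc
        exact (sub_eq_zero.1 hc.symm)
      · exfalso
        apply hmem c⁻¹ (a - b) (sub_mem_sub ha hb)
        rw [← hc, smul_smul, inv_mul_cancel₀ hc0, one_smul]
    have h1 := ih W hW (A.image L) (by rw [card_image_of_injOn hinj, hA])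
    exact h1.trans (image_sub_self_card (L : V →+ W) A)

open Finset in
lemma interval_set (p : ℕ) [Fact p.Prime] (k : ℕ) (hk1 : 1 ≤ k) (hk : k ≤ p) :
    ∃ I : Finset (ZMod p), I.card = k ∧ (I - I).card ≤ min (2 * k - 1) p := by
  refine ⟨(range k).image (fun n : ℕ => (n : ZMod p)), ?_, ?_⟩
  · rw [card_image_of_injOn, card_range]
    intro a ha b hb hab
    simp only [coe_range, Set.mem_Iio] at ha hb
    have := (ZMod.natCast_eq_natCast_iff' a b p).1 hab
    rwa [Nat.mod_eq_of_lt (by omega), Nat.mod_eq_of_lt (by omega)] at this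
  · apply le_min
    · have : (range k).image (fun n : ℕ => (n : ZMod p)) - (range k).image (fun n : ℕ => (n : ZMod p))
        ⊆ (Finset.Ioo (-(k : ℤ)) k).image (fun n : ℤ => (n : ZMod p)) := by
        intro x hx
        rw [mem_sub] at hx
        obtain ⟨a, ha, b, hb, rfl⟩ := hx
        rw [mem_image] at ha hb
        obtain ⟨a, ha, rfl⟩ := ha
        obtain ⟨b, hb, rfl⟩ := hb
        rw [mem_range] at ha hb
        rw [mem_image]
        exact ⟨(a : ℤ) - b, by rw [mem_Ioo]; omega, by push_cast; rfl⟩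
      refine (card_le_card this).trans (card_image_le.trans ?_)
      rw [Int.card_Ioo]
      omega
    · exact (card_le_univ _).trans_eq (ZMod.card p)

open Finset in
lemma small_bound (p : ℕ) [Fact p.Prime] (d : ℕ) (A : Finset (Fin d → ZMod p)) (hA : A.Nonempty) :
    min (2 * A.card - 1) p ≤ (A - A).card := by
  have h := cauchy_davenport_minOrder_add hA hA.neg
  rw [card_neg, ← two_mul, ← sub_eq_add_neg] at h
  have hm : (p : ℕ∞) ≤ AddMonoid.minOrder (Fin d → ZMod p) := by
    rw [AddMonoid.le_minOrder]
    intro a ha _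
    have : addOrderOf a = p := addOrderOf_eq_prime (by
      ext i; simp) ha
    rw [this]
  have h2 := (min_le_min_right _ hm).trans h
  rw [min_le_iff] at h2 ⊢
  rw [Nat.cast_le, Nat.cast_le] at h2
  exact h2.symm

/-- Lemma (the case `r ≤ p²`): for `G = (ℤ/pℤ)^d` with `p` prime, `t ≥ 0`, `p^t < r ≤ p^(t+1)`,
`r ≤ p^d` and `r ≤ p²`, we have `ρ⁻_G(r) = p^t · min {2⌈r/p^t⌉ - 1, p}`. -/
theorem rhoMinus_small_r (p : ℕ) [Fact p.Prime] (d t r : ℕ)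
    (hr1 : p ^ t < r) (hr2 : r ≤ p ^ (t + 1)) (hr3 : r ≤ p ^ d) (hr4 : r ≤ p ^ 2) :
    rhoMinus (Fin d → ZMod p) r = p ^ t * min (2 * (r ⌈/⌉ p ^ t) - 1) p := by
  have hpp : p.Prime := Fact.out
  have hkey : (∃ A : Finset (Fin d → ZMod p), A.card = r ∧
        (A - A).card ≤ p ^ t * min (2 * (r ⌈/⌉ p ^ t) - 1) p) ∧
      (∀ A : Finset (Fin d → ZMod p), A.card = r →
        p ^ t * min (2 * (r ⌈/⌉ p ^ t) - 1) p ≤ (A - A).card) := by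
    have htd : t < d := (Nat.pow_lt_pow_iff_right hpp.one_lt).1 (hr1.trans_le hr3)
    have ht : t < 2 := (Nat.pow_lt_pow_iff_right hpp.one_lt).1 (hr1.trans_le hr4)
    interval_cases t
    · simp only [pow_zero, one_mul, zero_add, pow_one] at *
      rw [ceilDiv_one]
      constructor
      · obtain ⟨I, hI, hII⟩ := interval_set p r (by omega) hr2
        let L : ZMod p →+ (Fin d → ZMod p) := AddMonoidHom.single (fun _ => ZMod p) ⟨0, htd⟩
        refine ⟨I.image L, ?_, (image_sub_self_card L I).trans hII⟩
        have hL : Function.Injective L := fun x y h => by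
          have h0 := congrFun h ⟨0, htd⟩
          simpa [L] using h0
        rw [Finset.card_image_of_injective _ hL, hI]
      · intro A hA
        have := small_bound p d A (Finset.card_pos.1 (by omega))
        rwa [hA] at this
    · simp only [pow_one] at *
      have hk1 : r ≤ p * (r ⌈/⌉ p) := le_smul_ceilDiv (α := ℕ) (β := ℕ) hpp.pos
      have hk2 : ∀ c, r ⌈/⌉ p ≤ c ↔ r ≤ p * c := fun c => ceilDiv_le_iff_le_mul hpp.pos
      generalize r ⌈/⌉ p = k at *
      have hkp : k ≤ p := (hk2 p).2 (by nlinarith)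
      have hk3 : 2 ≤ k := by
        by_contra hcon
        have : k ≤ 1 := by omega
        have := (hk2 1).1 this
        omega
      constructor
      · obtain ⟨I, hI, hII⟩ := interval_set p k (by omega) hkp
        let L : ZMod p × ZMod p →+ (Fin d → ZMod p) :=
          (AddMonoidHom.single (fun _ => ZMod p) (⟨0, by omega⟩ : Fin d)).coprod
            (AddMonoidHom.single (fun _ => ZMod p) (⟨1, htd⟩ : Fin d))
        have hL : Function.Injective L := by
          rintro ⟨x, y⟩ ⟨z, w⟩ h
          have h0 := congrFun h ⟨0, by omega⟩
          have h1 := congrFun h ⟨1, htd⟩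
          simp [L, Pi.single_apply] at h0 h1
          rw [h0, h1]
        obtain ⟨B, hB, hBr⟩ := Finset.exists_subset_card_eq
          (s := I ×ˢ (Finset.univ : Finset (ZMod p))) (n := r) (by
            rw [Finset.card_product, hI, Finset.card_univ, ZMod.card]; linarith)
        refine ⟨B.image L, by rw [Finset.card_image_of_injective _ hL, hBr],
          (image_sub_self_card L B).trans ?_⟩
        have hsub : B - B ⊆ (I - I) ×ˢ (Finset.univ : Finset (ZMod p)) := by
          intro x hx
          rw [Finset.mem_sub] at hx
          obtain ⟨a, ha, b, hb, rfl⟩ := hx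
          have ha' := hB ha
          have hb' := hB hb
          rw [Finset.mem_product] at ha' hb' ⊢
          exact ⟨Finset.sub_mem_sub ha'.1 hb'.1, Finset.mem_univ _⟩
        refine (Finset.card_le_card hsub).trans ?_
        rw [Finset.card_product, Finset.card_univ, ZMod.card, mul_comm]
        exact Nat.mul_le_mul_left p hII
      · intro A hA
        have hlt : p * (k - 1) + 1 ≤ r := by
          by_contra hcon
          have := (hk2 (k - 1)).2 (by omega)
          omega
        obtain ⟨B, hB, hBr⟩ := Finset.exists_subset_card_eq (s := A) (n := p * (k - 1) + 1)
          (by omega)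
        have h1 := space_bound p (k - 1) (by omega) (d - 2) (Fin d → ZMod p)
          (by rw [Module.finrank_fin_fun]; omega) B hBr
        rw [show 2 * (k - 1) + 1 = 2 * k - 1 by omega] at h1
        exact h1.trans (Finset.card_le_card (Finset.sub_subset_sub hB hB))
  obtain ⟨⟨A, hA, hAle⟩, hlow⟩ := hkey
  apply le_antisymm
  · have hmem : (A - A).card ∈
        {n : ℕ | ∃ A : Finset (Fin d → ZMod p), A.card = r ∧ (A - A).card = n} := ⟨A, hA, rfl⟩
    exact (Nat.sInf_le hmem).trans hAle
  · obtain ⟨B, hB, hBn⟩ := Nat.sInf_mem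
      (s := {n : ℕ | ∃ A : Finset (Fin d → ZMod p), A.card = r ∧ (A - A).card = n})
      ⟨(A - A).card, A, hA, rfl⟩
    have := hlow B hB
    rw [hBn] at this
    exact this
end

section
/- Let G = ℤ/Nℤ be a finite cyclic group of order N. Then ρ_G⁻(r) = ρ_G⁺(r) for every integer r with 1 ≤ r ≤ N. -/
open Pointwise

/-- `rhoPlus G r` is the minimum cardinality of `A + A` over subsets `A ⊆ G` with `|A| = r`. -/
noncomputable def rhoPlus (G : Type*) [AddCommGroup G] [Fintype G] [DecidableEq G] (r : ℕ) : ℕ :=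
  sInf {n : ℕ | ∃ A : Finset G, A.card = r ∧ (A + A).card = n}

set_option linter.unusedSectionVars false
namespace Kn
open Finset

variable {G : Type*} [AddCommGroup G] [Fintype G] [DecidableEq G]

open Classical in
/-- underlying finset of a subgroup -/
noncomputable def fs (L : AddSubgroup G) : Finset G := univ.filter (fun x => x ∈ L)

open Classical in
/-- coset -/
noncomputable def cos (L : AddSubgroup G) (a : G) : Finset G := univ.filter (fun x => x - a ∈ L)

/-- periodic -/
def per (L : AddSubgroup G) (X : Finset G) : Prop := ∀ g ∈ L, ∀ x ∈ X, g + x ∈ X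

/-- stabilizer -/
def stab (X : Finset G) : AddSubgroup G where
  carrier := {g | ∀ x, x ∈ X ↔ g + x ∈ X}
  zero_mem' := by simp
  add_mem' := by
    intro a b ha hb x
    rw [hb x, ha (b + x), add_assoc]
  neg_mem' := by
    intro a ha x
    rw [ha (-a + x)]; simp

lemma mem_fs {L : AddSubgroup G} {x : G} : x ∈ fs L ↔ x ∈ L := by simp [fs]

lemma mem_cos {L : AddSubgroup G} {a x : G} : x ∈ cos L a ↔ x - a ∈ L := by simp [cos]

lemma mem_stab {X : Finset G} {g : G} : g ∈ stab X ↔ ∀ x, x ∈ X ↔ g + x ∈ X := Iff.rfl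

lemma per_stab (X : Finset G) : per (stab X) X := fun _ hg x hx => (hg x).1 hx

lemma le_stab {L : AddSubgroup G} {X : Finset G} (h : per L X) : L ≤ stab X := by
  intro g hg x
  refine ⟨h g hg x, fun hx => ?_⟩
  have := h (-g) (neg_mem hg) _ hx
  simpa using this

lemma mem_hull {L : AddSubgroup G} {X : Finset G} {x : G} :
    x ∈ X + fs L ↔ ∃ y ∈ X, x - y ∈ L := by
  simp only [mem_add, mem_fs]
  constructor
  · rintro ⟨y, hy, z, hz, rfl⟩
    exact ⟨y, hy, by simpa using hz⟩
  · rintro ⟨y, hy, hz⟩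
    exact ⟨y, hy, _, hz, by abel⟩

lemma per_hull (L : AddSubgroup G) (X : Finset G) : per L (X + fs L) := by
  intro g hg x hx
  rw [mem_hull] at *
  obtain ⟨y, hy, h⟩ := hx
  refine ⟨y, hy, ?_⟩
  have := add_mem hg h
  rwa [add_sub_assoc]

lemma subset_hull (L : AddSubgroup G) (X : Finset G) : X ⊆ X + fs L := by
  intro x hx
  rw [mem_hull]
  exact ⟨x, hx, by simp⟩

lemma hull_mono {L M : AddSubgroup G} (h : L ≤ M) (X : Finset G) : X + fs L ⊆ X + fs M := by
  intro x hx
  rw [mem_hull] at *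
  obtain ⟨y, hy, hh⟩ := hx
  exact ⟨y, hy, h hh⟩

lemma fs_card_le {L M : AddSubgroup G} (h : L ≤ M) : #(fs L) ≤ #(fs M) :=
  card_le_card (fun x hx => mem_fs.2 (h (mem_fs.1 hx)))

lemma fs_card_pos (L : AddSubgroup G) : 0 < #(fs L) :=
  card_pos.2 ⟨0, mem_fs.2 (zero_mem _)⟩

lemma card_cos (L : AddSubgroup G) (a : G) : #(cos L a) = #(fs L) := by
  symm
  apply card_bij (fun x _ => x + a)
  · intro x hx; rw [mem_cos]; simpa using mem_fs.1 hx
  · intro x _ y _ h; simpa using h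
  · intro y hy; exact ⟨y - a, mem_fs.2 (mem_cos.1 hy), by simp⟩

lemma dvd_of_per {L : AddSubgroup G} {X : Finset G} (h : per L X) : #(fs L) ∣ #X := by
  classical
  rw [card_eq_sum_card_image (fun x => (QuotientAddGroup.mk x : G ⧸ L)) X]
  apply dvd_sum
  intro q hq
  obtain ⟨a, ha, rfl⟩ := mem_image.1 hq
  rw [← card_cos L a]
  apply dvd_of_eq
  congr 1
  ext x
  rw [mem_cos, mem_filter, eq_comm (b := (QuotientAddGroup.mk a : G ⧸ L)), QuotientAddGroup.eq]
  have e : -a + x = x - a := by abel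
  rw [e]
  constructor
  · intro hx
    refine ⟨?_, hx⟩
    have := h _ hx a ha
    simpa using this
  · exact fun hx => hx.2

/-- weak Kneser conclusion -/
def KnP (A B : Finset G) : Prop := ∃ L : AddSubgroup G, per L (A + B) ∧
  #(A + fs L) + #(B + fs L) ≤ #(A + B) + #(fs L)

/-- convergent -/
def Conv (A B C : Finset G) (K : AddSubgroup G) : Prop :=
  C ⊆ A + B ∧ C.Nonempty ∧ per K C ∧ #(A ∩ B) + #((A ∪ B) + fs K) ≤ #C + #(fs K)

lemma count1 {D : Finset G} {L K : AddSubgroup G} (hLK : L ≤ K) {a : G} (ha : a ∈ D) :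
    #(D + fs L) + #(fs K) ≤ #(D + fs K) + #((D + fs L) ∩ cos K a) := by
  have h1 : cos K a ⊆ D + fs K := fun x hx => mem_hull.2 ⟨a, ha, mem_cos.1 hx⟩
  have h2 : D + fs L ⊆ ((D + fs K) \ cos K a) ∪ ((D + fs L) ∩ cos K a) := by
    intro x hx
    have := hull_mono hLK D hx
    simp only [mem_union, mem_sdiff, mem_inter]
    tauto
  have h3 := (card_le_card h2).trans (card_union_le _ _)
  have h4 := card_sdiff_add_card_eq_card h1
  rw [card_cos] at h4
  omega

lemma count2 {D : Finset G} {L K : AddSubgroup G} (hLK : L ≤ K) {a b : G} (ha : a ∈ D)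
    (hb : b ∈ D) (hab : b - a ∉ K) :
    #(D + fs L) + 2 * #(fs K) ≤ #(D + fs K) + #((D + fs L) ∩ cos K a)
      + #((D + fs L) ∩ cos K b) := by
  have h1 : cos K a ∪ cos K b ⊆ D + fs K := by
    apply union_subset
    · exact fun x hx => mem_hull.2 ⟨a, ha, mem_cos.1 hx⟩
    · exact fun x hx => mem_hull.2 ⟨b, hb, mem_cos.1 hx⟩
  have hd : Disjoint (cos K a) (cos K b) := by
    rw [disjoint_left]
    intro x hx hx'
    apply hab
    have := sub_mem (mem_cos.1 hx) (mem_cos.1 hx')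
    simpa using this
  have h2 : D + fs L ⊆ ((D + fs K) \ (cos K a ∪ cos K b)) ∪ (((D + fs L) ∩ cos K a) ∪
      ((D + fs L) ∩ cos K b)) := by
    intro x hx
    have := hull_mono hLK D hx
    simp only [mem_union, mem_sdiff, mem_inter]
    tauto
  have h3 := (card_le_card h2).trans (card_union_le _ _)
  have h5 := card_union_le ((D + fs L) ∩ cos K a) ((D + fs L) ∩ cos K b)
  have h4 := card_sdiff_add_card_eq_card h1
  rw [card_union_of_disjoint hd, card_cos, card_cos] at h4
  omega

lemma part_le {A B : Finset G} {L K : AddSubgroup G} (hLK : L ≤ K) (a : G) :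
    #(((A ∪ B) + fs L) ∩ cos K a) ≤ #((A ∩ cos K a) + fs L) + #((B ∩ cos K a) + fs L) := by
  refine (card_le_card ?_).trans (card_union_le _ _)
  intro x hx
  rw [mem_inter, mem_hull, mem_cos] at hx
  obtain ⟨⟨y, hy, hxy⟩, hxa⟩ := hx
  have hya : y ∈ cos K a := by
    rw [mem_cos]
    have := sub_mem hxa (hLK hxy)
    simpa using this
  rw [mem_union, mem_hull, mem_hull]
  rcases mem_union.1 hy with h | h
  · exact Or.inl ⟨y, mem_inter.2 ⟨h, hya⟩, hxy⟩
  · exact Or.inr ⟨y, mem_inter.2 ⟨h, hya⟩, hxy⟩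

lemma part_le' (X : Finset G) (K : AddSubgroup G) (a : G) :
    #(X ∩ cos K a) ≤ #(fs K) := by
  rw [← card_cos K a]; exact card_le_card inter_subset_right

lemma conv_ext {A B C E : Finset G} {K L : AddSubgroup G} (hC : Conv A B C K)
    (hmin : ∀ C' K', Conv A B C' K' → #(fs K) ≤ #(fs K')) {z : G} (hz : z ∉ A + B)
    (hEC : E ⊆ A + B) (hEz : E ⊆ cos K z) (hL : per L E) (hLK : L ≤ K)
    (hlt : #(fs L) < #(fs K)) :
    #C + #E + #(fs L) < #(A ∩ B) + #((A ∪ B) + fs L) := by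
  by_contra hcon
  have hd : Disjoint C E := by
    rw [disjoint_left]
    intro y hy hyE
    apply hz
    apply hC.1
    have h1 := mem_cos.1 (hEz hyE)
    have := hC.2.2.1 _ (neg_mem h1) y hy
    simpa using this
  have : Conv A B (C ∪ E) L := by
    refine ⟨union_subset hC.1 hEC, hC.2.1.mono subset_union_left, ?_, ?_⟩
    · intro g hg x hx
      rcases mem_union.1 hx with h | h
      · exact mem_union_left _ (hC.2.2.1 g (hLK hg) x h)
      · exact mem_union_right _ (hL g hg x h)
    · rw [card_union_of_disjoint hd]; omega
  have := hmin _ _ this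
  omega

lemma step {A B C X Y : Finset G} {K : AddSubgroup G} (hC : Conv A B C K)
    (hmin : ∀ C' K', Conv A B C' K' → #(fs K) ≤ #(fs K')) {z : G} (hz : z ∉ A + B)
    (IH : ∀ A' B' : Finset G, A'.Nonempty → B'.Nonempty → #(A' + B') < #(A + B) → KnP A' B')
    (hX : X ⊆ A) (hY : Y ⊆ B) (hX0 : X.Nonempty) (hY0 : Y.Nonempty)
    (hXY : X + Y ⊆ cos K z) :
    ∃ L : AddSubgroup G, L ≤ K ∧ #(fs L) < #(fs K) ∧ per L (X + Y) ∧
      #(X + fs L) + #(Y + fs L) ≤ #(X + Y) + #(fs L) ∧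
      #C + #(X + Y) + #(fs L) < #(A ∩ B) + #((A ∪ B) + fs L) := by
  have hsub : X + Y ⊆ A + B := add_subset_add hX hY
  have hlt : #(X + Y) < #(A + B) := by
    apply card_lt_card
    refine ⟨hsub, fun h => ?_⟩
    obtain ⟨y, hy⟩ := hC.2.1
    apply hz
    apply hC.1
    have h1 := mem_cos.1 (hXY (h (hC.1 hy)))
    have := hC.2.2.1 _ (neg_mem h1) y hy
    simpa using this
  obtain ⟨L, hL, hineq⟩ := IH X Y hX0 hY0 hlt
  obtain ⟨e, he⟩ := hX0.add hY0
  have hLK : L ≤ K := by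
    intro g hg
    have h1 := mem_cos.1 (hXY (hL g hg e he))
    have h2 := mem_cos.1 (hXY he)
    have := sub_mem h1 h2
    simpa using this
  have hcard : #(fs L) < #(fs K) := by
    apply card_lt_card
    refine ⟨fun x hx => mem_fs.2 (hLK (mem_fs.1 hx)), fun h => ?_⟩
    apply hz
    apply hsub
    have h2 := mem_cos.1 (hXY he)
    have h3 := mem_fs.1 (h (mem_fs.2 (neg_mem h2)))
    have := hL _ h3 e he
    simpa using this
  exact ⟨L, hLK, hcard, hL, hineq, conv_ext hC hmin hz hsub hXY hL hLK hcard⟩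

lemma gap {l x y k : ℕ} (hx : l ∣ x) (hy : l ∣ y) (hk : l ∣ k) (h : x + y < k) :
    x + y + l ≤ k := by
  have := Nat.le_of_dvd (by omega) (Nat.dvd_sub hk (hx.add hy))
  omega

lemma dvd_fs {L K : AddSubgroup G} (h : L ≤ K) : #(fs L) ∣ #(fs K) :=
  dvd_of_per (fun _ hg _ hx => mem_fs.2 (add_mem (h hg) (mem_fs.1 hx)))

lemma core (A B : Finset G)
    (IH : ∀ A' B' : Finset G, A'.Nonempty → B'.Nonempty → #(A' + B') < #(A + B) → KnP A' B')
    (h0 : ∃ C K, Conv A B C K) :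
    #A + #B ≤ #(A + B) + #(fs (stab (A + B))) := by
  classical
  obtain ⟨C, K, hC, hmin⟩ : ∃ C K, Conv A B C K ∧
      ∀ C' K', Conv A B C' K' → #(fs K) ≤ #(fs K') := by
    have hex : ∃ n, ∃ C K, Conv A B C K ∧ #(fs K) = n := by
      obtain ⟨C, K, h⟩ := h0
      exact ⟨_, C, K, h, rfl⟩
    obtain ⟨C, K, h, hn⟩ := Nat.find_spec hex
    refine ⟨C, K, h, fun C' K' h' => ?_⟩
    rw [hn]
    exact Nat.find_min' hex ⟨C', K', h', rfl⟩
  have hconv := hC.2.2.2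
  by_cases hp : per K (A + B)
  · have h1 := fs_card_le (le_stab hp)
    have h2 := card_le_card hC.1
    have h3 := card_le_card (subset_hull K (A ∪ B))
    have h4 := card_union_add_card_inter A B
    omega
  exfalso
  unfold per at hp
  push Not at hp
  obtain ⟨g, hg, x, hx, hz⟩ := hp
  obtain ⟨a, ha, b, hb, rfl⟩ := mem_add.1 hx
  set z := g + (a + b) with hzdef
  have haD : a ∈ A ∪ B := mem_union_left _ ha
  have hbD : b ∈ A ∪ B := mem_union_right _ hb
  have hin : ∀ x y, x ∈ cos K a → y ∈ cos K b → x + y ∈ cos K z := by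
    intro x y hx hy
    rw [mem_cos] at *
    have := sub_mem (add_mem hx hy) hg
    have e : x - a + (y - b) - g = x + y - z := by rw [hzdef]; abel
    rwa [e] at this
  have hself : ∀ c, c ∈ cos K c := fun c => by rw [mem_cos]; simp
  have hs1 : (A ∩ cos K a) + (B ∩ cos K b) ⊆ cos K z := by
    intro w hw
    obtain ⟨x, hx, y, hy, rfl⟩ := mem_add.1 hw
    exact hin x y (mem_inter.1 hx).2 (mem_inter.1 hy).2
  have hs2 : (A ∩ cos K b) + (B ∩ cos K a) ⊆ cos K z := by
    intro w hw
    obtain ⟨x, hx, y, hy, rfl⟩ := mem_add.1 hw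
    rw [add_comm]
    exact hin y x (mem_inter.1 hy).2 (mem_inter.1 hx).2
  obtain ⟨L, hLK, hlt, hL, hineq, hnc⟩ := step hC hmin hz IH (X := A ∩ cos K a)
    (Y := B ∩ cos K b) inter_subset_left inter_subset_left
    ⟨a, mem_inter.2 ⟨ha, hself a⟩⟩ ⟨b, mem_inter.2 ⟨hb, hself b⟩⟩ hs1
  by_cases hab : b - a ∈ K
  · have hcos : cos K a = cos K b := by
      ext x
      rw [mem_cos, mem_cos]
      constructor
      · intro h; have := sub_mem h hab; simpa using this
      · intro h; have := add_mem h hab; simpa using this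
    have h1 := count1 hLK haD
    have h2 := part_le (A := A) (B := B) hLK a
    rw [← hcos] at hineq hnc
    omega
  have hc := count2 hLK haD hbD hab
  have hua := part_le (A := A) (B := B) hLK a
  have hub := part_le (A := A) (B := B) hLK b
  have hka := part_le' ((A ∪ B) + fs L) K a
  have hkb := part_le' ((A ∪ B) + fs L) K b
  rcases (B ∩ cos K a).eq_empty_or_nonempty with he | hB2
  · rw [he, empty_add, card_empty] at hua
    omega
  rcases (A ∩ cos K b).eq_empty_or_nonempty with he | hA2
  · rw [he, empty_add, card_empty] at hub
    omega
  obtain ⟨M, hMK, hlt', hM, hineq', hnc'⟩ := step hC hmin hz IH (X := A ∩ cos K b)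
    (Y := B ∩ cos K a) inter_subset_left inter_subset_left hA2 hB2 hs2
  have hPK : L ⊓ M ≤ K := inf_le_left.trans hLK
  have h3 := conv_ext (L := L ⊓ M)
    (E := ((A ∩ cos K a) + (B ∩ cos K b)) ∪ ((A ∩ cos K b) + (B ∩ cos K a)))
    hC hmin hz (union_subset (add_subset_add inter_subset_left inter_subset_left)
      (add_subset_add inter_subset_left inter_subset_left)) (union_subset hs1 hs2)
    (by
      intro g hg x hx
      rcases mem_union.1 hx with h | h
      · exact mem_union_left _ (hL g hg.1 x h)
      · exact mem_union_right _ (hM g hg.2 x h)) hPK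
      ((fs_card_le inf_le_left).trans_lt hlt)
  have hc3 := count2 hPK haD hbD hab
  have hua3 := part_le (A := A) (B := B) hPK a
  have hub3 := part_le (A := A) (B := B) hPK b
  have m1 := card_le_card (hull_mono (inf_le_left : L ⊓ M ≤ L) (A ∩ cos K a))
  have m2 := card_le_card (hull_mono (inf_le_left : L ⊓ M ≤ L) (B ∩ cos K b))
  have m3 := card_le_card (hull_mono (inf_le_right : L ⊓ M ≤ M) (A ∩ cos K b))
  have m4 := card_le_card (hull_mono (inf_le_right : L ⊓ M ≤ M) (B ∩ cos K a))
  have e1 := card_le_card (subset_union_left (s₁ := (A ∩ cos K a) + (B ∩ cos K b))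
    (s₂ := (A ∩ cos K b) + (B ∩ cos K a)))
  have e2 := card_le_card (subset_union_right (s₁ := (A ∩ cos K a) + (B ∩ cos K b))
    (s₂ := (A ∩ cos K b) + (B ∩ cos K a)))
  have d1 := card_le_card (hull_mono hLK (A ∪ B))
  have d2 := card_le_card (hull_mono hMK (A ∪ B))
  have g1 := gap (dvd_of_per (per_hull L (A ∩ cos K a))) (dvd_of_per (per_hull L (B ∩ cos K b)))
    (dvd_fs hLK) (by omega)
  have g2 := gap (dvd_of_per (per_hull M (A ∩ cos K b))) (dvd_of_per (per_hull M (B ∩ cos K a)))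
    (dvd_fs hMK) (by omega)
  omega

lemma stab_translate (X : Finset G) (t : G) : stab (X + {t}) = stab X := by
  have key : ∀ y, y ∈ X + {t} ↔ y - t ∈ X := by
    intro y
    rw [mem_add]
    constructor
    · rintro ⟨u, hu, v, hv, rfl⟩
      rw [mem_singleton.1 hv]; simpa using hu
    · intro h
      exact ⟨_, h, t, mem_singleton_self t, by abel⟩
  ext g
  simp only [mem_stab, key]
  constructor
  · intro h x
    have := h (x + t)
    have e : g + (x + t) - t = g + x := by abel
    rw [e] at this
    simpa using this
  · intro h x
    rw [h (x - t), add_sub_assoc]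

lemma per_inter {L : AddSubgroup G} {X Y : Finset G} (hX : per L X) (hY : per L Y) :
    per L (X ∩ Y) := fun g hg x hx =>
  mem_inter.2 ⟨hX g hg x (mem_inter.1 hx).1, hY g hg x (mem_inter.1 hx).2⟩

lemma per_union {L : AddSubgroup G} {X Y : Finset G} (hX : per L X) (hY : per L Y) :
    per L (X ∪ Y) := by
  intro g hg x hx
  rcases mem_union.1 hx with h | h
  · exact mem_union_left _ (hX g hg x h)
  · exact mem_union_right _ (hY g hg x h)

lemma hull_eq {L : AddSubgroup G} {X : Finset G} (h : per L X) : X + fs L = X := by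
  refine Subset.antisymm ?_ (subset_hull L X)
  intro x hx
  obtain ⟨y, hy, hxy⟩ := mem_hull.1 hx
  have := h _ hxy y hy
  simpa using this

lemma per_translate {L : AddSubgroup G} {X : Finset G} (h : per L X) (t : G) :
    per L (X + {t}) := by
  intro g hg x hx
  obtain ⟨u, hu, v, hv, rfl⟩ := mem_add.1 hx
  rw [← add_assoc]
  exact add_mem_add (h g hg u hu) hv

lemma inner (n : ℕ)
    (IH : ∀ A' B' : Finset G, A'.Nonempty → B'.Nonempty → #(A' + B') < n → KnP A' B') :
    ∀ m : ℕ, ∀ A B : Finset G, A.Nonempty → B.Nonempty → #A = m → #(A + B) = n →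
      per (stab (A + B)) A → per (stab (A + B)) B →
      #A + #B ≤ #(A + B) + #(fs (stab (A + B))) := by
  intro m
  induction m using Nat.strong_induction_on with
  | _ m ihm =>
  intro A B hA hB hm hn pA pB
  by_cases hcase : ∀ a ∈ A, ∀ a' ∈ A, ∀ b ∈ B, b + (a' - a) ∈ B
  · obtain ⟨a0, ha0⟩ := hA
    have h1 : A ⊆ cos (stab (A + B)) a0 := by
      intro a ha
      rw [mem_cos]
      have aux : ∀ u ∈ A, ∀ v ∈ A, ∀ x ∈ A + B, (u - v) + x ∈ A + B := by
        intro u hu v hv x hx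
        obtain ⟨c, hc, d, hd, rfl⟩ := mem_add.1 hx
        have := add_mem_add hc (hcase v hv u hu d hd)
        have e : u - v + (c + d) = c + (d + (u - v)) := by abel
        rwa [e]
      intro x
      refine ⟨aux a ha a0 ha0 x, fun hx => ?_⟩
      have := aux a0 ha0 a ha _ hx
      have e : a0 - a + (a - a0 + x) = x := by abel
      rwa [e] at this
    have h2 := card_le_card h1
    rw [card_cos] at h2
    have h3 : #B ≤ #(A + B) := card_le_card_add_left ⟨a0, ha0⟩
    omega
  push Not at hcase
  obtain ⟨a, ha, a', ha', b, hb, hnb⟩ := hcase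
  set t := a - b with ht
  set B' := B + {t} with hB'
  have hsum : A + B' = (A + B) + {t} := by rw [hB', add_assoc]
  have hst : stab (A + B') = stab (A + B) := by rw [hsum, stab_translate]
  have hcB : #B' = #B := by rw [hB', card_add_singleton]
  have hcS : #(A + B') = #(A + B) := by rw [hsum, card_add_singleton]
  have pB' : per (stab (A + B)) B' := per_translate pB t
  have haB : a ∈ B' := mem_add.2 ⟨b, hb, t, mem_singleton_self t, by rw [ht]; abel⟩
  have haB' : a' ∉ B' := by
    intro h
    obtain ⟨u, hu, v, hv, huv⟩ := mem_add.1 h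
    rw [mem_singleton] at hv
    apply hnb
    have e : b + (a' - a) = u := by rw [← huv, hv, ht]; abel
    rwa [e]
  rw [← hcB, ← hcS, ← hst]
  apply core
  · intro X Y hX hY h
    exact IH X Y hX hY (by omega)
  have hIne : (A ∩ B').Nonempty := ⟨a, mem_inter.2 ⟨ha, haB⟩⟩
  have hUne : (A ∪ B').Nonempty := ⟨a, mem_union_left _ ha⟩
  have hsub : (A ∩ B') + (A ∪ B') ⊆ A + B' := by
    intro w hw
    obtain ⟨x, hx, y, hy, rfl⟩ := mem_add.1 hw
    rw [mem_inter] at hx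
    rcases mem_union.1 hy with h | h
    · rw [add_comm x y]; exact add_mem_add h hx.2
    · exact add_mem_add hx.1 h
  by_cases hlt : #((A ∩ B') + (A ∪ B')) < n
  · obtain ⟨K, hK, hKi⟩ := IH _ _ hIne hUne hlt
    refine ⟨_, K, hsub, hIne.add hUne, hK, ?_⟩
    have := card_le_card (subset_hull K (A ∩ B'))
    omega
  · have heq : (A ∩ B') + (A ∪ B') = A + B' := eq_of_subset_of_card_le hsub (by omega)
    have hIlt : #(A ∩ B') < m := by
      rw [← hm]
      apply card_lt_card
      exact ⟨inter_subset_left, fun h => haB' (mem_inter.1 (h ha')).2⟩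
    have pI := per_inter pA pB'
    have pU := per_union pA pB'
    rw [← hst, ← heq] at pI pU
    have := ihm _ hIlt _ _ hIne hUne rfl (by rw [heq]; omega) pI pU
    refine ⟨_, _, hsub, hIne.add hUne, per_stab _, ?_⟩
    rw [hull_eq pU]
    exact this

theorem kneser : ∀ n : ℕ, ∀ A B : Finset G, A.Nonempty → B.Nonempty → #(A + B) = n → KnP A B := by
  intro n
  induction n using Nat.strong_induction_on with
  | _ n ih =>
  intro A B hA hB hn
  have hF : (fs (stab (A + B))).Nonempty := card_pos.1 (fs_card_pos _)
  have hsum : (A + fs (stab (A + B))) + (B + fs (stab (A + B))) = A + B := by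
    have e : (A + fs (stab (A + B))) + (B + fs (stab (A + B)))
        = ((A + B) + fs (stab (A + B))) + fs (stab (A + B)) := by abel
    rw [e, hull_eq (per_stab _), hull_eq (per_stab _)]
  have := inner n (fun X Y hX hY h => ih _ h X Y hX hY rfl) _
    (A + fs (stab (A + B))) (B + fs (stab (A + B))) (hA.add hF) (hB.add hF) rfl
    (by rw [hsum, hn]) (by rw [hsum]; exact per_hull _ _) (by rw [hsum]; exact per_hull _ _)
  rw [hsum] at this
  exact ⟨stab (A + B), per_stab _, this⟩

lemma construct (N : ℕ) [NeZero N] (r : ℕ) (hr : 1 ≤ r) (A B : Finset (ZMod N))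
    (hA : #A = r) (hB : #B = r) :
    ∃ X : Finset (ZMod N), #X = r ∧ #(X + X) ≤ #(A + B) ∧ #(X - X) ≤ #(A + B) := by
  obtain ⟨H, -, hH⟩ := kneser _ A B (card_pos.1 (by omega)) (card_pos.1 (by omega)) rfl
  obtain ⟨c1, hc1⟩ := dvd_of_per (per_hull H A)
  obtain ⟨c2, hc2⟩ := dvd_of_per (per_hull H B)
  have hA' := card_le_card (subset_hull H A)
  have hB' := card_le_card (subset_hull H B)
  have hpos := fs_card_pos H
  have hNle := card_le_univ (A + fs H)
  have hNle2 := card_le_univ (B + fs H)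
  rw [ZMod.card] at hNle hNle2
  obtain ⟨c, hcr, hcN, hcS⟩ : ∃ c, r ≤ #(fs H) * c ∧ #(fs H) * c ≤ N ∧
      2 * (#(fs H) * c) ≤ #(A + B) + #(fs H) := by
    rcases le_total (#(fs H) * c1) (#(fs H) * c2) with h | h
    · exact ⟨c1, by omega, by omega, by omega⟩
    · exact ⟨c2, by omega, by omega, by omega⟩
  have hc0 : 0 < c := Nat.pos_of_ne_zero (by rintro rfl; omega)
  set h := #(fs H) with hh
  have hann : ∀ x ∈ H, h • x = 0 := by
    intro x hx
    have e : h = Nat.card H := by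
      classical
      rw [hh, Nat.card_eq_fintype_card, Fintype.card_subtype]
      congr 1
    rw [e]
    have := card_nsmul_eq_zero' (x := (⟨x, hx⟩ : H))
    have h2 := congrArg Subtype.val this
    rwa [AddSubgroup.coe_nsmul] at h2
  set I : Finset (ZMod N) := (range c).image (fun i : ℕ => (i : ZMod N)) + fs H with hI
  have hIc : #I = h * c := by
    have : #I = #(range c ×ˢ fs H) := by
      symm
      apply card_bij (fun p _ => (p.1 : ZMod N) + p.2)
      · rintro ⟨i, x⟩ hp
        rw [mem_product] at hp
        exact add_mem_add (mem_image_of_mem _ hp.1) hp.2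
      · have key : ∀ i < c, ∀ j < c, ∀ x ∈ H, ∀ y ∈ H, (i : ZMod N) + x = j + y → i ≤ j := by
          intro i hi j hj x hx y hy hxy
          by_contra hlt
          push Not at hlt
          have h1 : ((i - j : ℕ) : ZMod N) = y - x := by
            rw [Nat.cast_sub hlt.le]; linear_combination hxy
          have h2 := hann _ (sub_mem hy hx)
          rw [← h1, nsmul_eq_mul, ← Nat.cast_mul, ZMod.natCast_eq_zero_iff] at h2
          have h3 := Nat.le_of_dvd (Nat.mul_pos hpos (by omega)) h2
          have h4 : h * (i - j) < h * c := Nat.mul_lt_mul_of_pos_left (by omega) hpos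
          omega
        rintro ⟨i, x⟩ hp ⟨j, y⟩ hq hpq
        simp only [mem_product, mem_range, mem_fs] at hp hq hpq
        have hij : i = j := le_antisymm (key i hp.1 j hq.1 x hp.2 y hq.2 hpq)
          (key j hq.1 i hp.1 y hq.2 x hp.2 hpq.symm)
        subst hij
        simpa using hpq
      · intro w hw
        obtain ⟨u, hu, x, hx, rfl⟩ := mem_add.1 hw
        obtain ⟨i, hi, rfl⟩ := mem_image.1 hu
        exact ⟨(i, x), mem_product.2 ⟨hi, hx⟩, rfl⟩
    rw [this, card_product, card_range, mul_comm]
  obtain ⟨X, hXI, hX⟩ := exists_subset_card_eq (hcr.trans hIc.ge)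
  have bound : ∀ (s : ZMod N) (Y : Finset (ZMod N)),
      Y ⊆ (range (2 * c - 1)).image (fun i : ℕ => (i : ZMod N) + s) + fs H → #Y ≤ #(A + B) := by
    intro s Y hY
    have h1 := (card_le_card hY).trans card_add_le
    rw [← hh] at h1
    have h2 : #((range (2 * c - 1)).image (fun i : ℕ => (i : ZMod N) + s)) ≤ 2 * c - 1 :=
      card_image_le.trans (by simp)
    have h3 := Nat.mul_le_mul_right h h2
    have h4 : (2 * c - 1) * h + h = 2 * (h * c) := by
      obtain ⟨d, rfl⟩ : ∃ d, c = d + 1 := ⟨c - 1, by omega⟩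
      have : 2 * (d + 1) - 1 = 2 * d + 1 := by omega
      rw [this]; ring
    omega
  refine ⟨X, hX, bound 0 _ ?_, bound (-((c - 1 : ℕ) : ZMod N)) _ ?_⟩
  · intro w hw
    obtain ⟨u, hu, v, hv, rfl⟩ := mem_add.1 hw
    obtain ⟨p, hp, x, hx, rfl⟩ := mem_add.1 (hXI hu)
    obtain ⟨q, hq, y, hy, rfl⟩ := mem_add.1 (hXI hv)
    obtain ⟨i, hi, rfl⟩ := mem_image.1 hp
    obtain ⟨j, hj, rfl⟩ := mem_image.1 hq
    rw [mem_range] at hi hj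
    refine mem_add.2 ⟨_, mem_image.2 ⟨i + j, mem_range.2 (by omega), rfl⟩, x + y,
      mem_fs.2 (add_mem (mem_fs.1 hx) (mem_fs.1 hy)), ?_⟩
    push_cast; ring
  · intro w hw
    obtain ⟨u, hu, v, hv, rfl⟩ := mem_sub.1 hw
    obtain ⟨p, hp, x, hx, rfl⟩ := mem_add.1 (hXI hu)
    obtain ⟨q, hq, y, hy, rfl⟩ := mem_add.1 (hXI hv)
    obtain ⟨i, hi, rfl⟩ := mem_image.1 hp
    obtain ⟨j, hj, rfl⟩ := mem_image.1 hq
    rw [mem_range] at hi hj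
    refine mem_add.2 ⟨_, mem_image.2 ⟨i + (c - 1 - j), mem_range.2 (by omega), rfl⟩, x - y,
      mem_fs.2 (sub_mem (mem_fs.1 hx) (mem_fs.1 hy)), ?_⟩
    rw [Nat.cast_add, Nat.cast_sub (by omega : j ≤ c - 1)]; ring

end Kn

/-- Remark: for the cyclic group `G = ℤ/Nℤ` and `1 ≤ r ≤ N`, `ρ⁻_G(r) = ρ⁺_G(r)`. -/
theorem rhoMinus_eq_rhoPlus_cyclic (N : ℕ) [NeZero N] (r : ℕ) (hr1 : 1 ≤ r) (hrN : r ≤ N) :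
    rhoMinus (ZMod N) r = rhoPlus (ZMod N) r := by
  obtain ⟨A0, -, hA0⟩ := Finset.exists_subset_card_eq
    (s := (Finset.univ : Finset (ZMod N))) (n := r) (by rw [Finset.card_univ, ZMod.card]; exact hrN)
  apply le_antisymm
  · obtain ⟨A, hA, hAn⟩ := Nat.sInf_mem
      (⟨_, A0, hA0, rfl⟩ : {n : ℕ | ∃ A : Finset (ZMod N), A.card = r ∧ (A + A).card = n}.Nonempty)
    obtain ⟨X, hX, -, h2⟩ := Kn.construct N r hr1 A A hA hA
    refine (Nat.sInf_le ⟨X, hX, rfl⟩ : rhoMinus (ZMod N) r ≤ _).trans (h2.trans hAn.le)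
  · obtain ⟨A, hA, hAn⟩ := Nat.sInf_mem
      (⟨_, A0, hA0, rfl⟩ : {n : ℕ | ∃ A : Finset (ZMod N), A.card = r ∧ (A - A).card = n}.Nonempty)
    obtain ⟨X, hX, h1, -⟩ := Kn.construct N r hr1 A (-A) hA (by rw [Finset.card_neg]; exact hA)
    rw [← sub_eq_add_neg] at h1
    refine (Nat.sInf_le ⟨X, hX, rfl⟩ : rhoPlus (ZMod N) r ≤ _).trans (h1.trans hAn.le)
end
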